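/- Let L(s) = L(s,χ) be the Dirichlet L-function of a primitive Dirichlet character χ, and let 0 < α < 1/2 and ε > 0. Then there is a constant C > 0 such that for all T ≥ 2, ∑ m(σ) ≤ C·T^{(5/2)α + ε}, where the sum runs over all zeros σ of L with 0 < Re σ < α and 0 < Im σ < T, counted with multiplicity m(σ). -/

import Mathlib

section
open Complex

namespace ZD

/-- The Gaussian beats polynomials. -/
lemma gauss_poly (K : ℕ) : ∃ C : ℝ, 0 < C ∧ ∀ u : ℝ, Real.exp (-u ^ 2) * (1 + |u|) ^ K ≤ C := by
  refine ⟨Real.exp (K ^ 2), Real.exp_pos _, fun u => ?_⟩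
  have h1 : (1 + |u|) ^ K ≤ Real.exp (K * |u|) := by
    have : 1 + |u| ≤ Real.exp |u| := by linarith [Real.add_one_le_exp |u|]
    calc (1 + |u|) ^ K ≤ (Real.exp |u|) ^ K := by gcongr
      _ = _ := by rw [← Real.exp_nat_mul]
  calc _ ≤ Real.exp (-u ^ 2) * Real.exp (K * |u|) := by gcongr
    _ = Real.exp (-u ^ 2 + K * |u|) := by rw [Real.exp_add]
    _ ≤ _ := by
      apply Real.exp_le_exp.mpr
      have : u ^ 2 = |u| ^ 2 := (sq_abs u).symm
      nlinarith [sq_nonneg (|u| - K / 2), sq_nonneg (K : ℝ)]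

lemma gauss_exp (B : ℝ) (u : ℝ) : Real.exp (-u ^ 2) * Real.exp (B * |u|) ≤ Real.exp (B ^ 2) := by
  rw [← Real.exp_add]
  apply Real.exp_le_exp.mpr
  have : u ^ 2 = |u| ^ 2 := (sq_abs u).symm
  nlinarith [sq_nonneg (|u| - B / 2), sq_nonneg B]

lemma norm_exp_sq (z : ℂ) : ‖cexp (z ^ 2)‖ = Real.exp (z.re ^ 2 - z.im ^ 2) := by
  rw [Complex.norm_exp]
  congr 1
  simp [sq]

/-- Vector valued three lines theorem with polynomial growth on the boundary. -/
lemma three_lines (b c : ℝ) (hbc : b < c) (K : ℕ) : ∃ C : ℝ, 0 < C ∧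
    ∀ (ι : Type) [Fintype ι] (F : ι → ℂ → ℂ) (A0 A1 : ℝ), 0 ≤ A0 → 0 ≤ A1 →
    (∀ i z, b ≤ z.re → z.re ≤ c → DifferentiableAt ℂ (F i) z) →
    (∀ i, ∃ B : ℝ, ∀ z : ℂ, b ≤ z.re → z.re ≤ c → ‖F i z‖ ≤ B * Real.exp (B * |z.im|)) →
    (∀ u : ℝ, ∑ i, ‖F i (b + u * I)‖ ^ 2 ≤ A0 * (1 + |u|) ^ K) →
    (∀ u : ℝ, ∑ i, ‖F i (c + u * I)‖ ^ 2 ≤ A1 * (1 + |u|) ^ K) →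
    ∀ x : ℝ, b ≤ x → x ≤ c →
      ∑ i, ‖F i x‖ ^ 2 ≤ C * (A0 ^ (1 - (x - b) / (c - b)) * A1 ^ ((x - b) / (c - b))) := by
  obtain ⟨C0, hC0, hC⟩ := gauss_poly K
  set D : ℝ := Real.exp (2 * (b ^ 2 + c ^ 2)) * C0 with hD
  have hDpos : 0 < D := by positivity
  refine ⟨D, hDpos, ?_⟩
  intro ι _ F A0 A1 hA0 hA1 hdiff hgrow hb hc x hbx hxc
  -- the vector valued function
  let G : ℂ → EuclideanSpace ℂ ι := fun z => WithLp.toLp 2 (fun i => cexp (z ^ 2) * F i z)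
  have hGn : ∀ z, ‖G z‖ ^ 2 = Real.exp (z.re ^ 2 - z.im ^ 2) ^ 2 * ∑ i, ‖F i z‖ ^ 2 := by
    intro z
    rw [EuclideanSpace.norm_sq_eq, Finset.mul_sum]
    refine Finset.sum_congr rfl fun i _ => ?_
    simp only [G, norm_mul, norm_exp_sq]
    ring
  have hGd : ∀ z, b ≤ z.re → z.re ≤ c → DifferentiableAt ℂ G z := by
    intro z h1 h2
    rw [differentiableAt_euclidean]
    intro i
    simp only [G]
    exact ((differentiableAt_id.pow 2).cexp).mul (hdiff i z h1 h2)
  have hcl : closure (HadamardThreeLines.verticalStrip b c) ⊆ {z : ℂ | b ≤ z.re ∧ z.re ≤ c} := by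
    apply closure_minimal
    · intro z hz
      exact ⟨hz.1.le, hz.2.le⟩
    · exact (isClosed_le continuous_const continuous_re).inter (isClosed_le continuous_re continuous_const)
  have hGdc : DiffContOnCl ℂ G (HadamardThreeLines.verticalStrip b c) := by
    refine ⟨fun z hz => (hGd z hz.1.le hz.2.le).differentiableWithinAt, fun z hz => ?_⟩
    exact (hGd z (hcl hz).1 (hcl hz).2).continuousAt.continuousWithinAt
  have hbdd : BddAbove ((norm ∘ G) '' HadamardThreeLines.verticalClosedStrip b c) := by
    choose B hB using hgrow
    refine ⟨Real.exp (b ^ 2 + c ^ 2) * ∑ i, |B i| * Real.exp (B i ^ 2), ?_⟩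
    rintro _ ⟨z, hz, rfl⟩
    have hz' : b ≤ z.re ∧ z.re ≤ c := hz
    have h1 : ‖G z‖ ≤ ∑ i, ‖cexp (z ^ 2) * F i z‖ := by
      rw [EuclideanSpace.norm_eq]
      apply Real.sqrt_le_iff.mpr
      refine ⟨by positivity, ?_⟩
      exact Finset.sum_sq_le_sq_sum_of_nonneg (fun i _ => norm_nonneg _)
    refine h1.trans ?_
    rw [Finset.mul_sum]
    refine Finset.sum_le_sum fun i _ => ?_
    rw [norm_mul, norm_exp_sq]
    have h2 := hB i z hz'.1 hz'.2
    have h3 : z.re ^ 2 ≤ b ^ 2 + c ^ 2 := by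
      rcases le_total 0 z.re with h | h
      · nlinarith [sq_nonneg b, hz'.2]
      · nlinarith [sq_nonneg c, hz'.1]
    calc _ ≤ (Real.exp (b ^ 2 + c ^ 2) * Real.exp (-z.im ^ 2)) * (|B i| * Real.exp (B i * |z.im|)) := by
          gcongr
          · rw [← Real.exp_add]
            apply Real.exp_le_exp.mpr; linarith
          · refine h2.trans ?_
            gcongr
            exact le_abs_self _
      _ = Real.exp (b ^ 2 + c ^ 2) * (|B i| * (Real.exp (-z.im ^ 2) * Real.exp (B i * |z.im|))) := by ring
      _ ≤ _ := by gcongr; exact gauss_exp _ _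
  have hline : ∀ (d A : ℝ), 0 ≤ A → d ^ 2 ≤ b ^ 2 + c ^ 2 →
      (∀ u : ℝ, ∑ i, ‖F i (d + u * I)‖ ^ 2 ≤ A * (1 + |u|) ^ K) →
      ∀ z ∈ re ⁻¹' {d}, ‖G z‖ ≤ (D * A) ^ (1 / 2 : ℝ) := by
    intro d A hA hd h z hz
    have hz' : z.re = d := hz
    have hzz : z = (d : ℂ) + (z.im : ℂ) * I := by
      rw [← hz', re_add_im]
    rw [← Real.sqrt_eq_rpow]
    apply Real.le_sqrt_of_sq_le
    rw [hGn]
    have h1 := h z.im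
    rw [← hzz] at h1
    calc _ ≤ Real.exp (z.re ^ 2 - z.im ^ 2) ^ 2 * (A * (1 + |z.im|) ^ K) := by gcongr
      _ = A * (Real.exp (2 * (z.re ^ 2 - z.im ^ 2)) * (1 + |z.im|) ^ K) := by
          rw [← Real.exp_nat_mul]; push_cast; ring
      _ ≤ A * (Real.exp (2 * (b ^ 2 + c ^ 2)) * Real.exp (-z.im ^ 2) * (1 + |z.im|) ^ K) := by
          gcongr
          rw [← Real.exp_add]
          apply Real.exp_le_exp.mpr
          rw [hz']; nlinarith [sq_nonneg z.im]
      _ = A * (Real.exp (2 * (b ^ 2 + c ^ 2)) * (Real.exp (-z.im ^ 2) * (1 + |z.im|) ^ K)) := by ring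
      _ ≤ A * (Real.exp (2 * (b ^ 2 + c ^ 2)) * C0) := by gcongr; exact hC _
      _ = D * A := by rw [hD]; ring
  have hmain := HadamardThreeLines.norm_le_interp_of_mem_verticalClosedStrip' hbc (z := (x : ℂ))
    (show (x : ℂ) ∈ HadamardThreeLines.verticalClosedStrip b c from ⟨by simpa using hbx, by simpa using hxc⟩)
    hGdc hbdd
    (hline b A0 hA0 (by nlinarith [sq_nonneg c]) hb) (hline c A1 hA1 (by nlinarith [sq_nonneg b]) hc)
  simp only [ofReal_re] at hmain
  have hcb : 0 < c - b := by linarith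
  set θ := (x - b) / (c - b) with hθ
  have hθ0 : 0 ≤ θ := div_nonneg (by linarith) hcb.le
  have hθ1 : θ ≤ 1 := by rw [hθ, div_le_one hcb]; linarith
  have h2 : ‖G x‖ ^ 2 ≤ D * (A0 ^ (1 - θ) * A1 ^ θ) := by
    calc ‖G x‖ ^ 2 ≤ (((D * A0) ^ (1 / 2 : ℝ)) ^ (1 - θ) * ((D * A1) ^ (1 / 2 : ℝ)) ^ θ) ^ 2 := by
          gcongr
      _ = (D * A0) ^ (1 - θ) * (D * A1) ^ θ := by
          rw [mul_pow, ← Real.rpow_mul (by positivity), ← Real.rpow_mul (by positivity),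
            ← Real.rpow_mul_natCast (by positivity), ← Real.rpow_mul_natCast (by positivity)]
          congr 2 <;> (push_cast; ring)
      _ = (D ^ (1 - θ) * D ^ θ) * (A0 ^ (1 - θ) * A1 ^ θ) := by
          rw [Real.mul_rpow hDpos.le hA0, Real.mul_rpow hDpos.le hA1]; ring
      _ = _ := by
          rw [← Real.rpow_add hDpos]; simp
  rw [hGn] at h2
  refine le_trans ?_ h2
  simp only [ofReal_re, ofReal_im]
  have : 1 ≤ Real.exp (x ^ 2 - 0 ^ 2) ^ 2 := by
    apply one_le_pow₀
    apply Real.one_le_exp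
    nlinarith [sq_nonneg x]
  exact le_mul_of_one_le_left (by positivity) this

/-- Passing from a circle to points inside, in the mean square sense. -/
lemma sampling {ι : Type} [Fintype ι] (G : ι → ℂ → ℂ) (a : ℂ) (ρ η B : ℝ) (hη : 0 < η)
    (w : ι → ℂ) (hw : ∀ i, ‖w i - a‖ ≤ ρ - η) (hρ : 0 < ρ)
    (hd : ∀ i, ∀ z ∈ Metric.closedBall a ρ, DifferentiableAt ℂ (G i) z)
    (hB : ∀ z ∈ Metric.sphere a ρ, ∑ i, ‖G i z‖ ^ 2 ≤ B) :
    ∑ i, ‖G i (w i)‖ ^ 2 ≤ (ρ / η) ^ 2 * B := by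
  have hB0 : 0 ≤ B := by
    have hmem : a + ρ ∈ Metric.sphere a ρ := by simp [hρ.le]
    exact le_trans (by positivity) (hB _ hmem)
  have hcont : ∀ i, ContinuousOn (fun z => (z - w i)⁻¹ * G i z) (Metric.sphere a ρ) := by
    intro i
    apply ContinuousOn.mul
    · apply ContinuousOn.inv₀ (by fun_prop)
      intro z hz h0
      have : z = w i := sub_eq_zero.mp h0
      have h1 := hw i
      rw [← this] at h1
      have h2 : ‖z - a‖ = ρ := by simpa [dist_eq_norm] using hz
      linarith
    · exact fun z hz => (hd i z (Metric.sphere_subset_closedBall hz)).continuousAt.continuousWithinAt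
  let H : ℂ → EuclideanSpace ℂ ι := fun z => WithLp.toLp 2 (fun i => (z - w i)⁻¹ * G i z)
  have hcauchy : ∀ i, ∮ z in C(a, ρ), (z - w i)⁻¹ * G i z = (2 * Real.pi * I) * G i (w i) := by
    intro i
    have := DiffContOnCl.circleIntegral_sub_inv_smul (f := G i) (c := a) (R := ρ) (w := w i)
      ⟨fun z hz => (hd i z (Metric.ball_subset_closedBall hz)).differentiableWithinAt,
        fun z hz => (hd i z (Metric.closure_ball_subset_closedBall hz)).continuousAt.continuousWithinAt⟩
      (by rw [Metric.mem_ball, dist_eq_norm]; have := hw i; linarith)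
    simpa [smul_eq_mul] using this
  have hHc : ContinuousOn H (Metric.sphere a ρ) := by
    have : ContinuousOn (fun z => (fun i => (z - w i)⁻¹ * G i z)) (Metric.sphere a ρ) :=
      continuousOn_pi.mpr hcont
    exact (PiLp.continuous_toLp 2 _).comp_continuousOn this
  have hHi : CircleIntegrable H a ρ := hHc.circleIntegrable hρ.le
  have hcomp : ∀ i, (∮ z in C(a, ρ), H z) i = ∮ z in C(a, ρ), (z - w i)⁻¹ * G i z := by
    intro i
    have h1 := (EuclideanSpace.proj i : EuclideanSpace ℂ ι →L[ℂ] ℂ).intervalIntegral_comp_comm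
      (f := fun θ : ℝ => deriv (circleMap a ρ) θ • H (circleMap a ρ θ)) (a := 0) (b := 2 * Real.pi)
      hHi.out
    unfold circleIntegral
    simpa [H] using h1.symm
  have hnorm : ‖∮ z in C(a, ρ), H z‖ ≤ 2 * Real.pi * ρ * (η⁻¹ * Real.sqrt B) := by
    apply circleIntegral.norm_integral_le_of_norm_le_const hρ.le
    intro z hz
    rw [EuclideanSpace.norm_eq]
    have h1 : η⁻¹ * Real.sqrt B = Real.sqrt (η⁻¹ ^ 2 * B) := by
      rw [Real.sqrt_mul (by positivity), Real.sqrt_sq (by positivity)]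
    rw [h1]
    apply Real.sqrt_le_sqrt
    calc ∑ i, ‖(H z) i‖ ^ 2 ≤ ∑ i, η⁻¹ ^ 2 * ‖G i z‖ ^ 2 := by
          refine Finset.sum_le_sum fun i _ => ?_
          simp only [H, norm_mul, mul_pow]
          gcongr
          rw [norm_inv]
          apply inv_anti₀ hη
          have h2 : ‖z - a‖ = ρ := by simpa [dist_eq_norm] using hz
          have h3 := norm_sub_norm_le (z - a) (w i - a)
          have h4 : z - a - (w i - a) = z - w i := by ring
          rw [h4] at h3
          linarith [hw i]
      _ = η⁻¹ ^ 2 * ∑ i, ‖G i z‖ ^ 2 := by rw [Finset.mul_sum]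
      _ ≤ _ := by gcongr; exact hB z hz
  have hsq : ‖∮ z in C(a, ρ), H z‖ ^ 2 = (2 * Real.pi) ^ 2 * ∑ i, ‖G i (w i)‖ ^ 2 := by
    rw [EuclideanSpace.norm_sq_eq, Finset.mul_sum]
    refine Finset.sum_congr rfl fun i _ => ?_
    rw [hcomp, hcauchy]
    simp [mul_pow, abs_of_pos Real.pi_pos]
  have h5 : ‖∮ z in C(a, ρ), H z‖ ^ 2 ≤ (2 * Real.pi * ρ * (η⁻¹ * Real.sqrt B)) ^ 2 := by gcongr
  rw [hsq] at h5
  have h6 : (2 * Real.pi * ρ * (η⁻¹ * Real.sqrt B)) ^ 2 = (2 * Real.pi) ^ 2 * ((ρ / η) ^ 2 * B) := by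
    have h7 : Real.sqrt B ^ 2 = B := Real.sq_sqrt hB0
    calc _ = (2 * Real.pi) ^ 2 * ((ρ * η⁻¹) ^ 2 * Real.sqrt B ^ 2) := by ring
      _ = _ := by rw [h7, div_eq_mul_inv]
  rw [h6] at h5
  exact le_of_mul_le_mul_left h5 (by positivity)

end ZD
end

section
open Complex MeasureTheory

namespace ZD

/-- one-separated families -/
def Sep {ι : Type} (t : ι → ℝ) : Prop := ∀ i j, i ≠ j → 1 ≤ |t i - t j|

lemma Sep.shift {ι : Type} {t : ι → ℝ} (h : Sep t) (u : ℝ) : Sep (fun i => t i + u) := by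
  intro i j hij
  have := h i j hij
  simpa using this

lemma Sep.neg {ι : Type} {t : ι → ℝ} (h : Sep t) : Sep (fun i => - t i) := by
  intro i j hij
  have := h j i hij.symm
  have e : - t i - - t j = t j - t i := by ring
  simpa only [e] using this

lemma sep_integral {ι : Type} [Fintype ι] {t : ι → ℝ} (ht : Sep t) (S : Set ℝ) (h : ℝ → ℝ)
    (hS : ∀ i, Set.Ioc (t i - 1 / 2) (t i + 1 / 2) ⊆ S)
    (hnn : ∀ v, 0 ≤ h v) (hint : IntegrableOn h S) :
    ∑ i, ∫ v in Set.Ioc (t i - 1 / 2) (t i + 1 / 2), h v ≤ ∫ v in S, h v := by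
  have h1 := integral_biUnion_finset (μ := volume) (f := h) Finset.univ
    (s := fun i => Set.Ioc (t i - 1 / 2) (t i + 1 / 2))
    (fun i _ => measurableSet_Ioc) ?_ (fun i _ => hint.mono_set (hS i))
  · rw [← h1]
    apply setIntegral_mono_set hint
    · exact ae_of_all _ hnn
    · apply LE.le.eventuallyLE
      intro x hx
      simp only [Set.mem_iUnion] at hx
      obtain ⟨i, -, hi⟩ := hx
      exact hS i hi
  · intro i _ j _ hij
    rw [Function.onFun, Set.disjoint_left]
    rintro x ⟨h1, h2⟩ ⟨h3, h4⟩
    have := ht i j hij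
    rcases le_abs.mp this with h | h <;> linarith

lemma sep_card {ι : Type} [Fintype ι] {t : ι → ℝ} (ht : Sep t) {T : ℝ} (hT : 1 ≤ T)
    (htT : ∀ i, |t i| ≤ T) : (Fintype.card ι : ℝ) ≤ 4 * T := by
  have h := sep_integral ht (Set.Ioc (-T - 1) (T + 1)) (fun _ => 1) ?_ (fun _ => zero_le_one) ?_
  · simp only [integral_const, MeasurableSet.univ, measureReal_restrict_apply, Set.univ_inter,
      Real.volume_real_Ioc, smul_eq_mul, mul_one] at h
    have e1 : ∀ i, max (t i + 1 / 2 - (t i - 1 / 2)) 0 = 1 := by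
      intro i
      have : t i + 1 / 2 - (t i - 1 / 2) = 1 := by ring
      rw [this]; norm_num
    simp only [e1, Finset.sum_const, Finset.card_univ, nsmul_eq_mul, mul_one] at h
    rw [max_eq_left (by linarith)] at h
    linarith
  · intro i x hx
    have := abs_le.mp (htT i)
    constructor <;> linarith [hx.1, hx.2]
  · simp

lemma sep_exp {ι : Type} [Fintype ι] {t : ι → ℝ} (ht : Sep t) (a : ℝ) :
    ∑ i, Real.exp (-|t i - a|) ≤ 6 := by
  have hval : ∫ v : ℝ, Real.exp (-|v|) = 2 := by
    have := integral_comp_abs (f := fun v => Real.exp (-v))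
    rw [this, integral_exp_neg_Ioi_zero]; norm_num
  have hint : Integrable (fun v : ℝ => Real.exp (-|v|)) := Integrable.of_integral_ne_zero (by rw [hval]; norm_num)
  have h := sep_integral (ht.shift (-a)) Set.univ (fun v => Real.exp (-|v|)) (fun _ => Set.subset_univ _)
    (fun _ => (Real.exp_pos _).le) (by simpa using hint)
  rw [setIntegral_univ, hval] at h
  have h2 : ∀ i, Real.exp (-|t i - a|) ≤ 3 * ∫ v in Set.Ioc (t i + -a - 1 / 2) (t i + -a + 1 / 2), Real.exp (-|v|) := by
    intro i
    have h3 : ∫ v in Set.Ioc (t i + -a - 1 / 2) (t i + -a + 1 / 2), Real.exp (-|t i - a| - 1) ≤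
        ∫ v in Set.Ioc (t i + -a - 1 / 2) (t i + -a + 1 / 2), Real.exp (-|v|) := by
      apply setIntegral_mono_on (by simp) hint.integrableOn measurableSet_Ioc
      intro v hv
      apply Real.exp_le_exp.mpr
      have : |v| ≤ |t i - a| + |v - (t i - a)| := by
        have := abs_add_le (t i - a) (v - (t i - a)); simpa using this
      have h4 : |v - (t i - a)| ≤ 1 := by
        rw [abs_le]; constructor <;> linarith [hv.1, hv.2]
      linarith
    simp only [integral_const, MeasurableSet.univ, measureReal_restrict_apply, Set.univ_inter,
      Real.volume_real_Ioc, smul_eq_mul] at h3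
    have e1 : max (t i + -a + 1 / 2 - (t i + -a - 1 / 2)) 0 = 1 := by
      have : t i + -a + 1 / 2 - (t i + -a - 1 / 2) = 1 := by ring
      rw [this]; norm_num
    rw [e1, one_mul, Real.exp_sub] at h3
    have h5 := Real.exp_one_lt_d9
    have h6 : Real.exp (-|t i - a|) = Real.exp 1 * (Real.exp (-|t i - a|) / Real.exp 1) := by
      field_simp
    rw [h6]
    have : 0 ≤ Real.exp (-|t i - a|) / Real.exp 1 := by positivity
    nlinarith
  calc _ ≤ ∑ i, 3 * ∫ v in Set.Ioc (t i + -a - 1 / 2) (t i + -a + 1 / 2), Real.exp (-|v|) :=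
        Finset.sum_le_sum fun i _ => h2 i
    _ = 3 * ∑ i, ∫ v in Set.Ioc (t i + -a - 1 / 2) (t i + -a + 1 / 2), Real.exp (-|v|) := by
        rw [Finset.mul_sum]
    _ ≤ 6 := by linarith

/-- Sobolev–Gallagher -/
lemma gallagher (g g' : ℝ → ℂ) (hg : ∀ v, HasDerivAt g (g' v) v) (hg' : Continuous g') (t : ℝ) :
    ‖g t‖ ^ 2 ≤ ∫ v in Set.Ioc (t - 1 / 2) (t + 1 / 2), (2 * ‖g v‖ ^ 2 + ‖g' v‖ ^ 2) := by
  have hgc : Continuous g := continuous_iff_continuousAt.mpr fun v => (hg v).continuousAt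
  have hder : ∀ v, HasDerivAt (fun v => ‖g v‖ ^ 2) (2 * inner ℝ (g v) (g' v)) v := fun v => (hg v).norm_sq
  have hdc : Continuous (fun v => 2 * inner ℝ (g v) (g' v)) := by fun_prop
  set I0 := Set.Ioc (t - 1 / 2) (t + 1 / 2) with hI0
  have hmc : Continuous (fun v => ‖g v‖ ^ 2 + ‖g' v‖ ^ 2) := by fun_prop
  have hmi : IntegrableOn (fun v => ‖g v‖ ^ 2 + ‖g' v‖ ^ 2) I0 :=
    (hmc.integrableOn_Icc (a := t - 1 / 2) (b := t + 1 / 2)).mono_set Set.Ioc_subset_Icc_self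
  have hgi : IntegrableOn (fun v => ‖g v‖ ^ 2) I0 :=
    ((hgc.norm.pow 2).integrableOn_Icc (a := t - 1 / 2) (b := t + 1 / 2)).mono_set Set.Ioc_subset_Icc_self
  have key : ∀ v ∈ I0, ‖g t‖ ^ 2 ≤ ‖g v‖ ^ 2 + ∫ v in I0, (‖g v‖ ^ 2 + ‖g' v‖ ^ 2) := by
    intro v hv
    have h1 : ∫ w in v..t, 2 * inner ℝ (g w) (g' w) = ‖g t‖ ^ 2 - ‖g v‖ ^ 2 :=
      intervalIntegral.integral_eq_sub_of_hasDerivAt (fun w _ => hder w) (hdc.intervalIntegrable _ _)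
    have h2 : ‖∫ w in v..t, 2 * inner ℝ (g w) (g' w)‖ ≤ ∫ w in Set.uIoc v t, ‖2 * inner ℝ (g w) (g' w)‖ :=
      intervalIntegral.norm_integral_le_integral_norm_uIoc
    have h3 : ∫ w in Set.uIoc v t, ‖2 * inner ℝ (g w) (g' w)‖ ≤ ∫ w in Set.uIoc v t, (‖g w‖ ^ 2 + ‖g' w‖ ^ 2) := by
      apply integral_mono_of_nonneg (ae_of_all _ fun _ => norm_nonneg _)
      · exact (hmc.integrableOn_uIcc (a := v) (b := t)).mono_set Set.uIoc_subset_uIcc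
      · refine ae_of_all _ fun w => ?_
        have := norm_inner_le_norm (𝕜 := ℝ) (g w) (g' w)
        simp only [norm_mul, Real.norm_ofNat]
        nlinarith [sq_nonneg (‖g w‖ - ‖g' w‖)]
    have h4 : ∫ w in Set.uIoc v t, (‖g w‖ ^ 2 + ‖g' w‖ ^ 2) ≤ ∫ w in I0, (‖g w‖ ^ 2 + ‖g' w‖ ^ 2) := by
      apply setIntegral_mono_set hmi
      · exact ae_of_all _ fun _ => by positivity
      · apply LE.le.eventuallyLE
        intro w hw
        rw [Set.uIoc, Set.mem_Ioc] at hw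
        have h5 : t - 1 / 2 ≤ min v t := le_min hv.1.le (by linarith)
        have h6 : max v t ≤ t + 1 / 2 := max_le hv.2 (by linarith)
        exact ⟨lt_of_le_of_lt h5 hw.1, hw.2.trans h6⟩
    have h7 := le_abs_self (∫ w in v..t, 2 * inner ℝ (g w) (g' w))
    rw [Real.norm_eq_abs] at h2
    linarith
  have h8 : ∫ v in I0, ‖g t‖ ^ 2 ≤ ∫ v in I0, (‖g v‖ ^ 2 + ∫ v in I0, (‖g v‖ ^ 2 + ‖g' v‖ ^ 2)) := by
    apply setIntegral_mono_on (by simp [hI0]) (hgi.add (by simp [hI0])) measurableSet_Ioc key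
  have hvol : volume.real I0 = 1 := by
    rw [hI0, Real.volume_real_Ioc]
    have : t + 1 / 2 - (t - 1 / 2) = 1 := by ring
    rw [this]; norm_num
  rw [integral_add hgi (by simp [hI0])] at h8
  simp only [integral_const, MeasurableSet.univ, measureReal_restrict_apply, Set.univ_inter,
    smul_eq_mul, hvol, one_mul] at h8
  refine h8.trans (le_of_eq ?_)
  rw [← integral_add hgi hmi]
  congr 1; ext v; ring

/-- Mean value of an exponential sum. -/
lemma mv_general (s : Finset ℕ) (c : ℕ → ℂ) (l : ℕ → ℝ) (hl : ∀ m ∈ s, ∀ n ∈ s, m ≠ n → l m ≠ l n)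
    (T : ℝ) (hT : 0 ≤ T) :
    ∫ v in Set.Ioc (-T) T, ‖∑ n ∈ s, c n * cexp (-(v * l n) * I)‖ ^ 2 ≤
      2 * T * ∑ n ∈ s, ‖c n‖ ^ 2 +
      ∑ m ∈ s, ∑ n ∈ s, if m = n then 0 else ‖c m‖ * ‖c n‖ * (2 / |l m - l n|) := by
  have hexp : ∀ v : ℝ, ((‖∑ n ∈ s, c n * cexp (-(v * l n) * I)‖ ^ 2 : ℝ) : ℂ) =
      ∑ m ∈ s, ∑ n ∈ s, c m * (starRingEnd ℂ) (c n) * cexp (-(((l m - l n : ℝ) : ℂ) * I) * v) := by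
    intro v
    rw [← Complex.normSq_eq_norm_sq, ← Complex.mul_conj, map_sum, Finset.sum_mul_sum]
    refine Finset.sum_congr rfl fun m _ => Finset.sum_congr rfl fun n _ => ?_
    rw [map_mul, ← Complex.exp_conj]
    simp only [map_mul, map_neg, conj_ofReal, conj_I]
    rw [show c m * cexp (-(v * l m) * I) * ((starRingEnd ℂ) (c n) * cexp (-(v * l n) * -I)) =
      c m * (starRingEnd ℂ) (c n) * (cexp (-(v * l m) * I) * cexp (-(v * l n) * -I)) by ring,
      ← Complex.exp_add]
    congr 2
    push_cast; ring
  have hint : ∀ m n, ‖∫ v in (-T)..T, cexp (-(((l m - l n : ℝ) : ℂ) * I) * v)‖ ≤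
      if l m = l n then 2 * T else 2 / |l m - l n| := by
    intro m n
    split_ifs with h
    · have := intervalIntegral.norm_integral_le_of_norm_le_const (a := -T) (b := T) (C := 1)
        (f := fun v : ℝ => cexp (-(((l m - l n : ℝ) : ℂ) * I) * v)) (by
          intro x _; rw [h]; simp)
      refine this.trans (le_of_eq ?_)
      rw [abs_of_nonneg (by linarith)]; ring
    · have h0 : l m - l n ≠ 0 := sub_ne_zero.mpr h
      have hne : -(((l m - l n : ℝ) : ℂ) * I) ≠ 0 := by
        simp only [neg_ne_zero, mul_ne_zero_iff]
        exact ⟨by exact_mod_cast h0, I_ne_zero⟩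
      rw [integral_exp_mul_complex hne, norm_div]
      have h1 : ‖-(((l m - l n : ℝ) : ℂ) * I)‖ = |l m - l n| := by
        rw [norm_neg, norm_mul, norm_I, mul_one, Complex.norm_real, Real.norm_eq_abs]
      rw [h1]
      gcongr
      refine (norm_sub_le _ _).trans ?_
      have h2 : ∀ w : ℝ, ‖cexp (-(((l m - l n : ℝ) : ℂ) * I) * w)‖ = 1 := by
        intro w
        rw [show -(((l m - l n : ℝ) : ℂ) * I) * w = ((-((l m - l n) * w) : ℝ) : ℂ) * I by push_cast; ring]
        exact Complex.norm_exp_ofReal_mul_I _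
      have h3 := h2 T
      have h4 := h2 (-T)
      rw [h3, h4]; norm_num
  rw [← intervalIntegral.integral_of_le (by linarith)]
  have e1 : ((∫ v in (-T)..T, ‖∑ n ∈ s, c n * cexp (-(v * l n) * I)‖ ^ 2 : ℝ) : ℂ) =
      ∑ m ∈ s, ∑ n ∈ s, c m * (starRingEnd ℂ) (c n) * ∫ v in (-T)..T, cexp (-(((l m - l n : ℝ) : ℂ) * I) * v) := by
    rw [← intervalIntegral.integral_ofReal]
    simp_rw [hexp]
    rw [intervalIntegral.integral_finsetSum]
    · refine Finset.sum_congr rfl fun m _ => ?_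
      rw [intervalIntegral.integral_finsetSum]
      · refine Finset.sum_congr rfl fun n _ => ?_
        rw [intervalIntegral.integral_const_mul]
      · intro n _
        apply Continuous.intervalIntegrable; fun_prop
    · intro m _
      apply Continuous.intervalIntegrable; fun_prop
  have e2 : ∫ v in (-T)..T, ‖∑ n ∈ s, c n * cexp (-(v * l n) * I)‖ ^ 2 ≤
      ‖((∫ v in (-T)..T, ‖∑ n ∈ s, c n * cexp (-(v * l n) * I)‖ ^ 2 : ℝ) : ℂ)‖ := by
    rw [Complex.norm_real]; exact le_abs_self _
  refine e2.trans ?_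
  rw [e1]
  calc _ ≤ ∑ m ∈ s, ∑ n ∈ s, ‖c m‖ * ‖c n‖ * (if l m = l n then 2 * T else 2 / |l m - l n|) := by
        refine (norm_sum_le _ _).trans (Finset.sum_le_sum fun m _ => (norm_sum_le _ _).trans
          (Finset.sum_le_sum fun n _ => ?_))
        rw [norm_mul, norm_mul, RCLike.norm_conj]
        gcongr
        exact hint m n
    _ = ∑ m ∈ s, ∑ n ∈ s, ((if m = n then 2 * T * ‖c n‖ ^ 2 else 0) +
          if m = n then 0 else ‖c m‖ * ‖c n‖ * (2 / |l m - l n|)) := by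
        refine Finset.sum_congr rfl fun m hm => Finset.sum_congr rfl fun n hn => ?_
        by_cases h : m = n
        · subst h; simp; ring
        · simp [h, hl m hm n hn h]
    _ = _ := by
        simp_rw [Finset.sum_add_distrib]
        congr 1
        rw [Finset.mul_sum]
        refine Finset.sum_congr rfl fun m hm => ?_
        simp [hm]

end ZD
end

section
open Complex MeasureTheory

namespace ZD

lemma log_gap {m n : ℕ} (hm : 1 ≤ m) (hn : 1 ≤ n) (hmn : m ≠ n) :
    2 / |Real.log m - Real.log n| ≤ 2 * (1 + Real.sqrt m * Real.sqrt n / |(m:ℝ) - n|) := by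
  wlog h : n < m generalizing m n with H
  · have := H hn hm hmn.symm (lt_of_le_of_ne (not_lt.mp h) hmn)
    rw [abs_sub_comm, abs_sub_comm (m:ℝ), mul_comm (Real.sqrt m)]
    exact this
  have hm0 : (0:ℝ) < m := by exact_mod_cast hm
  have hn0 : (0:ℝ) < n := by exact_mod_cast hn
  have hlt : (n:ℝ) < m := by exact_mod_cast h
  have h1 : ((m:ℝ) - n) / m ≤ Real.log m - Real.log n := by
    have := Real.log_le_sub_one_of_pos (x := (n:ℝ) / m) (by positivity)
    rw [Real.log_div hn0.ne' hm0.ne'] at this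
    have e : ((m:ℝ) - n) / m = 1 - n / m := by field_simp
    linarith
  have hd : 0 < (m:ℝ) - n := by linarith
  have hd2 : 0 < ((m:ℝ) - n) / m := by positivity
  rw [abs_of_pos (lt_of_lt_of_le hd2 h1), abs_of_pos hd]
  have h2 : 2 / (Real.log m - Real.log n) ≤ 2 / (((m:ℝ) - n) / m) := by gcongr
  refine h2.trans ?_
  have e : 2 / (((m:ℝ) - n) / m) = 2 * (1 + n / ((m:ℝ) - n)) := by field_simp; ring
  rw [e]
  have h3 : (n:ℝ) ≤ Real.sqrt m * Real.sqrt n := by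
    calc (n:ℝ) = Real.sqrt n * Real.sqrt n := (Real.mul_self_sqrt hn0.le).symm
      _ ≤ _ := by gcongr
  gcongr

lemma sum_recip_gap (N m : ℕ) (hm : m ∈ Finset.Icc 1 N) :
    ∑ n ∈ Finset.Icc 1 N, (if m = n then 0 else 1 / |(m:ℝ) - n|) ≤ 2 * (1 + Real.log N) := by
  rw [Finset.mem_Icc] at hm
  have hh : (harmonic N : ℝ) ≤ 1 + Real.log N := harmonic_le_one_add_log N
  have hN : (harmonic N : ℝ) = ∑ k ∈ Finset.Icc 1 N, 1 / (k:ℝ) := by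
    rw [harmonic_eq_sum_Icc]; push_cast; simp
  have e : ∀ n ∈ Finset.Icc 1 N, (if m = n then 0 else 1 / |(m:ℝ) - n|) ≤
      (if n < m then 1 / ((m - n : ℕ):ℝ) else 0) + (if m < n then 1 / ((n - m : ℕ):ℝ) else 0) := by
    intro n hn
    rcases lt_trichotomy n m with h | h | h
    · rw [if_neg h.ne', if_pos h, if_neg (by omega)]
      rw [Nat.cast_sub h.le, abs_of_pos (by have : (n:ℝ) < m := by exact_mod_cast h
                                            linarith)]; simp
    · subst h; simp
    · rw [if_neg h.ne, if_neg (by omega), if_pos h]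
      rw [Nat.cast_sub h.le, abs_of_neg (by have : (m:ℝ) < n := by exact_mod_cast h
                                            linarith)]; simp
  refine (Finset.sum_le_sum e).trans ?_
  rw [Finset.sum_add_distrib]
  have h1 : ∑ n ∈ Finset.Icc 1 N, (if n < m then 1 / ((m - n : ℕ):ℝ) else 0) ≤ ∑ k ∈ Finset.Icc 1 N, 1 / (k:ℝ) := by
    rw [← Finset.sum_filter]
    rw [← Finset.sum_image (f := fun k : ℕ => 1 / (k:ℝ)) (g := fun n => m - n)]
    · apply Finset.sum_le_sum_of_subset_of_nonneg
      · intro k hk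
        simp only [Finset.mem_image, Finset.mem_filter, Finset.mem_Icc] at hk ⊢
        obtain ⟨a, ha, rfl⟩ := hk
        omega
      · intros; positivity
    · intro a ha b hb hab
      simp only [Finset.coe_filter, Finset.mem_Icc, Set.mem_ofPred_eq] at ha hb hab
      omega
  have h2 : ∑ n ∈ Finset.Icc 1 N, (if m < n then 1 / ((n - m : ℕ):ℝ) else 0) ≤ ∑ k ∈ Finset.Icc 1 N, 1 / (k:ℝ) := by
    rw [← Finset.sum_filter]
    rw [← Finset.sum_image (f := fun k : ℕ => 1 / (k:ℝ)) (g := fun n => n - m)]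
    · apply Finset.sum_le_sum_of_subset_of_nonneg
      · intro k hk
        simp only [Finset.mem_image, Finset.mem_filter, Finset.mem_Icc] at hk ⊢
        obtain ⟨a, ha, rfl⟩ := hk
        omega
      · intros; positivity
    · intro a ha b hb hab
      simp only [Finset.coe_filter, Finset.mem_Icc, Set.mem_ofPred_eq] at ha hb hab
      omega
  rw [← hN] at h1 h2
  linarith

/-- Dirichlet polynomial -/
noncomputable def DP (N : ℕ) (f : ℕ → ℂ) (s : ℂ) : ℂ := ∑ n ∈ Finset.Icc 1 N, f n * (n:ℂ) ^ (-s)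

lemma mv_int (N : ℕ) (c : ℕ → ℂ) (T : ℝ) (hT : 0 ≤ T) :
    ∫ v in Set.Ioc (-T) T, ‖∑ n ∈ Finset.Icc 1 N, c n * cexp (-(v * (Real.log n : ℝ)) * I)‖ ^ 2 ≤
      2 * T * ∑ n ∈ Finset.Icc 1 N, ‖c n‖ ^ 2 + 2 * (∑ n ∈ Finset.Icc 1 N, ‖c n‖) ^ 2 +
      4 * (1 + Real.log N) * ∑ n ∈ Finset.Icc 1 N, n * ‖c n‖ ^ 2 := by
  have h := mv_general (Finset.Icc 1 N) c (fun n => Real.log n) (by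
    intro m hm n hn hmn he
    rw [Finset.mem_Icc] at hm hn
    have := Real.log_injOn_pos (show (m:ℝ) ∈ Set.Ioi 0 by
      simp only [Set.mem_Ioi]; exact_mod_cast hm.1) (show (n:ℝ) ∈ Set.Ioi 0 by
      simp only [Set.mem_Ioi]; exact_mod_cast hn.1) he
    exact hmn (by exact_mod_cast this)) T hT
  refine h.trans ?_
  rw [add_assoc]
  gcongr
  set S := Finset.Icc 1 N
  have e : ∀ m ∈ S, ∀ n ∈ S, (if m = n then 0 else ‖c m‖ * ‖c n‖ * (2 / |Real.log m - Real.log n|)) ≤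
      2 * (‖c m‖ * ‖c n‖) + ((m * ‖c m‖ ^ 2) * (if m = n then 0 else 1 / |(m:ℝ) - n|) +
       (n * ‖c n‖ ^ 2) * (if n = m then 0 else 1 / |(n:ℝ) - m|)) := by
    intro m hm n hn
    rw [Finset.mem_Icc] at hm hn
    by_cases hmn : m = n
    · subst hmn; simp; positivity
    · rw [if_neg hmn, if_neg hmn, if_neg (Ne.symm hmn)]
      have h1 := log_gap hm.1 hn.1 hmn
      have h2 : ‖c m‖ * ‖c n‖ * (2 / |Real.log m - Real.log n|) ≤ ‖c m‖ * ‖c n‖ * (2 * (1 + Real.sqrt m * Real.sqrt n / |(m:ℝ) - n|)) := by gcongr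
      refine h2.trans ?_
      rw [abs_sub_comm (n:ℝ)]
      have h3 : 2 * (Real.sqrt m * ‖c m‖) * (Real.sqrt n * ‖c n‖) ≤ m * ‖c m‖ ^ 2 + n * ‖c n‖ ^ 2 := by
        have := two_mul_le_add_sq (Real.sqrt m * ‖c m‖) (Real.sqrt n * ‖c n‖)
        rw [mul_pow, mul_pow, Real.sq_sqrt (by positivity), Real.sq_sqrt (by positivity)] at this
        exact this
      have h4 : 0 ≤ 1 / |(m:ℝ) - n| := by positivity
      have h5 := mul_le_mul_of_nonneg_right h3 h4
      calc _ = 2 * (‖c m‖ * ‖c n‖) + 2 * (Real.sqrt m * ‖c m‖) * (Real.sqrt n * ‖c n‖) * (1 / |(m:ℝ) - n|) := by ring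
        _ ≤ _ := by linarith
  calc _ ≤ ∑ m ∈ S, ∑ n ∈ S, (2 * (‖c m‖ * ‖c n‖) + ((m * ‖c m‖ ^ 2) * (if m = n then 0 else 1 / |(m:ℝ) - n|) +
       (n * ‖c n‖ ^ 2) * (if n = m then 0 else 1 / |(n:ℝ) - m|))) :=
        Finset.sum_le_sum fun m hm => Finset.sum_le_sum fun n hn => e m hm n hn
    _ = 2 * (∑ n ∈ S, ‖c n‖) ^ 2 + 2 * ∑ m ∈ S, (m * ‖c m‖ ^ 2) * ∑ n ∈ S, (if m = n then 0 else 1 / |(m:ℝ) - n|) := by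
        simp_rw [Finset.sum_add_distrib]
        rw [Finset.sum_comm (f := fun m n : ℕ => (n:ℝ) * ‖c n‖ ^ 2 * (if n = m then 0 else 1 / |(n:ℝ) - m|))]
        rw [sq, Finset.sum_mul_sum]
        simp_rw [← Finset.mul_sum]
        ring
    _ ≤ 2 * (∑ n ∈ S, ‖c n‖) ^ 2 + 2 * ∑ m ∈ S, (m * ‖c m‖ ^ 2) * (2 * (1 + Real.log N)) := by
        gcongr with m hm
        exact sum_recip_gap N m hm
    _ = _ := by rw [← Finset.sum_mul]; ring

lemma cpow_neg_I (n : ℕ) (hn : 1 ≤ n) (v : ℝ) : (n:ℂ) ^ (-(v * I)) = cexp (-(v * (Real.log n : ℝ)) * I) := by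
  have : (n:ℂ) ≠ 0 := by exact_mod_cast (by omega : n ≠ 0)
  rw [cpow_def_of_ne_zero this, Complex.natCast_log]
  congr 1; ring

/-- discrete mean value theorem -/
lemma discrete_mv0 {ι : Type} [Fintype ι] {t : ι → ℝ} (ht : Sep t) {T : ℝ} (hT : 1 ≤ T)
    (htT : ∀ i, |t i| ≤ T) (N : ℕ) (hN : 1 ≤ N) (c : ℕ → ℂ) :
    ∑ i, ‖DP N c (t i * I)‖ ^ 2 ≤ 12 * (1 + Real.log N) ^ 3 *
      (T * ∑ n ∈ Finset.Icc 1 N, ‖c n‖ ^ 2 + (∑ n ∈ Finset.Icc 1 N, ‖c n‖) ^ 2 +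
      ∑ n ∈ Finset.Icc 1 N, n * ‖c n‖ ^ 2) := by
  set S := Finset.Icc 1 N with hS
  set L := 1 + Real.log N with hL
  have hL1 : 1 ≤ L := by
    have := Real.log_nonneg (show (1:ℝ) ≤ N by exact_mod_cast hN)
    linarith
  set g : ℝ → ℂ := fun v => ∑ n ∈ S, c n * cexp (-(v * (Real.log n : ℝ)) * I) with hg
  set c' : ℕ → ℂ := fun n => c n * (-(Real.log n : ℝ) * I) with hc'
  set g' : ℝ → ℂ := fun v => ∑ n ∈ S, c' n * cexp (-(v * (Real.log n : ℝ)) * I) with hg'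
  have hder : ∀ v, HasDerivAt g (g' v) v := by
    intro v
    apply HasDerivAt.fun_sum
    intro n _
    have h1 : HasDerivAt (fun v : ℝ => -((v:ℂ) * (Real.log n : ℝ)) * I) (-(((1:ℝ):ℂ) * (Real.log n : ℝ)) * I) v :=
      ((((hasDerivAt_id v).ofReal_comp).mul_const _).neg).mul_const I
    have h2 := (h1.cexp).const_mul (c n)
    refine h2.congr_deriv ?_
    simp only [hc']; push_cast; ring
  have hgc : Continuous g := by simp only [hg]; fun_prop
  have hgc' : Continuous g' := by simp only [hg']; fun_prop
  have h1 : ∀ i, ‖DP N c (t i * I)‖ ^ 2 ≤ ∫ v in Set.Ioc (t i - 1 / 2) (t i + 1 / 2), (2 * ‖g v‖ ^ 2 + ‖g' v‖ ^ 2) := by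
    intro i
    have e : DP N c (t i * I) = g (t i) := by
      simp only [DP, hg]
      refine Finset.sum_congr rfl fun n hn => ?_
      rw [cpow_neg_I n (Finset.mem_Icc.mp hn).1]
    rw [e]
    exact gallagher g g' hder hgc' (t i)
  have hc : Continuous (fun v => 2 * ‖g v‖ ^ 2 + ‖g' v‖ ^ 2) := by fun_prop
  have h2 := sep_integral ht (Set.Ioc (-(T + 1)) (T + 1)) (fun v => 2 * ‖g v‖ ^ 2 + ‖g' v‖ ^ 2) (by
      intro i x hx
      have := abs_le.mp (htT i)
      constructor <;> linarith [hx.1, hx.2]) (fun _ => by positivity)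
      ((hc.integrableOn_Icc (a := -(T + 1)) (b := T + 1)).mono_set Set.Ioc_subset_Icc_self)
  refine (Finset.sum_le_sum fun i _ => h1 i).trans (h2.trans ?_)
  have hi1 : IntegrableOn (fun v => 2 * ‖g v‖ ^ 2) (Set.Ioc (-(T + 1)) (T + 1)) :=
    (Continuous.integrableOn_Icc (by fun_prop) (a := -(T + 1)) (b := T + 1)).mono_set Set.Ioc_subset_Icc_self
  have hi2 : IntegrableOn (fun v => ‖g' v‖ ^ 2) (Set.Ioc (-(T + 1)) (T + 1)) :=
    (Continuous.integrableOn_Icc (by fun_prop) (a := -(T + 1)) (b := T + 1)).mono_set Set.Ioc_subset_Icc_self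
  rw [integral_add hi1 hi2, integral_const_mul]
  have m1 := mv_int N c (T + 1) (by linarith)
  have m2 := mv_int N c' (T + 1) (by linarith)
  have hcc : ∀ n ∈ S, ‖c' n‖ ≤ L * ‖c n‖ := by
    intro n hn
    rw [Finset.mem_Icc] at hn
    simp only [hc', norm_mul, norm_neg, norm_I, mul_one, Complex.norm_real, Real.norm_eq_abs]
    have h0 := Real.log_nonneg (show (1:ℝ) ≤ n by exact_mod_cast hn.1)
    have h3 : Real.log n ≤ Real.log N := Real.log_le_log (by exact_mod_cast hn.1) (by exact_mod_cast hn.2)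
    rw [abs_of_nonneg h0, mul_comm]
    gcongr
    linarith
  have hcc2 : ∀ n ∈ S, ‖c' n‖ ^ 2 ≤ L ^ 2 * ‖c n‖ ^ 2 := by
    intro n hn
    rw [← mul_pow]
    exact pow_le_pow_left₀ (norm_nonneg _) (hcc n hn) 2
  set A := ∑ n ∈ S, ‖c n‖ ^ 2
  set B := (∑ n ∈ S, ‖c n‖) ^ 2
  set D := ∑ n ∈ S, n * ‖c n‖ ^ 2
  have a1 : ∑ n ∈ S, ‖c' n‖ ^ 2 ≤ L ^ 2 * A := by
    rw [Finset.mul_sum]; exact Finset.sum_le_sum hcc2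
  have a2 : (∑ n ∈ S, ‖c' n‖) ^ 2 ≤ L ^ 2 * B := by
    rw [← mul_pow]
    apply pow_le_pow_left₀ (by positivity)
    rw [Finset.mul_sum]; exact Finset.sum_le_sum hcc
  have a3 : ∑ n ∈ S, n * ‖c' n‖ ^ 2 ≤ L ^ 2 * D := by
    rw [Finset.mul_sum]
    refine Finset.sum_le_sum fun n hn => ?_
    have := hcc2 n hn
    calc (n:ℝ) * ‖c' n‖ ^ 2 ≤ n * (L ^ 2 * ‖c n‖ ^ 2) := by gcongr
      _ = _ := by ring
  have hA : 0 ≤ A := by positivity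
  have hB : 0 ≤ B := by positivity
  have hD : 0 ≤ D := by positivity
  have hLL : 1 ≤ L ^ 2 := one_le_pow₀ hL1
  have hLLL : L ^ 2 ≤ L ^ 3 := pow_le_pow_right₀ hL1 (by norm_num)
  set I1 := ∫ v in Set.Ioc (-(T + 1)) (T + 1), ‖g v‖ ^ 2
  set I2 := ∫ v in Set.Ioc (-(T + 1)) (T + 1), ‖g' v‖ ^ 2
  have m1' : I1 ≤ 4 * T * A + 2 * B + 4 * L * D := by
    refine m1.trans ?_
    have : 2 * (T + 1) * A ≤ 4 * T * A := by
      apply mul_le_mul_of_nonneg_right _ hA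
      linarith
    linarith
  have m1'' : I1 ≤ L ^ 2 * (4 * T * A + 2 * B + 4 * L * D) := by
    refine m1'.trans ?_
    exact le_mul_of_one_le_left (by positivity) hLL
  have m2' : I2 ≤ L ^ 2 * (4 * T * A + 2 * B + 4 * L * D) := by
    refine m2.trans ?_
    have : 2 * (T + 1) * (∑ n ∈ S, ‖c' n‖ ^ 2) ≤ 4 * T * (L ^ 2 * A) := by
      apply mul_le_mul _ a1 (by positivity) (by positivity)
      linarith
    have : 4 * L * (∑ n ∈ S, n * ‖c' n‖ ^ 2) ≤ 4 * L * (L ^ 2 * D) := by gcongr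
    nlinarith
  have : L ^ 2 * (4 * T * A + 2 * B + 4 * L * D) ≤ 4 * L ^ 3 * (T * A + B + D) := by
    have h1 : L ^ 2 * (T * A) ≤ L ^ 3 * (T * A) := by gcongr
    have h2 : L ^ 2 * B ≤ L ^ 3 * B := by gcongr
    nlinarith [mul_nonneg (by positivity : 0 ≤ L ^ 2) hB]
  linarith

end ZD
end

section
open Complex MeasureTheory

namespace ZD

lemma log_pow_le (k : ℕ) (e : ℝ) (he : 0 < e) : ∃ C > 0, ∀ x : ℝ, 1 ≤ x → (1 + Real.log x) ^ k ≤ C * x ^ e := by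
  by_cases hk : k = 0
  · refine ⟨1, one_pos, fun x hx => ?_⟩
    subst hk
    simpa using Real.one_le_rpow hx he.le
  have hk' : (0:ℝ) < k := by exact_mod_cast Nat.pos_of_ne_zero hk
  refine ⟨(1 + k / e) ^ k, by positivity, fun x hx => ?_⟩
  have h1 : Real.log x ≤ x ^ (e / k) / (e / k) := Real.log_le_rpow_div (by linarith) (by positivity)
  have h2 : 1 ≤ x ^ (e / k) := Real.one_le_rpow hx (by positivity)
  have h3 : 1 + Real.log x ≤ (1 + k / e) * x ^ (e / k) := by
    have : x ^ (e / k) / (e / k) = k / e * x ^ (e / k) := by field_simp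
    rw [this] at h1
    linarith
  have h4 := pow_le_pow_left₀ (by linarith [Real.log_nonneg hx]) h3 k
  refine h4.trans (le_of_eq ?_)
  rw [mul_pow, ← Real.rpow_natCast (x ^ (e / k)), ← Real.rpow_mul (by linarith)]
  congr 2
  field_simp

lemma norm_natCast_cpow' (n : ℕ) (hn : 1 ≤ n) (s : ℂ) : ‖(n:ℂ) ^ s‖ = (n:ℝ) ^ s.re :=
  Complex.norm_natCast_cpow_of_pos hn s

lemma sum_inv_le (N : ℕ) : ∑ n ∈ Finset.Icc 1 N, ((n:ℝ))⁻¹ ≤ 1 + Real.log N := by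
  have hh : (harmonic N : ℝ) ≤ 1 + Real.log N := harmonic_le_one_add_log N
  rw [harmonic_eq_sum_Icc] at hh; push_cast at hh; exact hh

lemma DP_shift (N : ℕ) (f : ℕ → ℂ) (x : ℂ) (s : ℂ) :
    DP N f (x + s) = DP N (fun n => f n * (n:ℂ) ^ (-x)) s := by
  unfold DP
  refine Finset.sum_congr rfl fun n hn => ?_
  have hn0 : (n:ℂ) ≠ 0 := by
    have := (Finset.mem_Icc.mp hn).1
    exact_mod_cast (by omega : n ≠ 0)
  rw [neg_add, cpow_add _ _ hn0, mul_assoc]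

lemma mv (e : ℝ) (he : 0 < e) : ∃ C > 0, ∀ (ι : Type) [Fintype ι] (t : ι → ℝ), Sep t → ∀ T : ℝ, 1 ≤ T →
    (∀ i, |t i| ≤ T) → ∀ (N : ℕ), 1 ≤ N → ∀ (f : ℕ → ℂ) (A x Bd : ℝ), 0 ≤ A → x ≤ 1 → 0 ≤ Bd →
    (∀ n ∈ Finset.Icc 1 N, ‖f n‖ ≤ A * (n:ℝ) ^ e) →
    (∀ n ∈ Finset.Icc 1 N, f n ≠ 0 → (n:ℝ) ^ (1 - 2 * x) ≤ Bd) →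
    ∑ i, ‖DP N f (x + t i * I)‖ ^ 2 ≤ C * A ^ 2 * (N:ℝ) ^ (3 * e) * (T * Bd + (N:ℝ) ^ (2 - 2 * x)) := by
  obtain ⟨C0, hC0, hC⟩ := log_pow_le 5 e he
  refine ⟨24 * C0, by positivity, ?_⟩
  intro ι _ t ht T hT htT N hN f A x Bd hA hx hBd hf hsupp
  have hN1 : (1:ℝ) ≤ N := by exact_mod_cast hN
  have hN0 : (0:ℝ) < N := by linarith
  set c : ℕ → ℂ := fun n => f n * (n:ℂ) ^ (-(x:ℂ)) with hc
  have h0 := discrete_mv0 ht hT htT N hN c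
  simp_rw [DP_shift N f x]
  refine h0.trans ?_
  set L := 1 + Real.log N with hL
  have hL1 : 1 ≤ L := by linarith [Real.log_nonneg hN1]
  have hcn : ∀ n ∈ Finset.Icc 1 N, ‖c n‖ ≤ A * (N:ℝ) ^ e * (n:ℝ) ^ (-x) := by
    intro n hn
    have hn' := Finset.mem_Icc.mp hn
    have hn1 : (1:ℝ) ≤ n := by exact_mod_cast hn'.1
    have hnN : (n:ℝ) ≤ N := by exact_mod_cast hn'.2
    simp only [hc, norm_mul]
    rw [norm_natCast_cpow' n hn'.1]
    simp only [neg_re, ofReal_re]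
    have := hf n hn
    have h2 : (n:ℝ) ^ e ≤ (N:ℝ) ^ e := Real.rpow_le_rpow (by linarith) hnN he.le
    gcongr
    exact this.trans (by gcongr)
  have hcn2 : ∀ n ∈ Finset.Icc 1 N, ‖c n‖ ^ 2 ≤ (A ^ 2 * (N:ℝ) ^ (2 * e)) * (n:ℝ) ^ (-2 * x) := by
    intro n hn
    refine (pow_le_pow_left₀ (norm_nonneg _) (hcn n hn) 2).trans (le_of_eq ?_)
    have e1 : ((N:ℝ) ^ e) ^ 2 = (N:ℝ) ^ (2 * e) := by
      rw [← Real.rpow_natCast, ← Real.rpow_mul hN0.le]; congr 1; push_cast; ring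
    have e2 : ((n:ℝ) ^ (-x)) ^ 2 = (n:ℝ) ^ (-2 * x) := by
      rw [← Real.rpow_natCast, ← Real.rpow_mul (by positivity)]; congr 1; push_cast; ring
    rw [mul_pow, mul_pow, e1, e2]
  have a1 : ∑ n ∈ Finset.Icc 1 N, ‖c n‖ ^ 2 ≤ (A ^ 2 * (N:ℝ) ^ (2 * e)) * (Bd * L) := by
    calc _ ≤ ∑ n ∈ Finset.Icc 1 N, (A ^ 2 * (N:ℝ) ^ (2 * e)) * (Bd * (n:ℝ)⁻¹) := by
          refine Finset.sum_le_sum fun n hn => ?_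
          by_cases hfn : f n = 0
          · simp only [hc, hfn]; simp; positivity
          · have hn' := Finset.mem_Icc.mp hn
            have hn1 : (0:ℝ) < n := by exact_mod_cast hn'.1
            refine (hcn2 n hn).trans ?_
            have : (n:ℝ) ^ (-2 * x) = (n:ℝ) ^ (1 - 2 * x) * (n:ℝ)⁻¹ := by
              rw [← Real.rpow_neg_one, ← Real.rpow_add hn1]; congr 1; ring
            rw [this]
            have := hsupp n hn hfn
            gcongr
      _ ≤ _ := by
          rw [← Finset.mul_sum, ← Finset.mul_sum]
          gcongr
          exact sum_inv_le N
  have a2 : ∑ n ∈ Finset.Icc 1 N, ‖c n‖ ≤ (A * (N:ℝ) ^ e) * ((N:ℝ) ^ (1 - x) * L) := by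
    calc _ ≤ ∑ n ∈ Finset.Icc 1 N, (A * (N:ℝ) ^ e) * ((N:ℝ) ^ (1 - x) * (n:ℝ)⁻¹) := by
          refine Finset.sum_le_sum fun n hn => ?_
          have hn' := Finset.mem_Icc.mp hn
          have hn1 : (0:ℝ) < n := by exact_mod_cast hn'.1
          refine (hcn n hn).trans ?_
          have : (n:ℝ) ^ (-x) = (n:ℝ) ^ (1 - x) * (n:ℝ)⁻¹ := by
              rw [← Real.rpow_neg_one, ← Real.rpow_add hn1]; congr 1; ring
          rw [this]
          have : (n:ℝ) ^ (1 - x) ≤ (N:ℝ) ^ (1 - x) := Real.rpow_le_rpow hn1.le (by exact_mod_cast hn'.2) (by linarith)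
          gcongr
      _ ≤ _ := by
          rw [← Finset.mul_sum, ← Finset.mul_sum]
          gcongr
          exact sum_inv_le N
  have a2' : (∑ n ∈ Finset.Icc 1 N, ‖c n‖) ^ 2 ≤ (A ^ 2 * (N:ℝ) ^ (2 * e)) * ((N:ℝ) ^ (2 - 2 * x) * L ^ 2) := by
    refine (pow_le_pow_left₀ (by positivity) a2 2).trans (le_of_eq ?_)
    have e1 : ((N:ℝ) ^ e) ^ 2 = (N:ℝ) ^ (2 * e) := by
      rw [← Real.rpow_natCast, ← Real.rpow_mul hN0.le]; congr 1; push_cast; ring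
    have e2 : ((N:ℝ) ^ (1 - x)) ^ 2 = (N:ℝ) ^ (2 - 2 * x) := by
      rw [← Real.rpow_natCast, ← Real.rpow_mul hN0.le]; congr 1; push_cast; ring
    rw [mul_pow, mul_pow, mul_pow, e1, e2]
  have a3 : ∑ n ∈ Finset.Icc 1 N, n * ‖c n‖ ^ 2 ≤ (A ^ 2 * (N:ℝ) ^ (2 * e)) * ((N:ℝ) ^ (2 - 2 * x) * L) := by
    calc _ ≤ ∑ n ∈ Finset.Icc 1 N, (A ^ 2 * (N:ℝ) ^ (2 * e)) * ((N:ℝ) ^ (2 - 2 * x) * (n:ℝ)⁻¹) := by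
          refine Finset.sum_le_sum fun n hn => ?_
          have hn' := Finset.mem_Icc.mp hn
          have hn1 : (0:ℝ) < n := by exact_mod_cast hn'.1
          have h1 : (n:ℝ) * ‖c n‖ ^ 2 ≤ n * ((A ^ 2 * (N:ℝ) ^ (2 * e)) * (n:ℝ) ^ (-2 * x)) := by
            gcongr; exact hcn2 n hn
          refine h1.trans ?_
          have : (n:ℝ) ^ (2 - 2 * x) ≤ (N:ℝ) ^ (2 - 2 * x) := Real.rpow_le_rpow hn1.le (by exact_mod_cast hn'.2) (by linarith)
          have e1 : (n:ℝ) * (n:ℝ) ^ (-2 * x) = (n:ℝ) ^ (2 - 2 * x) * (n:ℝ)⁻¹ := by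
              rw [← Real.rpow_neg_one, ← Real.rpow_add hn1]
              nth_rewrite 1 [← Real.rpow_one (n:ℝ)]
              rw [← Real.rpow_add hn1]; congr 1; ring
          calc _ = (A ^ 2 * (N:ℝ) ^ (2 * e)) * ((n:ℝ) * (n:ℝ) ^ (-2 * x)) := by ring
            _ ≤ _ := by rw [e1]; gcongr
      _ ≤ _ := by
          rw [← Finset.mul_sum, ← Finset.mul_sum]
          gcongr
          exact sum_inv_le N
  set Q := A ^ 2 * (N:ℝ) ^ (2 * e) with hQ
  have hQ0 : 0 ≤ Q := by positivity
  set W := (N:ℝ) ^ (2 - 2 * x) with hW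
  have hW0 : 0 ≤ W := by positivity
  have hLL : L ≤ L ^ 2 := by nlinarith
  calc _ ≤ 12 * L ^ 3 * (T * (Q * (Bd * L)) + Q * (W * L ^ 2) + Q * (W * L)) := by gcongr
    _ ≤ 12 * L ^ 3 * (T * (Q * (Bd * L ^ 2)) + Q * (W * L ^ 2) + Q * (W * L ^ 2)) := by gcongr
    _ ≤ 24 * L ^ 5 * (Q * (T * Bd + W)) := by
        have : 0 ≤ L ^ 3 * (T * (Q * (Bd * L ^ 2))) := by positivity
        linarith
    _ ≤ 24 * (C0 * (N:ℝ) ^ e) * (Q * (T * Bd + W)) := by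
        gcongr
        exact hC N hN1
    _ = _ := by
        have : (N:ℝ) ^ (3 * e) = (N:ℝ) ^ e * (N:ℝ) ^ (2 * e) := by
          rw [← Real.rpow_add hN0]; congr 1; ring
        rw [this, hQ]; ring

/-! divisor bound -/

lemma prime_factor_bound (e : ℝ) (he : 0 < e) : ∃ C : ℝ, 1 ≤ C ∧ ∃ K : ℕ, ∀ p a : ℕ, 2 ≤ p →
    ((a:ℝ) + 1) ≤ (if p < K then C else 1) * ((p:ℝ) ^ a) ^ e := by
  obtain ⟨K, hK⟩ := exists_nat_ge ((2:ℝ) ^ (1 / e))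
  have hl2 := Real.log_pos (show (1:ℝ) < 2 by norm_num)
  refine ⟨1 + 1 / (e * Real.log 2), by have : 0 < 1 / (e * Real.log 2) := by positivity
                                       linarith, K, fun p a hp => ?_⟩
  have hp' : (2:ℝ) ≤ p := by exact_mod_cast hp
  split_ifs with h
  · have h1 : ((2:ℝ) ^ a) ^ e ≤ ((p:ℝ) ^ a) ^ e := by gcongr
    have h2 : (a:ℝ) * (e * Real.log 2) + 1 ≤ ((2:ℝ) ^ a) ^ e := by
      have := Real.add_one_le_exp ((a:ℝ) * (e * Real.log 2))
      refine this.trans (le_of_eq ?_)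
      rw [Real.rpow_def_of_pos (by positivity), Real.log_pow]; ring_nf
    have h3 : 1 ≤ ((2:ℝ) ^ a) ^ e := Real.one_le_rpow (one_le_pow₀ (by norm_num)) he.le
    have hc : 0 < e * Real.log 2 := by positivity
    have h4 : (a:ℝ) ≤ 1 / (e * Real.log 2) * ((2:ℝ) ^ a) ^ e := by
      rw [div_mul_eq_mul_div, one_mul, le_div_iff₀ hc]; linarith
    calc (a:ℝ) + 1 ≤ (1 + 1 / (e * Real.log 2)) * ((2:ℝ) ^ a) ^ e := by linarith
      _ ≤ _ := by gcongr
  · push Not at h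
    have h1 : (2:ℝ) ≤ (p:ℝ) ^ e := by
      have h2 : (2:ℝ) ^ (1 / e) ≤ p := hK.trans (by exact_mod_cast h)
      calc (2:ℝ) = ((2:ℝ) ^ (1 / e)) ^ e := by
            rw [← Real.rpow_mul (by norm_num)]; field_simp; simp
        _ ≤ _ := by gcongr
    rw [one_mul, ← Real.rpow_natCast, ← Real.rpow_mul (by positivity), mul_comm, Real.rpow_mul (by positivity), Real.rpow_natCast]
    have h2 : ((a:ℝ) + 1) ≤ 2 ^ a := by
      have := Nat.lt_two_pow_self (n := a)
      exact_mod_cast this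
    exact h2.trans (by gcongr)

lemma divisor_bound (e : ℝ) (he : 0 < e) : ∃ C > 0, ∀ n : ℕ, 1 ≤ n → (n.divisors.card : ℝ) ≤ C * (n:ℝ) ^ e := by
  obtain ⟨C, hC1, K, h⟩ := prime_factor_bound e he
  refine ⟨C ^ K, by positivity, fun n hn => ?_⟩
  have hn0 : n ≠ 0 := by omega
  rw [Nat.card_divisors hn0]
  push_cast
  have h1 : (n:ℝ) ^ e = ∏ p ∈ n.primeFactors, ((p:ℝ) ^ (n.factorization p)) ^ e := by
    rw [Real.finsetProd_rpow _ _ (fun i _ => by positivity)]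
    congr 1
    have := Nat.prod_factorization_pow_eq_self hn0
    nth_rewrite 1 [← this]
    rw [Finsupp.prod]; push_cast; simp
  rw [h1]
  calc _ ≤ ∏ p ∈ n.primeFactors, (if p < K then C else 1) * ((p:ℝ) ^ (n.factorization p)) ^ e := by
        apply Finset.prod_le_prod
        · intros; positivity
        · intro p hp
          exact h p _ (Nat.prime_of_mem_primeFactors hp).two_le
    _ = (∏ p ∈ n.primeFactors, (if p < K then C else 1)) * ∏ p ∈ n.primeFactors, ((p:ℝ) ^ (n.factorization p)) ^ e :=
        Finset.prod_mul_distrib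
    _ ≤ _ := by
        gcongr
        rw [← Finset.prod_filter, Finset.prod_const]
        apply pow_le_pow_right₀ hC1
        calc _ ≤ (Finset.range K).card := by
              apply Finset.card_le_card
              intro p hp
              simp at hp ⊢; exact hp.2
          _ = K := by simp

end ZD
end

section
open Complex MeasureTheory

namespace ZD

lemma conv_bound (e : ℝ) (he : 0 < e) : ∃ C > 0, ∀ (f g : ℕ → ℂ) (A B : ℝ), 0 ≤ A → 0 ≤ B →
    (∀ n ≥ 1, ‖f n‖ ≤ A * (n:ℝ) ^ e) → (∀ n ≥ 1, ‖g n‖ ≤ B * (n:ℝ) ^ e) →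
    ∀ n ≥ 1, ‖(LSeries.convolution f g) n‖ ≤ C * (A * B) * (n:ℝ) ^ (2 * e) := by
  obtain ⟨C, hC, h⟩ := divisor_bound e he
  refine ⟨C, hC, fun f g A B hA hB hf hg n hn => ?_⟩
  rw [LSeries.convolution_def]
  have hn0 : (0:ℝ) < n := by exact_mod_cast hn
  calc ‖∑ p ∈ n.divisorsAntidiagonal, f p.1 * g p.2‖ ≤ ∑ p ∈ n.divisorsAntidiagonal, A * B * (n:ℝ) ^ e := by
        refine (norm_sum_le _ _).trans (Finset.sum_le_sum fun p hp => ?_)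
        rw [Nat.mem_divisorsAntidiagonal] at hp
        have h1 : 1 ≤ p.1 := Nat.one_le_iff_ne_zero.mpr (by rintro h0; simp [h0] at hp; omega)
        have h2 : 1 ≤ p.2 := Nat.one_le_iff_ne_zero.mpr (by rintro h0; simp [h0] at hp; omega)
        rw [norm_mul, ← hp.1]
        push_cast
        rw [Real.mul_rpow (by positivity) (by positivity)]
        calc ‖f p.1‖ * ‖g p.2‖ ≤ (A * (p.1:ℝ) ^ e) * (B * (p.2:ℝ) ^ e) :=
              mul_le_mul (hf _ h1) (hg _ h2) (norm_nonneg _) (by positivity)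
          _ = _ := by ring
    _ = (n.divisors.card : ℝ) * (A * B * (n:ℝ) ^ e) := by
        rw [Finset.sum_const, nsmul_eq_mul]
        rw [← Nat.map_div_right_divisors, Finset.card_map]
    _ ≤ (C * (n:ℝ) ^ e) * (A * B * (n:ℝ) ^ e) := by
        gcongr; exact h n hn
    _ = _ := by
        rw [two_mul, Real.rpow_add hn0]; ring

/-- iterated Dirichlet convolution -/
noncomputable def cpw (f : ℕ → ℂ) : ℕ → (ℕ → ℂ)
  | 0 => fun n => if n = 1 then 1 else 0
  | k + 1 => LSeries.convolution f (cpw f k)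

lemma cpw_bound (k : ℕ) : ∀ e : ℝ, 0 < e → ∃ e' : ℝ, 0 < e' ∧ e' ≤ e ∧ ∃ C : ℝ, 0 < C ∧ ∀ (f : ℕ → ℂ) (A : ℝ), 0 ≤ A →
    (∀ n ≥ 1, ‖f n‖ ≤ A * (n:ℝ) ^ e') → ∀ n ≥ 1, ‖cpw f k n‖ ≤ C * A ^ k * (n:ℝ) ^ e := by
  induction k with
  | zero =>
    intro e he
    refine ⟨e, he, le_rfl, 1, one_pos, fun f A hA hf n hn => ?_⟩
    have : (1:ℝ) ≤ (n:ℝ) ^ e := Real.one_le_rpow (by exact_mod_cast hn) (le_of_lt he)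
    simp only [cpw, pow_zero, one_mul]
    split_ifs
    · simpa using this
    · simp; positivity
  | succ k ih =>
    intro e he
    obtain ⟨e', he', hle, C, hC, h⟩ := ih (e / 2) (by positivity)
    obtain ⟨C2, hC2, h2⟩ := conv_bound (e / 2) (by positivity)
    refine ⟨e', he', by linarith, C2 * C, by positivity, fun f A hA hf n hn => ?_⟩
    have := h2 f (cpw f k) A (C * A ^ k) hA (by positivity) (fun n hn => (hf n hn).trans ?_) (h f A hA hf) n hn
    · rw [show 2 * (e / 2) = e by ring] at this
      refine this.trans (le_of_eq ?_)
      ring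
    · gcongr
      exact_mod_cast hn

lemma conv_supp {f g : ℕ → ℂ} {a b a' b' : ℝ} (ha : 0 ≤ a) (ha' : 0 ≤ a')
    (hf : ∀ n, f n ≠ 0 → a ≤ n ∧ (n:ℝ) ≤ b) (hg : ∀ n, g n ≠ 0 → a' ≤ n ∧ (n:ℝ) ≤ b') :
    ∀ n, (LSeries.convolution f g) n ≠ 0 → a * a' ≤ n ∧ (n:ℝ) ≤ b * b' := by
  intro n hn
  rw [LSeries.convolution_def] at hn
  obtain ⟨p, hp, hne⟩ := Finset.exists_ne_zero_of_sum_ne_zero hn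
  rw [Nat.mem_divisorsAntidiagonal] at hp
  obtain ⟨h1, h2⟩ := hf _ (left_ne_zero_of_mul hne)
  obtain ⟨h3, h4⟩ := hg _ (right_ne_zero_of_mul hne)
  rw [← hp.1]; push_cast
  constructor
  · gcongr
  · have : 0 ≤ b := (Nat.cast_nonneg _).trans h2
    gcongr

lemma cpw_supp {f : ℕ → ℂ} {a b : ℝ} (ha : 0 ≤ a)
    (hf : ∀ n, f n ≠ 0 → a ≤ n ∧ (n:ℝ) ≤ b) (k : ℕ) : ∀ n, cpw f k n ≠ 0 → a ^ k ≤ n ∧ (n:ℝ) ≤ b ^ k := by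
  induction k with
  | zero =>
    intro n hn
    simp only [cpw] at hn
    have : n = 1 := by by_contra h; simp [h] at hn
    simp [this]
  | succ k ih =>
    intro n hn
    rw [pow_succ', pow_succ']
    exact conv_supp ha (by positivity) hf ih n hn

lemma term_eq (f : ℕ → ℂ) (s : ℂ) (n : ℕ) (hn : 1 ≤ n) : LSeries.term f s n = f n * (n:ℂ) ^ (-s) := by
  rw [LSeries.term_of_ne_zero (by omega), cpow_neg, div_eq_mul_inv]

lemma DP_hasSum (N : ℕ) (f : ℕ → ℂ) (hf : ∀ n, N < n → f n = 0) (s : ℂ) :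
    LSeriesHasSum f s (DP N f s) := by
  have h : HasSum (LSeries.term f s) (∑ n ∈ Finset.Icc 1 N, LSeries.term f s n) := hasSum_sum_of_ne_finset_zero (by
    intro n hn
    rcases Nat.eq_zero_or_pos n with rfl | h
    · simp
    · rw [LSeries.term_of_ne_zero (by omega), hf n (by
        by_contra h'
        exact hn (Finset.mem_Icc.mpr ⟨h, by omega⟩)), zero_div])
  unfold LSeriesHasSum DP
  convert h using 1
  exact Finset.sum_congr rfl fun n hn => (term_eq f s n (Finset.mem_Icc.mp hn).1).symm

lemma DP_mul (N M : ℕ) (f g : ℕ → ℂ) (hf : ∀ n, N < n → f n = 0) (hg : ∀ n, M < n → g n = 0) (s : ℂ) :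
    DP N f s * DP M g s = DP (N * M) (LSeries.convolution f g) s := by
  have h1 := (DP_hasSum N f hf s).convolution (DP_hasSum M g hg s)
  have h2 := DP_hasSum (N * M) (LSeries.convolution f g) (by
    intro n hn
    by_contra h0
    have := (conv_supp (a := 0) (a' := 0) (b := N) (b' := M) le_rfl le_rfl (fun n hn => ⟨by positivity, by
      have := mt (hf n) hn
      exact_mod_cast not_lt.mp this⟩) (fun n hn => ⟨by positivity, by
      have := mt (hg n) hn
      exact_mod_cast not_lt.mp this⟩) n h0).2
    have : n ≤ N * M := by exact_mod_cast this
    omega) s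
  exact HasSum.unique h1 h2

lemma cpw_zero_of_lt (N : ℕ) (f : ℕ → ℂ) (hf : ∀ n, N < n → f n = 0) (k : ℕ) (n : ℕ) (hn : N ^ k < n) :
    cpw f k n = 0 := by
  by_contra h0
  have := (cpw_supp (a := 0) (b := N) le_rfl (fun n hn => ⟨by positivity, by
      have := mt (hf n) hn
      exact_mod_cast not_lt.mp this⟩) k n h0).2
  have : n ≤ N ^ k := by exact_mod_cast this
  omega

lemma DP_pow (N : ℕ) (f : ℕ → ℂ) (hf : ∀ n, N < n → f n = 0) (k : ℕ) (s : ℂ) :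
    DP N f s ^ k = DP (N ^ k) (cpw f k) s := by
  induction k with
  | zero => simp [DP, cpw]
  | succ k ih =>
    rw [pow_succ', ih, DP_mul N (N ^ k) f (cpw f k) hf (cpw_zero_of_lt N f hf k), pow_succ', cpw]

lemma tail_bound : ∃ C > 0, ∀ (f : ℕ → ℂ) (A e c : ℝ) (N : ℕ) (s : ℂ), 0 ≤ A → s.re = c → 2 + e ≤ c → 1 ≤ N →
    (∀ n ≥ 1, ‖f n‖ ≤ A * (n:ℝ) ^ e) → ‖LSeries f s - DP N f s‖ ≤ C * A * (N:ℝ) ^ (2 + e - c) := by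
  have hs2 : Summable (fun n : ℕ => (n:ℝ) ^ (-2:ℝ)) := Real.summable_nat_rpow.mpr (by norm_num)
  refine ⟨1 + ∑' n : ℕ, (n:ℝ) ^ (-2:ℝ), by
    have : 0 ≤ ∑' n : ℕ, (n:ℝ) ^ (-2:ℝ) := tsum_nonneg fun n => by positivity
    linarith, fun f A e c N s hA hs hc hN hf => ?_⟩
  have hN1 : (1:ℝ) ≤ N := by exact_mod_cast hN
  have hterm : ∀ n ≥ 1, ‖LSeries.term f s n‖ ≤ A * (n:ℝ) ^ (e - c) := by
    intro n hn
    have hn0 : (0:ℝ) < n := by exact_mod_cast hn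
    rw [term_eq f s n hn, norm_mul, norm_natCast_cpow' n hn, neg_re, hs]
    calc _ ≤ (A * (n:ℝ) ^ e) * (n:ℝ) ^ (-c) := by gcongr; exact hf n hn
      _ = _ := by rw [mul_assoc, ← Real.rpow_add hn0]; rfl
  set g : ℕ → ℂ := fun n => if n ≤ N then f n else 0 with hg
  have hDP : DP N f s = DP N g s := by
    unfold DP
    refine Finset.sum_congr rfl fun n hn => ?_
    simp [hg, (Finset.mem_Icc.mp hn).2]
  have hgs := DP_hasSum N g (fun n hn => by simp [hg, hn]) s
  have hsum : LSeriesSummable f s := by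
    apply LSeriesSummable_of_le_const_mul_rpow (x := c - 1) (by rw [hs]; linarith)
    refine ⟨A, fun n hn => (hf n (Nat.one_le_iff_ne_zero.mpr hn)).trans ?_⟩
    have : (1:ℝ) ≤ n := by exact_mod_cast Nat.one_le_iff_ne_zero.mpr hn
    have h5 : e ≤ c - 1 - 1 := by linarith
    exact mul_le_mul_of_nonneg_left (Real.rpow_le_rpow_of_exponent_le this h5) hA
  have hd := HasSum.sub hsum.LSeriesHasSum hgs
  rw [hDP]
  have h1 : ∀ n, ‖(fun n => LSeries.term f s n - LSeries.term g s n) n‖ ≤ (A * (N:ℝ) ^ (2 + e - c)) * (n:ℝ) ^ (-2:ℝ) := by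
    intro n
    rcases Nat.eq_zero_or_pos n with rfl | hn
    · simp only [LSeries.term_zero, sub_zero, norm_zero]; positivity
    · by_cases hnN : n ≤ N
      · have : LSeries.term f s n - LSeries.term g s n = 0 := by
          rw [term_eq _ _ _ hn, term_eq _ _ _ hn]; simp [hg, hnN]
        simp only [this, norm_zero]; positivity
      · have : LSeries.term g s n = 0 := by
          rw [term_eq _ _ _ hn]; simp [hg, hnN]
        simp only [this, sub_zero]
        refine (hterm n hn).trans ?_
        have hn0 : (0:ℝ) < n := by exact_mod_cast hn
        rw [mul_assoc]
        gcongr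
        have e1 : (n:ℝ) ^ (e - c) = (n:ℝ) ^ (2 + e - c) * (n:ℝ) ^ (-2:ℝ) := by
          rw [← Real.rpow_add hn0]; congr 1; ring
        rw [e1]
        gcongr ?_ * _
        apply Real.rpow_le_rpow_of_nonpos (by linarith) _ (by linarith)
        exact_mod_cast (not_le.mp hnN).le
  have h2 := tsum_of_norm_bounded (hs2.hasSum.mul_left (A * (N:ℝ) ^ (2 + e - c))) h1
  rw [hd.tsum_eq] at h2
  refine h2.trans ?_
  have : 0 ≤ A * (N:ℝ) ^ (2 + e - c) := by positivity
  nlinarith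

end ZD
end

section
open Complex MeasureTheory Filter Topology

namespace ZD

lemma int_rpow_exp (s b : ℝ) (hs : -1 < s) (hb : 0 < b) :
    IntegrableOn (fun x : ℝ => x ^ s * Real.exp (-(b * x))) (Set.Ioi 0) := by
  have := integrableOn_rpow_mul_exp_neg_mul_rpow (s := s) (p := 1) (b := b) hs one_pos hb
  refine this.congr_fun (fun x _ => ?_) measurableSet_Ioi
  simp

lemma laplace_int {a r : ℂ} (ha : 0 < a.re) (hr : 0 < r.re) :
    IntegrableOn (fun t : ℝ => (t:ℂ) ^ (a - 1) * cexp (-(r * t))) (Set.Ioi 0) := by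
  have h := int_rpow_exp (a.re - 1) r.re (by linarith) hr
  refine Integrable.mono' h ?_ ?_
  · apply ContinuousOn.aestronglyMeasurable _ measurableSet_Ioi
    intro t ht
    apply ContinuousAt.continuousWithinAt
    apply ContinuousAt.mul
    · exact (continuousAt_ofReal_cpow_const t (a - 1) (Or.inr ht.ne'))
    · fun_prop
  · rw [ae_restrict_iff' measurableSet_Ioi]
    refine ae_of_all _ fun t ht => ?_
    rw [norm_mul, Complex.norm_exp, Complex.norm_cpow_eq_rpow_re_of_pos ht]
    simp

lemma laplace_deriv {a : ℂ} (ha : 0 < a.re) {r : ℂ} (hr : 0 < r.re) :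
    DifferentiableAt ℂ (fun r : ℂ => ∫ t in Set.Ioi (0:ℝ), (t:ℂ) ^ (a - 1) * cexp (-(r * t))) r := by
  have hb : 0 < r.re / 2 := by linarith
  have key := hasDerivAt_integral_of_dominated_loc_of_deriv_le (𝕜 := ℂ)
    (μ := volume.restrict (Set.Ioi (0:ℝ)))
    (F := fun (r : ℂ) (t : ℝ) => (t:ℂ) ^ (a - 1) * cexp (-(r * t)))
    (F' := fun (r : ℂ) (t : ℝ) => (t:ℂ) ^ (a - 1) * (cexp (-(r * t)) * -t))
    (x₀ := r) (s := {z : ℂ | r.re / 2 < z.re})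
    (bound := fun t : ℝ => t ^ a.re * Real.exp (-(r.re / 2 * t)))
    ((isOpen_lt continuous_const continuous_re).mem_nhds (by
      show r.re / 2 < r.re
      linarith))
    ?_ (laplace_int ha hr) ?_ ?_ (int_rpow_exp _ _ (by linarith) hb) ?_
  · exact key.2.differentiableAt
  · filter_upwards [(isOpen_lt continuous_const continuous_re).mem_nhds (show r ∈ {z : ℂ | 0 < z.re} from hr)] with z hz
    exact (laplace_int ha hz).aestronglyMeasurable
  · apply ContinuousOn.aestronglyMeasurable _ measurableSet_Ioi
    intro t ht
    apply ContinuousAt.continuousWithinAt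
    apply ContinuousAt.mul
    · exact (continuousAt_ofReal_cpow_const t (a - 1) (Or.inr ht.ne'))
    · fun_prop
  · rw [ae_restrict_iff' measurableSet_Ioi]
    refine ae_of_all _ fun t ht z hz => ?_
    have ht' : 0 < t := ht
    have hz' : r.re / 2 < z.re := hz
    rw [norm_mul, norm_mul, Complex.norm_exp, Complex.norm_cpow_eq_rpow_re_of_pos ht, norm_neg, Complex.norm_real,
      Real.norm_eq_abs, abs_of_pos ht']
    simp only [sub_re, one_re, neg_re, mul_re, ofReal_re, ofReal_im, mul_zero, sub_zero]
    have e : t ^ a.re = t ^ (a.re - 1) * t := by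
      conv_lhs => rw [show a.re = (a.re - 1) + 1 by ring, Real.rpow_add ht', Real.rpow_one]
    rw [e]
    have : Real.exp (-(z.re * t)) ≤ Real.exp (-(r.re / 2 * t)) := by
      apply Real.exp_le_exp.mpr
      nlinarith
    calc _ = t ^ (a.re - 1) * t * Real.exp (-(z.re * t)) := by ring
      _ ≤ _ := by gcongr
  · refine ae_of_all _ fun t z _ => ?_
    have h1 : HasDerivAt (fun z : ℂ => -(z * t)) (-(1 * (t:ℂ))) z := ((hasDerivAt_id z).mul_const _).neg
    refine ((h1.cexp).const_mul _).congr_deriv ?_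
    simp

lemma laplace {a r : ℂ} (ha : 0 < a.re) (hr : 0 < r.re) :
    ∫ t in Set.Ioi (0:ℝ), (t:ℂ) ^ (a - 1) * cexp (-(r * t)) = r ^ (-a) * Gamma a := by
  set U : Set ℂ := {z : ℂ | 0 < z.re}
  have hU : IsOpen U := isOpen_lt continuous_const continuous_re
  have hUc : IsPreconnected U := (convex_halfSpace_re_gt 0).isPreconnected
  have h1 : AnalyticOnNhd ℂ (fun r : ℂ => ∫ t in Set.Ioi (0:ℝ), (t:ℂ) ^ (a - 1) * cexp (-(r * t))) U :=
    DifferentiableOn.analyticOnNhd (fun z hz => (laplace_deriv ha hz).differentiableWithinAt) hU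
  have h2 : AnalyticOnNhd ℂ (fun r : ℂ => r ^ (-a) * Gamma a) U := by
    apply DifferentiableOn.analyticOnNhd _ hU
    intro z hz
    apply DifferentiableAt.differentiableWithinAt
    apply DifferentiableAt.mul_const
    exact (differentiableAt_id).cpow_const (Or.inl hz)
  have hfreq : ∃ᶠ z in 𝓝[≠] (1:ℂ), (∫ t in Set.Ioi (0:ℝ), (t:ℂ) ^ (a - 1) * cexp (-(z * t))) = z ^ (-a) * Gamma a := by
    have ht : Tendsto (fun n : ℕ => ((1 + 1 / ((n:ℝ) + 1) : ℝ) : ℂ)) atTop (𝓝[≠] 1) := by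
      apply tendsto_nhdsWithin_of_tendsto_nhds_of_eventually_within
      · have h5 : Tendsto (fun n : ℕ => (1 + 1 / ((n:ℝ) + 1))) atTop (𝓝 (1 + 0)) :=
          tendsto_one_div_add_atTop_nhds_zero_nat.const_add 1
        have := (continuous_ofReal.tendsto _).comp h5
        rw [add_zero, ofReal_one] at this
        exact this
      · refine Eventually.of_forall fun n => ?_
        rw [Set.mem_compl_singleton_iff, Ne, ofReal_eq_one]
        have : 0 < 1 / ((n:ℝ) + 1) := by positivity
        linarith
    refine ht.frequently (Eventually.frequently (Eventually.of_forall fun n => ?_))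
    have hp : 0 < 1 + 1 / ((n:ℝ) + 1) := by positivity
    rw [integral_cpow_mul_exp_neg_mul_Ioi ha hp]
    congr 1
    rw [one_div, ← ofReal_inv, cpow_neg, ← inv_cpow, ofReal_inv]
    rw [arg_ofReal_of_nonneg hp.le]
    exact Real.pi_pos.ne
  exact h1.eqOn_of_preconnected_of_frequently_eq h2 hUc (show (1:ℂ) ∈ U by simp [U]) hfreq hr

/-- test function for Poisson summation -/
noncomputable def pf (t N : ℝ) (x : ℝ) : ℂ := if 0 < x then (x:ℂ) ^ (1 - t * I) * Real.exp (-(x / N)) else 0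

lemma pf_norm (t N x : ℝ) (hx : 0 < x) : ‖pf t N x‖ = x * Real.exp (-(x / N)) := by
  rw [pf, if_pos hx, norm_mul, Complex.norm_cpow_eq_rpow_re_of_pos hx, Complex.norm_real, Real.norm_eq_abs, Real.abs_exp]
  simp

lemma pf_cont (t N : ℝ) (hN : 0 < N) : Continuous (pf t N) := by
  rw [continuous_iff_continuousAt]
  intro x
  rcases lt_trichotomy x 0 with hx | hx | hx
  · have : pf t N =ᶠ[𝓝 x] fun _ => 0 := by
      filter_upwards [Iio_mem_nhds hx] with y hy
      rw [pf, if_neg (not_lt.mpr (le_of_lt hy))]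
    exact continuousAt_const.congr this.symm
  · subst hx
    have h0 : pf t N 0 = 0 := by simp [pf]
    rw [ContinuousAt, h0]
    rw [tendsto_zero_iff_norm_tendsto_zero]
    refine squeeze_zero (g := fun x : ℝ => |x|) (fun _ => norm_nonneg _) (fun y => ?_) ?_
    · by_cases hy : 0 < y
      · rw [pf_norm t N y hy, abs_of_pos hy]
        apply mul_le_of_le_one_right hy.le
        apply Real.exp_le_one_iff.mpr
        have : 0 < y / N := by positivity
        linarith
      · rw [pf, if_neg hy]; simp
    · have := continuous_abs.tendsto (0:ℝ)
      simpa using this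
  · have : pf t N =ᶠ[𝓝 x] fun x => (x:ℂ) ^ (1 - t * I) * Real.exp (-(x / N)) := by
      filter_upwards [Ioi_mem_nhds hx] with y hy
      rw [pf, if_pos (show 0 < y from hy)]
    refine ContinuousAt.congr ?_ this.symm
    apply ContinuousAt.mul
    · exact (continuousAt_ofReal_cpow_const x _ (Or.inr hx.ne'))
    · fun_prop

open scoped FourierTransform in
lemma pf_fourier (t N : ℝ) (hN : 0 < N) (ξ : ℝ) :
    𝓕 (pf t N) ξ = (1 / N + 2 * Real.pi * ξ * I) ^ (-(2 - t * I)) * Gamma (2 - t * I) := by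
  rw [← laplace (by simp) (by simp; positivity)]
  rw [Real.fourier_real_eq_integral_exp_smul]
  rw [← integral_indicator measurableSet_Ioi]
  congr 1
  ext x
  by_cases hx : 0 < x
  · rw [Set.indicator_of_mem (show x ∈ Set.Ioi 0 from hx), pf, if_pos hx, smul_eq_mul]
    rw [show (2 - t * I - 1 : ℂ) = 1 - t * I by ring]
    push_cast
    rw [mul_comm, mul_assoc, ← Complex.exp_add]
    congr 2
    ring
  · rw [Set.indicator_of_notMem (by simpa using hx), pf, if_neg hx]; simp

end ZD
end

section
open Complex MeasureTheory Filter Topology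

namespace ZD

lemma norm_Gamma_one_sq (y : ℝ) (hy : y ≠ 0) : ‖Gamma (1 + y * I)‖ ^ 2 = Real.pi * y / Real.sinh (Real.pi * y) := by
  have hyI : (y:ℂ) * I ≠ 0 := mul_ne_zero (by exact_mod_cast hy) I_ne_zero
  have h1 : Gamma (1 + y * I) * Gamma (1 - y * I) = Real.pi * y / Real.sinh (Real.pi * y) := by
    have h2 := Complex.Gamma_mul_Gamma_one_sub (y * I)
    rw [add_comm, Gamma_add_one _ hyI, mul_assoc, h2]
    rw [show (Real.pi:ℂ) * (y * I) = ((Real.pi * y : ℝ):ℂ) * I by push_cast; ring, sin_mul_I, ofReal_sinh]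
    have h3 : Complex.sinh ((Real.pi * y : ℝ):ℂ) ≠ 0 := by
      rw [← ofReal_sinh]
      have : Real.sinh (Real.pi * y) ≠ 0 := by
        rw [Ne, Real.sinh_eq_zero]; positivity
      exact_mod_cast this
    field_simp
    try push_cast
    try ring
  have h4 : (starRingEnd ℂ) (Gamma (1 + y * I)) = Gamma (1 - y * I) := by
    rw [← Complex.Gamma_conj]; congr 1; simp [sub_eq_add_neg]
  have h5 : ((‖Gamma (1 + y * I)‖ ^ 2 : ℝ) : ℂ) = ((Real.pi * y / Real.sinh (Real.pi * y) : ℝ) : ℂ) := by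
    rw [← Complex.normSq_eq_norm_sq, ← Complex.mul_conj, h4, h1]; push_cast; ring
  exact_mod_cast h5

lemma norm_Gamma_half_sq (y : ℝ) : ‖Gamma (1 / 2 + y * I)‖ ^ 2 = Real.pi / Real.cosh (Real.pi * y) := by
  have h1 : Gamma (1 / 2 + y * I) * Gamma (1 / 2 - y * I) = Real.pi / Real.cosh (Real.pi * y) := by
    have h2 := Complex.Gamma_mul_Gamma_one_sub (1 / 2 + y * I)
    rw [show (1 - (1 / 2 + y * I) : ℂ) = 1 / 2 - y * I by ring] at h2
    rw [h2]
    rw [show (Real.pi:ℂ) * (1 / 2 + y * I) = ((Real.pi * y : ℝ):ℂ) * I + Real.pi / 2 by push_cast; ring,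
      Complex.sin_add_pi_div_two, Complex.cos_mul_I, ofReal_cosh]
  have h4 : (starRingEnd ℂ) (Gamma (1 / 2 + y * I)) = Gamma (1 / 2 - y * I) := by
    rw [← Complex.Gamma_conj]; congr 1; simp [sub_eq_add_neg, map_ofNat]
  have h5 : ((‖Gamma (1 / 2 + y * I)‖ ^ 2 : ℝ) : ℂ) = ((Real.pi / Real.cosh (Real.pi * y) : ℝ) : ℂ) := by
    rw [← Complex.normSq_eq_norm_sq, ← Complex.mul_conj, h4, h1]; push_cast; ring
  exact_mod_cast h5

/-- size of Γ(2 - it) -/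
lemma norm_Gamma_two (t : ℝ) : ‖Gamma (2 - t * I)‖ ≤ 4 * (1 + |t|) ^ (3 / 2 : ℝ) * Real.exp (-(Real.pi * |t| / 2)) := by
  by_cases ht : t = 0
  · subst ht; simp [Complex.Gamma_ofNat_eq_factorial]
  have hI : (1 + (-t : ℝ) * I : ℂ) ≠ 0 := by
    intro h
    have := congrArg re h
    simp at this
  have h1 : Gamma (2 - t * I) = (1 + (-t : ℝ) * I) * Gamma (1 + (-t : ℝ) * I) := by
    rw [← Gamma_add_one _ hI]; congr 1; push_cast; ring
  have h2 := norm_Gamma_one_sq (-t) (neg_ne_zero.mpr ht)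
  have h3 : Real.pi * -t / Real.sinh (Real.pi * -t) = Real.pi * |t| / Real.sinh (Real.pi * |t|) := by
    rcases abs_cases t with ⟨h, _⟩ | ⟨h, _⟩ <;> rw [h]
    rw [mul_neg, Real.sinh_neg]; field_simp
  rw [h3] at h2
  set u := Real.pi * |t| with hu
  have hu0 : 0 < u := by positivity
  have h4 : u / Real.sinh u ≤ 2 * (1 + u) * Real.exp (-u) := by
    rw [div_le_iff₀ (Real.sinh_pos_iff.mpr hu0), Real.sinh_eq]
    have e : Real.exp (-u) * (Real.exp u) = 1 := by rw [← Real.exp_add]; simp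
    have e1 : Real.exp (-u) * Real.exp (-u) = Real.exp (-(2 * u)) := by rw [← Real.exp_add]; congr 1; ring
    have e2 : (1 + 2 * u) * Real.exp (-(2 * u)) ≤ 1 := by
      have := Real.add_one_le_exp (2 * u)
      have h6 : Real.exp (2 * u) * Real.exp (-(2 * u)) = 1 := by rw [← Real.exp_add]; simp
      nlinarith [Real.exp_pos (-(2 * u))]
    have : 2 * (1 + u) * Real.exp (-u) * ((Real.exp u - Real.exp (-u)) / 2) = (1 + u) * (1 - Real.exp (-(2 * u))) := by
      rw [← e, ← e1]; ring
    rw [this]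
    nlinarith [Real.exp_pos (-(2 * u))]
  have h5 : ‖(1 + (-t : ℝ) * I : ℂ)‖ ≤ 1 + |t| := by
    refine (norm_add_le _ _).trans ?_
    simp
  have hsq : ‖Gamma (2 - t * I)‖ ^ 2 ≤ (4 * (1 + |t|) ^ (3 / 2 : ℝ) * Real.exp (-(u / 2))) ^ 2 := by
    rw [h1, norm_mul, mul_pow, h2]
    have e1 : ((1 + |t|) ^ (3 / 2 : ℝ)) ^ 2 = (1 + |t|) ^ 3 := by
      rw [← Real.rpow_natCast, ← Real.rpow_mul (by positivity), ← Real.rpow_natCast]; norm_num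
    have e2 : Real.exp (-(u / 2)) ^ 2 = Real.exp (-u) := by
      rw [← Real.exp_nat_mul]; congr 1; push_cast; ring
    rw [mul_pow, mul_pow, e1, e2]
    have hp := Real.pi_lt_four
    have : 2 * (1 + u) ≤ 16 * (1 + |t|) := by
      rw [hu]; nlinarith [abs_nonneg t]
    calc _ ≤ (1 + |t|) ^ 2 * (2 * (1 + u) * Real.exp (-u)) := by gcongr
      _ ≤ (1 + |t|) ^ 2 * (16 * (1 + |t|) * Real.exp (-u)) := by gcongr
      _ = _ := by ring
  exact (pow_le_pow_iff_left₀ (norm_nonneg _) (by positivity) two_ne_zero).mp hsq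

end ZD
end

section
open Complex MeasureTheory Filter Topology

namespace ZD

lemma pf_le (t N x : ℝ) (hN : 0 < N) (hx : x ≠ 0) : ‖pf t N x‖ ≤ 6 * N ^ 3 * (x ^ 2)⁻¹ := by
  by_cases h : 0 < x
  · rw [pf_norm t N x h]
    have h1 : (x / N) ^ 3 / 6 ≤ Real.exp (x / N) := by
      have := Real.pow_div_factorial_le_exp (x / N) (by positivity) 3
      simpa [Nat.factorial] using this
    rw [Real.exp_neg]
    have h2 : 0 < (x / N) ^ 3 / 6 := by positivity
    have h3 := inv_anti₀ h2 h1
    calc x * (Real.exp (x / N))⁻¹ ≤ x * ((x / N) ^ 3 / 6)⁻¹ := by gcongr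
      _ = _ := by field_simp
  · rw [pf, if_neg h, norm_zero]; positivity

lemma four_norm (t N ξ : ℝ) (hN : 0 < N) :
    ‖(1 / N + 2 * Real.pi * ξ * I : ℂ) ^ (-(2 - t * I)) * Gamma (2 - t * I)‖ ≤
      ((1 / N) ^ 2 + (2 * Real.pi * ξ) ^ 2)⁻¹ * (4 * (1 + |t|) ^ (3 / 2 : ℝ)) *
        Real.exp (-(|t| * ((1 / N) / (1 / N + 2 * Real.pi * |ξ|)))) := by
  set r : ℂ := 1 / N + 2 * Real.pi * ξ * I with hr
  have hre : r.re = 1 / N := by rw [hr]; simp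
  have him : r.im = 2 * Real.pi * ξ := by rw [hr]; simp
  have ha : 0 < 1 / N := by positivity
  have hr0 : r ≠ 0 := by intro h; rw [h] at hre; simp at hre; exact hN.ne hre
  have hn : ‖r‖ ^ 2 = (1 / N) ^ 2 + (2 * Real.pi * ξ) ^ 2 := by
    rw [← Complex.normSq_eq_norm_sq, normSq_apply, hre, him]; ring
  have hnp : 0 < ‖r‖ := norm_pos_iff.mpr hr0
  rw [norm_mul, Complex.norm_cpow_of_ne_zero hr0]
  have e1 : (-(2 - t * I) : ℂ).re = -2 := by simp
  have e2 : (-(2 - t * I) : ℂ).im = t := by simp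
  rw [e1, e2]
  have e3 : ‖r‖ ^ (-2 : ℝ) = ((1 / N) ^ 2 + (2 * Real.pi * ξ) ^ 2)⁻¹ := by
    rw [Real.rpow_neg hnp.le, ← hn]; norm_cast
  rw [e3]
  have hcos : Real.cos r.arg = (1 / N) / ‖r‖ := by rw [Complex.cos_arg hr0, hre]
  have hnle : ‖r‖ ≤ 1 / N + 2 * Real.pi * |ξ| := by
    have := Complex.norm_le_abs_re_add_abs_im r
    rw [hre, him, abs_of_pos ha, abs_mul, abs_of_pos Real.two_pi_pos] at this
    exact this
  have harg : |r.arg| ≤ Real.pi / 2 - (1 / N) / (1 / N + 2 * Real.pi * |ξ|) := by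
    have h1 : |r.arg| ≤ Real.pi / 2 := Complex.abs_arg_le_pi_div_two_iff.mpr (by rw [hre]; exact ha.le)
    have h2 : Real.cos |r.arg| ≤ Real.pi / 2 - |r.arg| := by
      rw [← Real.sin_pi_div_two_sub]; exact Real.sin_le (by linarith)
    rw [Real.cos_abs, hcos] at h2
    have h3 : (1 / N) / (1 / N + 2 * Real.pi * |ξ|) ≤ (1 / N) / ‖r‖ := by gcongr
    linarith
  have hexp : (Real.exp (r.arg * t))⁻¹ * Real.exp (-(Real.pi * |t| / 2)) ≤ Real.exp (-(|t| * ((1 / N) / (1 / N + 2 * Real.pi * |ξ|)))) := by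
    rw [← Real.exp_neg, ← Real.exp_add]
    apply Real.exp_le_exp.mpr
    have : -(r.arg * t) ≤ |r.arg| * |t| := by rw [← abs_mul]; exact neg_le_abs _
    nlinarith [mul_le_mul_of_nonneg_right harg (abs_nonneg t)]
  have hG := norm_Gamma_two t
  calc _ ≤ ((1 / N) ^ 2 + (2 * Real.pi * ξ) ^ 2)⁻¹ / Real.exp (r.arg * t) * (4 * (1 + |t|) ^ (3 / 2 : ℝ) * Real.exp (-(Real.pi * |t| / 2))) := by gcongr
    _ = ((1 / N) ^ 2 + (2 * Real.pi * ξ) ^ 2)⁻¹ * (4 * (1 + |t|) ^ (3 / 2 : ℝ)) * ((Real.exp (r.arg * t))⁻¹ * Real.exp (-(Real.pi * |t| / 2))) := by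
      field_simp
    _ ≤ _ := by gcongr

lemma four_norm' (t N ξ : ℝ) (hN : 0 < N) (hξ : ξ ≠ 0) :
    ‖(1 / N + 2 * Real.pi * ξ * I : ℂ) ^ (-(2 - t * I)) * Gamma (2 - t * I)‖ ≤
      (ξ ^ 2)⁻¹ * (4 * (1 + |t|) ^ (3 / 2 : ℝ)) *
        Real.exp (-(|t| * ((1 / N) / (1 / N + 2 * Real.pi * |ξ|)))) := by
  refine (four_norm t N ξ hN).trans ?_
  have : ξ ^ 2 ≤ (1 / N) ^ 2 + (2 * Real.pi * ξ) ^ 2 := by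
    have := Real.pi_gt_three
    have h2 : 1 ≤ (2 * Real.pi) ^ 2 := by nlinarith
    rw [mul_pow]
    nlinarith [sq_nonneg ξ, sq_nonneg (1 / N)]
  have hp : 0 < ξ ^ 2 := by positivity
  gcongr

lemma isBigO_aux (f : ℝ → ℂ) (C : ℝ) (h : ∀ x, x ≠ 0 → ‖f x‖ ≤ C * (x ^ 2)⁻¹) :
    f =O[cocompact ℝ] (fun x => |x| ^ (-(2:ℝ))) := by
  refine Asymptotics.IsBigO.of_bound C ?_
  have : ∀ᶠ x : ℝ in cocompact ℝ, x ≠ 0 := by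
    have := (isCompact_singleton (x := (0:ℝ))).compl_mem_cocompact
    filter_upwards [this] with x hx using hx
  filter_upwards [this] with x hx
  have h1 := h x hx
  have h2 : ‖|x| ^ (-(2:ℝ))‖ = (x ^ 2)⁻¹ := by
    rw [Real.rpow_neg (abs_nonneg x), Real.norm_eq_abs, abs_of_nonneg (by positivity)]
    norm_cast
    rw [sq_abs]
  rw [h2]; exact h1

open scoped FourierTransform in
lemma poisson (t N : ℝ) (hN : 0 < N) :
    ∑' n : ℤ, pf t N n = ∑' n : ℤ, (1 / N + 2 * Real.pi * n * I : ℂ) ^ (-(2 - t * I)) * Gamma (2 - t * I) := by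
  have h := Real.tsum_eq_tsum_fourier_of_rpow_decay (pf_cont t N hN) (b := 2) (by norm_num)
    (isBigO_aux _ (6 * N ^ 3) fun x hx => pf_le t N x hN hx)
    (isBigO_aux _ (4 * (1 + |t|) ^ (3 / 2 : ℝ)) fun x hx => by
      rw [pf_fourier t N hN x]
      refine (four_norm' t N x hN hx).trans ?_
      rw [mul_comm (x ^ 2)⁻¹]
      apply mul_le_of_le_one_right (by positivity)
      apply Real.exp_le_one_iff.mpr
      have : 0 ≤ |t| * ((1 / N) / (1 / N + 2 * Real.pi * |x|)) := by positivity
      linarith) 0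
  simp only [zero_add] at h
  rw [h]
  congr 1
  ext n
  rw [pf_fourier t N hN n]
  simp

lemma pf_summable (t N : ℝ) (hN : 0 < N) : Summable (fun n : ℤ => pf t N n) := by
  refine Summable.of_norm_bounded (g := fun n : ℤ => 6 * N ^ 3 * (((n:ℝ)) ^ 2)⁻¹) ?_ fun n => ?_
  · apply Summable.mul_left
    have := (Real.summable_one_div_int_pow (p := 2)).mpr (by norm_num)
    simpa [one_div] using this
  · by_cases hn : n = 0
    · subst hn; simp [pf]
    · exact pf_le t N n hN (by exact_mod_cast hn)

lemma rpow_le_exp (x e : ℝ) (he : 0 < e) (he1 : e < 1) (hx : 0 < x) : Real.exp (-x) ≤ x ^ (-(1 - e)) := by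
  rw [Real.exp_neg, Real.rpow_neg hx.le]
  apply inv_anti₀ (by positivity)
  rcases le_total x 1 with h | h
  · exact (Real.rpow_le_one hx.le h (by linarith)).trans (Real.one_le_exp hx.le)
  · calc x ^ (1 - e) ≤ x ^ (1:ℝ) := Real.rpow_le_rpow_of_exponent_le h (by linarith)
      _ = x := Real.rpow_one x
      _ ≤ _ := by linarith [Real.add_one_le_exp x]

/-- `(1+|t|)^(3/2) e^{-π|t|/2}` versus `e^{-|t|}` -/
lemma pow_exp_le : ∃ C > 0, ∀ t : ℝ, 0 ≤ t → (1 + t) ^ (3 / 2 : ℝ) * Real.exp (-(t / 2)) ≤ C := by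
  refine ⟨64, by norm_num, fun t ht => ?_⟩
  have h1 : (1 + t) ^ (3 / 2 : ℝ) ≤ (1 + t) ^ 2 := by
    rw [← Real.rpow_natCast]
    exact Real.rpow_le_rpow_of_exponent_le (by linarith) (by norm_num)
  have h2 : (1 + t / 4) ≤ Real.exp (t / 4) := by linarith [Real.add_one_le_exp (t / 4)]
  have h3 : (1 + t / 4) ^ 2 ≤ Real.exp (t / 2) := by
    calc _ ≤ (Real.exp (t / 4)) ^ 2 := by gcongr
      _ = _ := by rw [← Real.exp_nat_mul]; congr 1; push_cast; ring
  have h4 : (1 + t) ^ 2 ≤ 64 * Real.exp (t / 2) := by nlinarith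
  calc _ ≤ 64 * Real.exp (t / 2) * Real.exp (-(t / 2)) := by gcongr; linarith
    _ = 64 := by rw [mul_assoc, ← Real.exp_add]; simp

end ZD
end

section
open Complex MeasureTheory Filter Topology

namespace ZD

lemma four_zero (t N : ℝ) (hN : 0 < N) :
    ‖(1 / N + 2 * Real.pi * ((0:ℤ):ℂ) * I : ℂ) ^ (-(2 - t * I)) * Gamma (2 - t * I)‖ ≤ 256 * N ^ 2 * Real.exp (-|t|) := by
  have h0 : (1 / N + 2 * Real.pi * ((0:ℤ):ℂ) * I : ℂ) = ((1 / N : ℝ) : ℂ) := by push_cast; ring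
  rw [h0, norm_mul, Complex.norm_cpow_eq_rpow_re_of_pos (by positivity)]
  have e1 : (-(2 - t * I) : ℂ).re = -2 := by simp
  rw [e1]
  have e3 : (1 / N) ^ (-2 : ℝ) = N ^ 2 := by
    rw [Real.rpow_neg (by positivity), one_div, Real.inv_rpow hN.le, inv_inv]; norm_cast
  rw [e3]
  have hG := norm_Gamma_two t
  have h1 : (1 + |t|) ^ (3 / 2 : ℝ) ≤ (1 + |t|) ^ 2 := by
    rw [← Real.rpow_natCast]
    exact Real.rpow_le_rpow_of_exponent_le (by linarith [abs_nonneg t]) (by norm_num)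
  have h2 : (1 + |t| / 4) ≤ Real.exp (|t| / 4) := by linarith [Real.add_one_le_exp (|t| / 4)]
  have h3 : (1 + |t| / 4) ^ 2 ≤ Real.exp (|t| / 2) := by
    calc _ ≤ (Real.exp (|t| / 4)) ^ 2 := by gcongr
      _ = _ := by rw [← Real.exp_nat_mul]; congr 1; push_cast; ring
  have h4 : (1 + |t|) ^ 2 ≤ 64 * Real.exp (|t| / 2) := by nlinarith [abs_nonneg t]
  have h5 : Real.exp (-(Real.pi * |t| / 2)) ≤ Real.exp (-(3 * |t| / 2)) := by
    apply Real.exp_le_exp.mpr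
    nlinarith [Real.pi_gt_three, abs_nonneg t]
  calc _ ≤ N ^ 2 * (4 * (64 * Real.exp (|t| / 2)) * Real.exp (-(3 * |t| / 2))) := by
        gcongr
        refine hG.trans ?_
        gcongr
        linarith
    _ = 256 * N ^ 2 * (Real.exp (|t| / 2) * Real.exp (-(3 * |t| / 2))) := by ring
    _ = _ := by rw [← Real.exp_add]; congr 2; ring

lemma four_pos (e t N : ℝ) (he : 0 < e) (he1 : e < 1) (hN : 1 ≤ N) (ht : 1 ≤ |t|) (m : ℤ) (hm : m ≠ 0) :
    ‖(1 / N + 2 * Real.pi * m * I : ℂ) ^ (-(2 - t * I)) * Gamma (2 - t * I)‖ ≤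
      96 * |t| ^ (1 / 2 + e) * N * |(m:ℝ)| ^ (-(1 + e)) := by
  have hN0 : 0 < N := by linarith
  have hm1 : 1 ≤ |(m:ℝ)| := by exact_mod_cast Int.one_le_abs hm
  have hm0 : (m:ℝ) ≠ 0 := by exact_mod_cast hm
  have h := four_norm' t N m hN0 hm0
  set a := |(m:ℝ)| with ha
  have ha0 : 0 < a := by linarith
  have hφ : 1 / (8 * a * N) ≤ (1 / N) / (1 / N + 2 * Real.pi * a) := by
    rw [div_div, mul_add, mul_one_div_cancel hN0.ne']
    apply one_div_le_one_div_of_le (by positivity)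
    have : 1 ≤ a * N := by nlinarith
    nlinarith [Real.pi_lt_d2, mul_pos ha0 hN0]
  have hexp : Real.exp (-(|t| * ((1 / N) / (1 / N + 2 * Real.pi * a)))) ≤ (|t| / (8 * a * N)) ^ (-(1 - e)) := by
    refine le_trans ?_ (rpow_le_exp _ e he he1 (by positivity))
    apply Real.exp_le_exp.mpr
    have := mul_le_mul_of_nonneg_left hφ (abs_nonneg t)
    rw [mul_one_div] at this
    linarith
  have h8 : (|t| / (8 * a * N)) ^ (-(1 - e)) ≤ 8 * N * a ^ (1 - e) * |t| ^ (-(1 - e)) := by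
    rw [Real.div_rpow (by positivity) (by positivity), Real.rpow_neg (by positivity : 0 ≤ 8 * a * N), div_inv_eq_mul, mul_comm]
    apply mul_le_mul_of_nonneg_right _ (by positivity)
    rw [Real.mul_rpow (by positivity) (by positivity), Real.mul_rpow (by positivity) (by positivity)]
    have e1 : (8:ℝ) ^ (1 - e) ≤ 8 := by
      calc (8:ℝ) ^ (1 - e) ≤ 8 ^ (1:ℝ) := Real.rpow_le_rpow_of_exponent_le (by norm_num) (by linarith)
        _ = 8 := Real.rpow_one _
    have e2 : N ^ (1 - e) ≤ N := by
      calc N ^ (1 - e) ≤ N ^ (1:ℝ) := Real.rpow_le_rpow_of_exponent_le hN (by linarith)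
        _ = N := Real.rpow_one _
    calc _ ≤ 8 * a ^ (1 - e) * N := by gcongr
      _ = _ := by ring
  have h3 : (1 + |t|) ^ (3 / 2 : ℝ) ≤ 3 * |t| ^ (3 / 2 : ℝ) := by
    calc (1 + |t|) ^ (3 / 2 : ℝ) ≤ (2 * |t|) ^ (3 / 2 : ℝ) := by gcongr; linarith
      _ = 2 ^ (3 / 2 : ℝ) * |t| ^ (3 / 2 : ℝ) := Real.mul_rpow (by norm_num) (by positivity)
      _ ≤ _ := by
        gcongr
        have : ((2:ℝ) ^ (3 / 2 : ℝ)) ^ 2 ≤ 3 ^ 2 := by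
          rw [← Real.rpow_natCast, ← Real.rpow_mul (by norm_num)]; norm_num
        exact (pow_le_pow_iff_left₀ (by positivity) (by norm_num) two_ne_zero).mp this
  have ht0 : 0 < |t| := by linarith
  have e5 : |t| ^ (3 / 2 : ℝ) * |t| ^ (-(1 - e)) = |t| ^ (1 / 2 + e) := by
    rw [← Real.rpow_add ht0]; congr 1; ring
  have e6 : ((m:ℝ) ^ 2)⁻¹ * a ^ (1 - e) = a ^ (-(1 + e)) := by
    rw [← sq_abs, ← ha, ← Real.rpow_natCast, ← Real.rpow_neg ha0.le, ← Real.rpow_add ha0]; congr 1; push_cast; ring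
  calc _ ≤ _ := h
    _ ≤ ((m:ℝ) ^ 2)⁻¹ * (4 * (3 * |t| ^ (3 / 2 : ℝ))) * (8 * N * a ^ (1 - e) * |t| ^ (-(1 - e))) := by
      gcongr; exact hexp.trans h8
    _ = 96 * (|t| ^ (3 / 2 : ℝ) * |t| ^ (-(1 - e))) * N * (((m:ℝ) ^ 2)⁻¹ * a ^ (1 - e)) := by ring
    _ = _ := by rw [e5, e6]

lemma summ_int (e : ℝ) (he : 0 < e) : Summable (fun m : ℤ => |(m:ℝ)| ^ (-(1 + e))) := by
  have := Real.summable_abs_int_rpow (b := 1 + e) (by linarith)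
  exact this

lemma tsum_split_bound (g : ℤ → ℂ) (h : ℤ → ℝ) (A B : ℝ) (hB : 0 ≤ B) (hA : 0 ≤ A) (hh : Summable h) (hh0 : ∀ m, 0 ≤ h m)
    (h0 : ‖g 0‖ ≤ A) (hg : ∀ m, m ≠ 0 → ‖g m‖ ≤ B * h m) : ‖∑' m, g m‖ ≤ A + B * ∑' m, h m := by
  have hs : HasSum (fun m : ℤ => (if m = 0 then A else 0) + B * h m) (A + B * ∑' m, h m) :=
    (hasSum_ite_eq 0 A).add (hh.hasSum.mul_left B)
  refine tsum_of_norm_bounded hs fun m => ?_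
  by_cases hm : m = 0
  · subst hm; simp only [if_true]
    have := mul_nonneg hB (hh0 0)
    linarith
  · rw [if_neg hm, zero_add]; exact hg m hm

lemma kernel_bound (e : ℝ) (he : 0 < e) (he1 : e < 1) : ∃ C > 0, ∀ t N : ℝ, 1 ≤ N → (t = 0 ∨ 1 ≤ |t|) →
    ‖∑' n : ℤ, pf t N n‖ ≤ C * (N ^ 2 * Real.exp (-|t|) + N * |t| ^ (1 / 2 + e)) := by
  set S := ∑' m : ℤ, |(m:ℝ)| ^ (-(1 + e)) with hS
  have hS0 : 0 ≤ S := tsum_nonneg fun m => by positivity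
  set S2 := ∑' m : ℤ, ((m:ℝ) ^ 2)⁻¹ with hS2
  have hS20 : 0 ≤ S2 := tsum_nonneg fun m => by positivity
  refine ⟨256 + 96 * S + 4 * S2, by positivity, fun t N hN ht => ?_⟩
  have hN0 : 0 < N := by linarith
  rw [poisson t N hN0]
  rcases ht with ht | ht
  · subst ht
    have h := tsum_split_bound (fun n : ℤ => (1 / N + 2 * Real.pi * n * I : ℂ) ^ (-(2 - ((0:ℝ):ℂ) * I)) * Gamma (2 - ((0:ℝ):ℂ) * I))
      (fun m : ℤ => ((m:ℝ) ^ 2)⁻¹) (256 * N ^ 2) 4 (by norm_num) (by positivity) ?_ (fun m => by positivity) ?_ ?_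
    · refine h.trans ?_
      rw [← hS2]
      simp only [abs_zero, neg_zero, Real.exp_zero]
      rw [Real.zero_rpow (by positivity)]
      nlinarith [mul_nonneg hS0 (sq_nonneg N), mul_nonneg hS20 (by nlinarith : 0 ≤ N ^ 2 - 1)]
    · have := (Real.summable_one_div_int_pow (p := 2)).mpr (by norm_num)
      simpa [one_div] using this
    · have := four_zero 0 N hN0
      simpa using this
    · intro m hm
      have hm0 : (m:ℝ) ≠ 0 := by exact_mod_cast hm
      have := four_norm' 0 N m hN0 hm0
      simp only [abs_zero, add_zero, Real.one_rpow, zero_mul, neg_zero, Real.exp_zero, mul_one] at this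
      rw [mul_comm 4]; exact_mod_cast this
  · have h := tsum_split_bound (fun n : ℤ => (1 / N + 2 * Real.pi * n * I : ℂ) ^ (-(2 - t * I)) * Gamma (2 - t * I))
      (fun m : ℤ => |(m:ℝ)| ^ (-(1 + e))) (256 * N ^ 2 * Real.exp (-|t|)) (96 * |t| ^ (1 / 2 + e) * N) (by positivity) (by positivity) (summ_int e he)
      (fun m => by positivity) (four_zero t N hN0) (fun m hm => four_pos e t N he he1 hN ht m hm)
    refine h.trans ?_
    rw [← hS]
    have a1 : 0 ≤ N ^ 2 * Real.exp (-|t|) := by positivity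
    have a2 : 0 ≤ N * |t| ^ (1 / 2 + e) := by positivity
    nlinarith [mul_nonneg hS0 a1, mul_nonneg hS20 a1, mul_nonneg hS20 a2]

end ZD
end

section
open Complex MeasureTheory Filter Topology

namespace ZD

lemma pf_expand {ι : Type} [Fintype ι] (t : ι → ℝ) (c : ι → ℂ) (N : ℝ) (n : ℕ) (hn : 1 ≤ n) :
    ∑ i, ∑ j, c i * (starRingEnd ℂ) (c j) * pf (t i - t j) N ((n:ℤ):ℝ) =
      ((n * Real.exp (-(n / N)) * ‖∑ i, c i * (n:ℂ) ^ (-(t i * I))‖ ^ 2 : ℝ) : ℂ) := by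
  push_cast
  rw [← ofReal_pow, ← Complex.normSq_eq_norm_sq, ← Complex.mul_conj, map_sum, Finset.sum_mul_sum, Finset.mul_sum]
  refine Finset.sum_congr rfl fun i _ => ?_
  rw [Finset.mul_sum]
  refine Finset.sum_congr rfl fun j _ => ?_
  have hn0 : (n:ℂ) ≠ 0 := by exact_mod_cast (by omega : n ≠ 0)
  have hn1 : (0:ℝ) < n := by exact_mod_cast hn
  rw [pf, if_pos (by exact_mod_cast hn), map_mul]
  have h1 : (starRingEnd ℂ) ((n:ℂ) ^ (-(t j * I))) = (n:ℂ) ^ (t j * I) := by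
    rw [cpow_def_of_ne_zero hn0, cpow_def_of_ne_zero hn0, ← Complex.exp_conj, ← Complex.natCast_log, map_mul, conj_ofReal]
    simp
  rw [h1]
  have h2 : ((n:ℝ):ℂ) ^ (1 - ((t i - t j : ℝ):ℂ) * I) = (n:ℂ) * (n:ℂ) ^ (-(t i * I)) * (n:ℂ) ^ (t j * I) := by
    push_cast
    rw [show (1 - ((t i:ℂ) - t j) * I) = 1 + (-(t i * I)) + t j * I by ring, cpow_add _ _ hn0, cpow_add _ _ hn0, cpow_one]
  rw [h2]
  push_cast
  ring

lemma dual {ι : Type} [Fintype ι] (t : ι → ℝ) (c : ι → ℂ) (N : ℝ) (hN : 0 < N) (M : ℕ) :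
    ∑ n ∈ Finset.Icc 1 M, (n * Real.exp (-(n / N)) * ‖∑ i, c i * (n:ℂ) ^ (-(t i * I))‖ ^ 2 : ℝ) ≤
      ∑ i, ∑ j, ‖c i‖ * ‖c j‖ * ‖∑' n : ℤ, pf (t i - t j) N n‖ := by
  have hs : HasSum (fun n : ℤ => ∑ i, ∑ j, c i * (starRingEnd ℂ) (c j) * pf (t i - t j) N n)
      (∑ i, ∑ j, c i * (starRingEnd ℂ) (c j) * ∑' n : ℤ, pf (t i - t j) N n) :=
    hasSum_sum fun i _ => hasSum_sum fun j _ => ((pf_summable _ N hN).hasSum).mul_left _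
  set g : ℤ → ℂ := fun n : ℤ => ∑ i, ∑ j, c i * (starRingEnd ℂ) (c j) * pf (t i - t j) N n with hg
  set S := ∑ i, ∑ j, c i * (starRingEnd ℂ) (c j) * ∑' n : ℤ, pf (t i - t j) N n with hS
  have hre : HasSum (fun n => (g n).re) S.re := Complex.hasSum_re hs
  have hnat : ∀ n : ℕ, 1 ≤ n → (g n).re = n * Real.exp (-(n / N)) * ‖∑ i, c i * (n:ℂ) ^ (-(t i * I))‖ ^ 2 := by
    intro n hn
    rw [hg]
    simp only
    rw [pf_expand t c N n hn, ofReal_re]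
  have hnn : ∀ n : ℤ, 0 ≤ (g n).re := by
    intro n
    by_cases h : 1 ≤ n
    · obtain ⟨k, rfl⟩ := Int.eq_ofNat_of_zero_le (by omega : 0 ≤ n)
      rw [hnat k (by exact_mod_cast h)]; positivity
    · have : g n = 0 := by
        rw [hg]
        simp only
        refine Finset.sum_eq_zero fun i _ => Finset.sum_eq_zero fun j _ => ?_
        rw [pf, if_neg, mul_zero]
        push Not at h ⊢
        exact_mod_cast (by omega : n ≤ 0)
      rw [this]; simp
  have h1 : ∑ n ∈ (Finset.Icc 1 M).map Nat.castEmbedding, (g n).re ≤ S.re :=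
    sum_le_hasSum _ (fun n _ => hnn n) hre
  rw [Finset.sum_map] at h1
  calc _ = ∑ n ∈ Finset.Icc 1 M, (g ((Nat.castEmbedding (R := ℤ)) n)).re :=
        Finset.sum_congr rfl fun n hn => (hnat n (Finset.mem_Icc.mp hn).1).symm
    _ ≤ S.re := h1
    _ ≤ ‖S‖ := Complex.re_le_norm S
    _ ≤ _ := by
      refine (norm_sum_le _ _).trans (Finset.sum_le_sum fun i _ => (norm_sum_le _ _).trans (Finset.sum_le_sum fun j _ => ?_))
      rw [norm_mul, norm_mul, RCLike.norm_conj]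

/-- Schur test -/
lemma schur {ι : Type} [Fintype ι] (c : ι → ℝ) (hc : ∀ i, 0 ≤ c i) (K : ι → ι → ℝ) (hK : ∀ i j, 0 ≤ K i j) (B : ℝ)
    (h1 : ∀ i, ∑ j, K i j ≤ B) (h2 : ∀ j, ∑ i, K i j ≤ B) : ∑ i, ∑ j, c i * c j * K i j ≤ B * ∑ i, c i ^ 2 := by
  have : ∀ i j, c i * c j * K i j ≤ c i ^ 2 / 2 * K i j + c j ^ 2 / 2 * K i j := by
    intro i j
    have := mul_le_mul_of_nonneg_right (two_mul_le_add_sq (c i) (c j)) (hK i j)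
    linarith
  calc _ ≤ ∑ i, ∑ j, (c i ^ 2 / 2 * K i j + c j ^ 2 / 2 * K i j) := Finset.sum_le_sum fun i _ => Finset.sum_le_sum fun j _ => this i j
    _ = ∑ i, c i ^ 2 / 2 * ∑ j, K i j + ∑ j, c j ^ 2 / 2 * ∑ i, K i j := by
      simp only [Finset.sum_add_distrib, Finset.mul_sum]
      congr 1
      rw [Finset.sum_comm]
    _ ≤ ∑ i, c i ^ 2 / 2 * B + ∑ j, c j ^ 2 / 2 * B := by
      gcongr with i _ j _
      · exact h1 i
      · exact h2 j
    _ = _ := by rw [← Finset.sum_add_distrib, Finset.mul_sum]; exact Finset.sum_congr rfl fun i _ => by ring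

lemma halasz (e : ℝ) (he : 0 < e) (he1 : e < 1) : ∃ C > 0, ∀ (ι : Type) [Fintype ι] (t : ι → ℝ), Sep t → ∀ T : ℝ, 1 ≤ T →
    (∀ i, |t i| ≤ T) → ∀ N : ℕ, 1 ≤ N → ∀ (f : ℕ → ℂ) (a : ℝ), 0 < a → (∀ n ∈ Finset.Icc 1 N, f n ≠ 0 → a ≤ n) →
    ∑ i, ‖DP N f (t i * I)‖ ^ 2 ≤ C * (N / a) * (N + Fintype.card ι * T ^ (1 / 2 + e)) * ∑ n ∈ Finset.Icc 1 N, ‖f n‖ ^ 2 := by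
  obtain ⟨C, hC, hk⟩ := kernel_bound e he he1
  refine ⟨3 * C * 6, by positivity, fun ι _ t ht T hT htT N hN f a ha hf => ?_⟩
  have hN1 : (1:ℝ) ≤ N := by exact_mod_cast hN
  have hN0 : (0:ℝ) < N := by linarith
  set R : ℝ := ((Fintype.card ι : ℕ) : ℝ) with hR
  set K : ι → ι → ℝ := fun i j => ‖∑' n : ℤ, pf (t i - t j) N n‖ with hKdef
  set B : ℝ := C * (N ^ 2 * 6 + N * (R * (4 * T ^ (1 / 2 + e)))) with hB
  have hKb : ∀ i j, K i j ≤ C * (N ^ 2 * Real.exp (-|t i - t j|) + N * (4 * T ^ (1 / 2 + e))) := by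
    intro i j
    have h1 : t i - t j = 0 ∨ 1 ≤ |t i - t j| := by
      by_cases h : i = j
      · left; rw [h]; ring
      · right; exact ht i j h
    refine (hk (t i - t j) N hN1 h1).trans ?_
    have h2 : |t i - t j| ≤ 2 * T := by
      have := abs_sub (t i) (t j)
      linarith [htT i, htT j]
    have h3 : |t i - t j| ^ (1 / 2 + e) ≤ 4 * T ^ (1 / 2 + e) := by
      calc |t i - t j| ^ (1 / 2 + e) ≤ (2 * T) ^ (1 / 2 + e) := by gcongr
        _ = 2 ^ (1 / 2 + e) * T ^ (1 / 2 + e) := Real.mul_rpow (by norm_num) (by linarith)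
        _ ≤ 2 ^ (2:ℝ) * T ^ (1 / 2 + e) := by
          gcongr
          · norm_num
          · linarith
        _ = _ := by norm_num
    gcongr
  have hrow : ∀ j, ∑ i, K i j ≤ B := by
    intro j
    calc _ ≤ ∑ i, C * (N ^ 2 * Real.exp (-|t i - t j|) + N * (4 * T ^ (1 / 2 + e))) := Finset.sum_le_sum fun i _ => hKb i j
      _ = C * (N ^ 2 * ∑ i, Real.exp (-|t i - t j|) + N * (R * (4 * T ^ (1 / 2 + e)))) := by
        rw [← Finset.mul_sum, Finset.sum_add_distrib, ← Finset.mul_sum, Finset.sum_const, Finset.card_univ, nsmul_eq_mul]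
        ring
      _ ≤ _ := by
        rw [hB]
        gcongr
        exact sep_exp ht (t j)
  have hcol : ∀ i, ∑ j, K i j ≤ B := by
    intro i
    calc _ ≤ ∑ j, C * (N ^ 2 * Real.exp (-|t j - t i|) + N * (4 * T ^ (1 / 2 + e))) := Finset.sum_le_sum fun j _ => by
          rw [abs_sub_comm]; exact hKb i j
      _ = C * (N ^ 2 * ∑ j, Real.exp (-|t j - t i|) + N * (R * (4 * T ^ (1 / 2 + e)))) := by
        rw [← Finset.mul_sum, Finset.sum_add_distrib, ← Finset.mul_sum, Finset.sum_const, Finset.card_univ, nsmul_eq_mul]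
        ring
      _ ≤ _ := by
        rw [hB]
        gcongr
        exact sep_exp ht (t i)
  set P : ι → ℂ := fun i => DP N f (t i * I) with hP
  set c : ι → ℂ := fun i => (starRingEnd ℂ) (P i) with hc
  set S := ∑ i, ‖P i‖ ^ 2 with hS
  have hS0 : 0 ≤ S := Finset.sum_nonneg fun i _ => by positivity
  have hd := dual t c N hN0 N
  have hd2 : ∑ i, ∑ j, ‖c i‖ * ‖c j‖ * ‖∑' n : ℤ, pf (t i - t j) N n‖ ≤ B * S := by
    have := schur (fun i => ‖c i‖) (fun i => norm_nonneg _) K (fun i j => norm_nonneg _) B hcol hrow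
    refine this.trans (le_of_eq ?_)
    rw [hS]; congr 1
    exact Finset.sum_congr rfl fun i _ => by rw [hc, RCLike.norm_conj]
  set A := ∑ n ∈ Finset.Icc 1 N, ‖f n‖ ^ 2 with hA
  set g : ℕ → ℂ := fun n => ∑ i, c i * (n:ℂ) ^ (-(t i * I)) with hg
  have hSeq : (S:ℂ) = ∑ n ∈ Finset.Icc 1 N, f n * g n := by
    rw [hS]; push_cast
    calc _ = ∑ i, c i * P i := Finset.sum_congr rfl fun i _ => by
            rw [← ofReal_pow, ← Complex.normSq_eq_norm_sq, ← Complex.mul_conj, hc, mul_comm]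
      _ = ∑ i, ∑ n ∈ Finset.Icc 1 N, c i * (f n * (n:ℂ) ^ (-(t i * I))) := Finset.sum_congr rfl fun i _ => by
            rw [hP]; simp only [DP]; rw [Finset.mul_sum]
      _ = _ := by
        rw [Finset.sum_comm]
        refine Finset.sum_congr rfl fun n _ => ?_
        rw [hg]; simp only; rw [Finset.mul_sum]
        exact Finset.sum_congr rfl fun i _ => by ring
  have hSle : S ≤ ∑ n ∈ Finset.Icc 1 N, ‖f n‖ * (if f n = 0 then 0 else ‖g n‖) := by
    have : S = ‖(S:ℂ)‖ := by rw [Complex.norm_real, Real.norm_eq_abs, abs_of_nonneg hS0]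
    rw [this, hSeq]
    refine (norm_sum_le _ _).trans (Finset.sum_le_sum fun n _ => ?_)
    split_ifs with h
    · rw [h]; simp
    · rw [norm_mul]
  have hCS : S ^ 2 ≤ A * ∑ n ∈ Finset.Icc 1 N, (if f n = 0 then 0 else ‖g n‖) ^ 2 := by
    refine (pow_le_pow_left₀ hS0 hSle 2).trans ?_
    exact Finset.sum_mul_sq_le_sq_mul_sq _ _ _
  have hgb : ∑ n ∈ Finset.Icc 1 N, (if f n = 0 then 0 else ‖g n‖) ^ 2 ≤ 3 / a * (B * S) := by
    refine le_trans ?_ (mul_le_mul_of_nonneg_left (hd.trans hd2) (by positivity))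
    rw [Finset.mul_sum]
    refine Finset.sum_le_sum fun n hn => ?_
    split_ifs with h
    · simp; positivity
    · have hn1 := hf n hn h
      have hnN : (n:ℝ) / N ≤ 1 := by rw [div_le_one hN0]; exact_mod_cast (Finset.mem_Icc.mp hn).2
      have he3 : 1 / 3 ≤ Real.exp (-(n / N)) := by
        rw [Real.exp_neg, one_div]
        apply inv_anti₀ (Real.exp_pos _)
        calc Real.exp (n / N) ≤ Real.exp 1 := Real.exp_le_exp.mpr hnN
          _ ≤ 3 := by linarith [Real.exp_one_lt_d9]
      have : 1 ≤ 3 / a * (n * Real.exp (-(n / N))) := by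
        calc (1:ℝ) = 3 / a * (a * (1 / 3)) := by field_simp
          _ ≤ _ := by gcongr
      calc ‖g n‖ ^ 2 = 1 * ‖g n‖ ^ 2 := (one_mul _).symm
        _ ≤ 3 / a * (n * Real.exp (-(n / N))) * ‖g n‖ ^ 2 := by gcongr
        _ = _ := by ring
  have hA0 : 0 ≤ A := Finset.sum_nonneg fun i _ => by positivity
  have hfin : S ≤ A * (3 / a * B) := by
    by_cases h : S = 0
    · rw [h]; positivity
    · have hSp : 0 < S := lt_of_le_of_ne hS0 (Ne.symm h)
      have h3 : S * S ≤ A * (3 / a * B) * S := by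
        calc S * S = S ^ 2 := by ring
          _ ≤ _ := hCS
          _ ≤ A * (3 / a * (B * S)) := by gcongr
          _ = _ := by ring
      exact le_of_mul_le_mul_right h3 hSp
  refine hfin.trans ?_
  rw [hB]
  have : A * (3 / a * (C * (N ^ 2 * 6 + N * (R * (4 * T ^ (1 / 2 + e)))))) = 3 * C * (N / a) * (6 * N + 4 * (R * T ^ (1 / 2 + e))) * A := by
    field_simp
  rw [this]
  have h4 : 6 * N + 4 * (R * T ^ (1 / 2 + e)) ≤ 6 * (N + R * T ^ (1 / 2 + e)) := by
    have : 0 ≤ R * T ^ (1 / 2 + e) := by positivity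
    linarith
  calc _ ≤ 3 * C * (N / a) * (6 * (N + R * T ^ (1 / 2 + e))) * A := by gcongr
    _ = _ := by ring

end ZD
end

section
open Complex MeasureTheory Filter Topology

namespace ZD

/-- at most exponential growth in the imaginary part on `S` -/
def EG (S : Set ℂ) (F : ℂ → ℂ) : Prop := ∃ B : ℝ, ∀ z ∈ S, ‖F z‖ ≤ B * Real.exp (B * |z.im|)

lemma EG.nonneg {S : Set ℂ} {F : ℂ → ℂ} (h : EG S F) : ∃ B : ℝ, 0 ≤ B ∧ ∀ z ∈ S, ‖F z‖ ≤ B * Real.exp (B * |z.im|) := by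
  obtain ⟨B, hB⟩ := h
  refine ⟨|B|, abs_nonneg _, fun z hz => (hB z hz).trans ?_⟩
  have := le_abs_self B
  gcongr

lemma EG.mul {S : Set ℂ} {F G : ℂ → ℂ} (hF : EG S F) (hG : EG S G) : EG S (fun z => F z * G z) := by
  obtain ⟨B, hB0, hB⟩ := hF.nonneg
  obtain ⟨C, hC0, hC⟩ := hG.nonneg
  refine ⟨B * C + B + C, fun z hz => ?_⟩
  rw [norm_mul]
  calc _ ≤ (B * Real.exp (B * |z.im|)) * (C * Real.exp (C * |z.im|)) :=
        mul_le_mul (hB z hz) (hC z hz) (norm_nonneg _) (by positivity)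
    _ = B * C * Real.exp ((B + C) * |z.im|) := by rw [add_mul, Real.exp_add]; ring
    _ ≤ _ := by
      have h1 : B * C ≤ B * C + B + C := by linarith
      have h2 : B + C ≤ B * C + B + C := by nlinarith
      gcongr

lemma EG.add {S : Set ℂ} {F G : ℂ → ℂ} (hF : EG S F) (hG : EG S G) : EG S (fun z => F z + G z) := by
  obtain ⟨B, hB0, hB⟩ := hF.nonneg
  obtain ⟨C, hC0, hC⟩ := hG.nonneg
  refine ⟨B + C, fun z hz => (norm_add_le _ _).trans ?_⟩
  calc _ ≤ (B * Real.exp (B * |z.im|)) + (C * Real.exp (C * |z.im|)) := add_le_add (hB z hz) (hC z hz)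
    _ ≤ B * Real.exp ((B + C) * |z.im|) + C * Real.exp ((B + C) * |z.im|) := by
      have h1 : B ≤ B + C := by linarith
      have h2 : C ≤ B + C := by linarith
      gcongr
    _ = _ := by ring

lemma EG.of_bdd {S : Set ℂ} {F : ℂ → ℂ} (B : ℝ) (h : ∀ z ∈ S, ‖F z‖ ≤ B) : EG S F := by
  refine ⟨|B|, fun z hz => (h z hz).trans ?_⟩
  have : 1 ≤ Real.exp (|B| * |z.im|) := Real.one_le_exp (by positivity)
  nlinarith [le_abs_self B, abs_nonneg B]

lemma EG.mono {S S' : Set ℂ} {F : ℂ → ℂ} (h : EG S F) (hS : S' ⊆ S) : EG S' F :=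
  let ⟨B, hB⟩ := h; ⟨B, fun z hz => hB z (hS hz)⟩

lemma EG.of_le {S : Set ℂ} {F G : ℂ → ℂ} (h : EG S F) (hS : ∀ z ∈ S, ‖G z‖ ≤ ‖F z‖) : EG S G :=
  let ⟨B, hB⟩ := h; ⟨B, fun z hz => (hS z hz).trans (hB z hz)⟩

lemma EG.union {S S' : Set ℂ} {F : ℂ → ℂ} (h : EG S F) (h' : EG S' F) : EG (S ∪ S') F := by
  obtain ⟨B, hB0, hB⟩ := h.nonneg
  obtain ⟨C, hC0, hC⟩ := h'.nonneg
  refine ⟨B + C, fun z hz => ?_⟩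
  have h1 : B ≤ B + C := by linarith
  have h2 : C ≤ B + C := by linarith
  rcases hz with hz | hz
  · refine (hB z hz).trans (by gcongr)
  · refine (hC z hz).trans (by gcongr)

def strip (b c : ℝ) : Set ℂ := {z | b ≤ z.re ∧ z.re ≤ c}
def stripHi (b c : ℝ) : Set ℂ := {z | b ≤ z.re ∧ z.re ≤ c ∧ 1 / 2 ≤ |z.im|}

lemma EG.of_hi {b c : ℝ} {F : ℂ → ℂ} (h : EG (stripHi b c) F) (hc : Continuous F) : EG (strip b c) F := by
  have h2 : EG (Set.Icc b c ×ℂ Set.Icc (-1) 1) F := by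
    have hK : IsCompact (Set.Icc b c ×ℂ Set.Icc (-1) 1) := isCompact_Icc.reProdIm isCompact_Icc
    obtain ⟨B, hB⟩ := hK.exists_bound_of_continuousOn hc.continuousOn
    exact EG.of_bdd B hB
  refine (h.union h2).mono fun z hz => ?_
  by_cases h3 : 1 / 2 ≤ |z.im|
  · left; exact ⟨hz.1, hz.2, h3⟩
  · right
    push Not at h3
    rw [abs_lt] at h3
    exact ⟨hz, ⟨by linarith [h3.1], by linarith [h3.2]⟩⟩

lemma mellin_bdd (f : ℝ → ℂ) (hf : ∀ s, MellinConvergent f s) (b c : ℝ) :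
    ∃ B, ∀ s : ℂ, b ≤ s.re → s.re ≤ c → ‖mellin f s‖ ≤ B := by
  have hb := (hf (b:ℂ)).norm
  have hc := (hf (c:ℂ)).norm
  refine ⟨∫ t : ℝ in Set.Ioi 0, (‖(t : ℂ) ^ ((b:ℂ) - 1) • f t‖ + ‖(t : ℂ) ^ ((c:ℂ) - 1) • f t‖), fun s h1 h2 => ?_⟩
  refine norm_integral_le_of_norm_le (hb.add hc) ?_
  refine (ae_restrict_iff' measurableSet_Ioi).mpr (ae_of_all _ fun t ht => ?_)
  have ht0 : (0:ℝ) < t := ht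
  rw [norm_smul, norm_smul, norm_smul, ← add_mul, norm_cpow_eq_rpow_re_of_pos ht0, norm_cpow_eq_rpow_re_of_pos ht0, norm_cpow_eq_rpow_re_of_pos ht0]
  apply mul_le_mul_of_nonneg_right _ (norm_nonneg _)
  simp only [sub_re, ofReal_re, one_re]
  have p1 := Real.rpow_nonneg ht0.le (b - 1)
  have p2 := Real.rpow_nonneg ht0.le (c - 1)
  rcases le_total t 1 with h | h
  · have := Real.rpow_le_rpow_of_exponent_ge ht0 h (by linarith : b - 1 ≤ s.re - 1)
    linarith
  · have := Real.rpow_le_rpow_of_exponent_le h (by linarith : s.re - 1 ≤ c - 1)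
    linarith

lemma even0_bdd (a : UnitAddCircle) (b c : ℝ) :
    ∃ B, ∀ s : ℂ, b ≤ s.re → s.re ≤ c → ‖HurwitzZeta.completedHurwitzZetaEven₀ a s‖ ≤ B := by
  obtain ⟨B, hB⟩ := mellin_bdd (HurwitzZeta.hurwitzEvenFEPair a).f_modif
    (fun s => ((HurwitzZeta.hurwitzEvenFEPair a).isStrongFEPair_toStrongFEPair.hasMellin s).1) (b / 2) (c / 2)
  refine ⟨B / 2, fun s h1 h2 => ?_⟩
  rw [HurwitzZeta.completedHurwitzZetaEven₀, norm_div]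
  have e : (s / 2).re = s.re / 2 := by simp
  have := hB (s / 2) (by rw [e]; linarith) (by rw [e]; linarith)
  rw [WeakFEPair.Λ₀]
  simp only [Complex.norm_ofNat]
  linarith

lemma odd_bdd (a : UnitAddCircle) (b c : ℝ) :
    ∃ B, ∀ s : ℂ, b ≤ s.re → s.re ≤ c → ‖HurwitzZeta.completedHurwitzZetaOdd a s‖ ≤ B := by
  obtain ⟨B, hB⟩ := mellin_bdd (HurwitzZeta.hurwitzOddFEPair a).f
    (fun s => ((HurwitzZeta.isStrong_hurwitzOddFEPair a).hasMellin s).1) ((b + 1) / 2) ((c + 1) / 2)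
  refine ⟨B / 2, fun s h1 h2 => ?_⟩
  rw [HurwitzZeta.completedHurwitzZetaOdd, norm_div]
  have e : ((s + 1) / 2).re = (s.re + 1) / 2 := by simp
  have := hB ((s + 1) / 2) (by rw [e]; linarith) (by rw [e]; linarith)
  rw [(HurwitzZeta.isStrong_hurwitzOddFEPair a).Λ_eq]
  simp only [Complex.norm_ofNat]
  linarith

lemma EG.sum {S : Set ℂ} {ι : Type*} (s : Finset ι) (F : ι → ℂ → ℂ) (h : ∀ i ∈ s, EG S (F i)) : EG S (fun z => ∑ i ∈ s, F i z) := by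
  classical
  induction s using Finset.induction_on with
  | empty => exact EG.of_bdd 0 (by simp)
  | insert a s ha ih =>
    have := (h a (by simp)).add (ih fun i hi => h i (by simp [hi]))
    simpa [Finset.sum_insert ha] using this

lemma EG.const (S : Set ℂ) (c : ℂ) : EG S (fun _ => c) := EG.of_bdd ‖c‖ fun _ _ => le_rfl

lemma EG_npow (N : ℕ) [NeZero N] (b c : ℝ) (r : ℂ → ℂ) (hr : ∀ z ∈ strip b c, |(r z).re| ≤ |b| + |c| + 1) :
    EG (strip b c) (fun z => (N:ℂ) ^ (r z)) := by
  refine EG.of_bdd ((N:ℝ) ^ (|b| + |c| + 1)) fun z hz => ?_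
  rw [norm_natCast_cpow' N (Nat.one_le_iff_ne_zero.mpr (NeZero.ne N))]
  apply Real.rpow_le_rpow_of_exponent_le
  · exact_mod_cast Nat.one_le_iff_ne_zero.mpr (NeZero.ne N)
  · exact (le_abs_self _).trans (hr z hz)

lemma abs_le_strip {b c x : ℝ} (h1 : b ≤ x) (h2 : x ≤ c) : |x| ≤ |b| + |c| := by
  rw [abs_le]
  constructor
  · linarith [neg_abs_le b, abs_nonneg c]
  · linarith [le_abs_self c, abs_nonneg b]

lemma completed_EG {N : ℕ} [NeZero N] (χ : DirichletCharacter ℂ N) (b c : ℝ) :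
    EG (stripHi b c) χ.completedLFunction := by
  have hN : EG (strip b c) (fun z => (N:ℂ) ^ (-z)) := EG_npow N b c _ fun z hz => by
    rw [neg_re, abs_neg]; linarith [abs_le_strip hz.1 hz.2]
  have h0 : EG (strip b c) (ZMod.completedLFunction₀ χ) := by
    unfold ZMod.completedLFunction₀
    refine EG.add (hN.mul (EG.sum _ _ fun j _ => (EG.const _ _).mul ?_)) (hN.mul (EG.sum _ _ fun j _ => (EG.const _ _).mul ?_))
    · obtain ⟨B, hB⟩ := even0_bdd (ZMod.toAddCircle j) b c
      exact EG.of_bdd B fun z hz => hB z hz.1 hz.2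
    · obtain ⟨B, hB⟩ := odd_bdd (ZMod.toAddCircle j) b c
      exact EG.of_bdd B fun z hz => hB z hz.1 hz.2
  have hsub : stripHi b c ⊆ strip b c := fun z hz => ⟨hz.1, hz.2.1⟩
  have hinv : EG (stripHi b c) (fun z => z⁻¹) := EG.of_bdd 2 fun z hz => by
    rw [norm_inv]
    have h1 : 1 / 2 ≤ ‖z‖ := hz.2.2.trans (abs_im_le_norm z)
    have := inv_anti₀ (by norm_num) h1
    simpa using this
  have hinv2 : EG (stripHi b c) (fun z => (1 - z)⁻¹) := EG.of_bdd 2 fun z hz => by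
    rw [norm_inv]
    have h1 : 1 / 2 ≤ ‖1 - z‖ := by
      refine le_trans ?_ (abs_im_le_norm _)
      simpa using hz.2.2
    have := inv_anti₀ (by norm_num) h1
    simpa using this
  have h := ((h0.mono hsub).add (((EG.const _ (-χ 0)).mul (hN.mono hsub)).mul hinv)).add
    (((EG.const _ (-∑ j, χ j)).mul (hN.mono hsub)).mul hinv2)
  refine h.of_le fun z _ => le_of_eq ?_
  rw [DirichletCharacter.completedLFunction, ZMod.completedLFunction_eq]
  congr 1
  ring

lemma EG_Gamma (b c : ℝ) (hb : 0 < b) : EG (strip b c) Gamma := by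
  have hc : ContinuousOn Real.Gamma (Set.Icc b c) := fun x hx =>
    (Real.differentiableAt_Gamma fun m h => by
      have : (0:ℝ) ≤ m := Nat.cast_nonneg m
      linarith [hx.1]).continuousAt.continuousWithinAt
  obtain ⟨B, hB⟩ := isCompact_Icc.exists_bound_of_continuousOn hc
  refine EG.of_bdd B fun z hz => ?_
  have h1 : ‖Gamma z‖ ≤ Real.Gamma z.re := by
    have hz0 : 0 < z.re := lt_of_lt_of_le hb hz.1
    rw [Complex.Gamma_eq_integral hz0, Real.Gamma_eq_integral hz0, Complex.GammaIntegral]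
    refine (norm_integral_le_integral_norm _).trans (le_of_eq ?_)
    refine setIntegral_congr_fun measurableSet_Ioi fun x hx => ?_
    rw [norm_mul, norm_cpow_eq_rpow_re_of_pos hx, Complex.norm_real, Real.norm_eq_abs, Real.abs_exp]
    simp
  exact h1.trans ((le_abs_self _).trans (hB z.re hz))

lemma EG_sin (S : Set ℂ) : EG S (fun z => sin (Real.pi * z)) := by
  refine ⟨Real.pi, fun z _ => ?_⟩
  simp only [show sin (Real.pi * z) = (cexp (-(Real.pi * z) * I) - cexp ((Real.pi * z) * I)) * I / 2 from rfl]
  have h1 : ‖cexp (-(Real.pi * z) * I)‖ ≤ Real.exp (Real.pi * |z.im|) := by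
    rw [Complex.norm_exp]
    apply Real.exp_le_exp.mpr
    simp
    nlinarith [Real.pi_pos, le_abs_self z.im]
  have h2 : ‖cexp ((Real.pi * z) * I)‖ ≤ Real.exp (Real.pi * |z.im|) := by
    rw [Complex.norm_exp]
    apply Real.exp_le_exp.mpr
    simp
    nlinarith [Real.pi_pos, neg_le_abs z.im]
  rw [norm_div, norm_mul, Complex.norm_I, mul_one, Complex.norm_ofNat]
  have := norm_sub_le (cexp (-(Real.pi * z) * I)) (cexp ((Real.pi * z) * I))
  have h3 := Real.pi_gt_three
  have := Real.exp_pos (Real.pi * |z.im|)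
  nlinarith

lemma EG.comp_sub {b c : ℝ} {F : ℂ → ℂ} (h : EG (strip b c) F) : EG (strip (1 - c) (1 - b)) (fun z => F (1 - z)) := by
  obtain ⟨B, hB⟩ := h
  refine ⟨B, fun z hz => ?_⟩
  have := hB (1 - z) ⟨by simp; linarith [hz.2], by simp; linarith [hz.1]⟩
  simpa using this

lemma EG_invGamma_half (b : ℝ) : EG (strip b (1 / 2)) (fun z => (Gamma z)⁻¹) := by
  have h1 := (EG_Gamma (1 / 2) (1 - b) (by norm_num)).comp_sub
  have h2 := (h1.mul (EG_sin _)).mul (EG.const _ ((Real.pi:ℂ)⁻¹))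
  have : strip b (1 / 2) ⊆ strip (1 - (1 - b)) (1 - 1 / 2) := by
    intro z hz; exact ⟨by linarith [hz.1], by linarith [hz.2]⟩
  refine (h2.mono this).of_le fun z hz => ?_
  by_cases hG : Gamma z = 0
  · rw [hG, inv_zero, norm_zero]; positivity
  · apply le_of_eq
    congr 1
    have h := Gamma_mul_Gamma_one_sub z
    have hne : Gamma (1 - z) ≠ 0 := Gamma_ne_zero_of_re_pos (by simp; linarith [hz.2])
    have hs : sin (Real.pi * z) ≠ 0 := by
      intro h0
      rw [h0, div_zero] at h
      exact mul_ne_zero hG hne h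
    have hpi : (Real.pi:ℂ) ≠ 0 := by exact_mod_cast Real.pi_ne_zero
    rw [eq_div_iff hs] at h
    apply inv_eq_of_mul_eq_one_right
    calc Gamma z * (Gamma (1 - z) * sin (Real.pi * z) * (Real.pi:ℂ)⁻¹) = (Gamma z * Gamma (1 - z) * sin (Real.pi * z)) * (Real.pi:ℂ)⁻¹ := by ring
      _ = 1 := by rw [h, mul_inv_cancel₀ hpi]

lemma EG_invGamma (b : ℝ) : EG (strip b (3 / 2)) (fun z => (Gamma z)⁻¹) := by
  refine EG.of_hi ?_ differentiable_one_div_Gamma.continuous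
  obtain ⟨B, hB0, hB⟩ := (EG_invGamma_half (b - 1)).nonneg
  refine ⟨2 * B, fun z hz => ?_⟩
  have him : 1 / 2 ≤ ‖z - 1‖ := by
    refine le_trans ?_ (abs_im_le_norm _)
    simpa using hz.2.2
  have hne : z - 1 ≠ 0 := by rw [← norm_pos_iff]; linarith
  have h1 := hB (z - 1) ⟨by simp; linarith [hz.1], by simp; linarith [hz.2.1]⟩
  have h2 : Gamma z = (z - 1) * Gamma (z - 1) := by rw [← Gamma_add_one _ hne]; simp
  simp only
  rw [h2, mul_inv, norm_mul, norm_inv]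
  have h3 := inv_anti₀ (by norm_num) him
  have e : |(z - 1).im| = |z.im| := by simp
  rw [e] at h1
  calc _ ≤ (1 / 2)⁻¹ * (B * Real.exp (B * |z.im|)) := by gcongr
    _ ≤ 2 * (B * Real.exp (2 * B * |z.im|)) := by
      rw [one_div, inv_inv]
      have : B ≤ 2 * B := by linarith
      gcongr
    _ = _ := by ring

end ZD
end

section
open Complex MeasureTheory Filter Topology

namespace ZD

noncomputable def psi (k : ℕ) (s : ℂ) : ℂ := Gamma ((1 - s + k) / 2) * (Gamma ((s + k) / 2))⁻¹

lemma psi_diff (k : ℕ) (s : ℂ) (hs : s.re < 1) : DifferentiableAt ℂ (psi k) s := by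
  unfold psi
  apply DifferentiableAt.mul
  · apply DifferentiableAt.comp s (g := Gamma) (f := fun s : ℂ => (1 - s + (k:ℂ)) / 2)
    · apply differentiableAt_Gamma
      intro m h
      have := congrArg re h
      simp at this
      have h2 : (0:ℝ) ≤ m := Nat.cast_nonneg m
      have h3 : (0:ℝ) ≤ k := Nat.cast_nonneg k
      linarith
    · fun_prop
  · exact (differentiable_one_div_Gamma _).comp s (f := fun s : ℂ => (s + (k:ℂ)) / 2) (by fun_prop)

lemma psi_half (k : ℕ) (t : ℝ) : ‖psi k (1 / 2 + t * I)‖ ≤ 1 := by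
  have h : (1 - (1 / 2 + t * I) + k : ℂ) / 2 = (starRingEnd ℂ) (((1 / 2 + t * I) + k) / 2) := by
    simp [map_ofNat]; ring
  rw [psi, h, Gamma_conj, norm_mul, RCLike.norm_conj, norm_inv]
  exact mul_inv_le_one

lemma psi_zero_neg_one (t : ℝ) : ‖psi 0 (-1 + t * I)‖ ^ 2 ≤ 4 * (1 + |t|) ^ 3 := by
  set y : ℝ := t / 2 with hy
  have e1 : (1 - (-1 + t * I) + (0:ℕ) : ℂ) / 2 = 1 + (-y : ℝ) * I := by rw [hy]; push_cast; ring
  have e2 : ((-1 + t * I) + (0:ℕ) : ℂ) / 2 = -1 / 2 + y * I := by rw [hy]; push_cast; ring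
  have hne : (-1 / 2 + y * I : ℂ) ≠ 0 := by
    intro h; have := congrArg re h; simp at this
  have e3 : (Gamma (-1 / 2 + y * I))⁻¹ = (-1 / 2 + y * I) * (Gamma (1 / 2 + y * I))⁻¹ := by
    rw [show (1 / 2 + y * I : ℂ) = (-1 / 2 + y * I) + 1 by ring, Gamma_add_one _ hne]
    rw [mul_inv, ← mul_assoc, mul_inv_cancel₀ hne, one_mul]
  rw [psi, e1, e2, e3, norm_mul, norm_mul, norm_inv, mul_pow, mul_pow, inv_pow, norm_Gamma_half_sq]
  have h5 : ‖(-1 / 2 + y * I : ℂ)‖ ≤ 1 + |t| := by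
    refine (norm_add_le _ _).trans ?_
    simp [hy, abs_div]; linarith [abs_nonneg t]
  have hch : 0 < Real.cosh (Real.pi * y) := Real.cosh_pos _
  have h6 : ‖Gamma (1 + (-y : ℝ) * I)‖ ^ 2 * (Real.pi / Real.cosh (Real.pi * y))⁻¹ ≤ 4 * (1 + |t|) := by
    by_cases h0 : y = 0
    · rw [h0]; simp
      have := Real.pi_gt_three
      have : Real.pi⁻¹ ≤ 3⁻¹ := inv_anti₀ (by norm_num) this.le
      linarith [abs_nonneg t]
    · rw [norm_Gamma_one_sq _ (neg_ne_zero.mpr h0)]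
      have h3 : Real.pi * -y / Real.sinh (Real.pi * -y) = Real.pi * |y| / Real.sinh (Real.pi * |y|) := by
        rcases abs_cases y with ⟨h, _⟩ | ⟨h, _⟩ <;> rw [h]
        rw [mul_neg, Real.sinh_neg]; field_simp
      have h4 : Real.cosh (Real.pi * y) = Real.cosh (Real.pi * |y|) := by
        rw [← Real.cosh_abs, abs_mul, abs_of_pos Real.pi_pos]
      rw [h3, h4, inv_div]
      set u := Real.pi * |y| with hu
      have hu0 : 0 < u := by positivity
      have hs : 0 < Real.sinh u := Real.sinh_pos_iff.mpr hu0
      have h7 : u * Real.cosh u ≤ (1 + u) * Real.sinh u := by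
        have : Real.cosh u - Real.sinh u = Real.exp (-u) := Real.cosh_sub_sinh u
        have h8 : u ≤ Real.sinh u := Real.self_le_sinh_iff.mpr hu0.le
        have h9 : Real.exp (-u) ≤ 1 := Real.exp_le_one_iff.mpr (by linarith)
        nlinarith
      have : u / Real.sinh u * (Real.cosh u / Real.pi) ≤ (1 + u) / Real.pi := by
        rw [div_mul_div_comm, div_le_div_iff₀ (by positivity) Real.pi_pos]
        nlinarith [Real.pi_pos]
      refine this.trans ?_
      rw [div_le_iff₀ Real.pi_pos, hu]
      have : |y| = |t| / 2 := by rw [hy, abs_div]; simp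
      rw [this]
      nlinarith [Real.pi_gt_three, abs_nonneg t]
  calc _ = (‖Gamma (1 + (-y : ℝ) * I)‖ ^ 2 * (Real.pi / Real.cosh (Real.pi * y))⁻¹) * ‖(-1 / 2 + y * I : ℂ)‖ ^ 2 := by ring
    _ ≤ (4 * (1 + |t|)) * (1 + |t|) ^ 2 := by gcongr
    _ = _ := by ring

lemma psi_one_neg_one (t : ℝ) : ‖psi 1 (-1 + t * I)‖ ^ 2 ≤ 4 * (1 + |t|) ^ 3 := by
  set y : ℝ := t / 2 with hy
  have e1 : (1 - (-1 + t * I) + (1:ℕ) : ℂ) / 2 = (1 / 2 + (-y : ℝ) * I) + 1 := by rw [hy]; push_cast; ring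
  have e2 : ((-1 + t * I) + (1:ℕ) : ℂ) / 2 = y * I := by rw [hy]; push_cast; ring
  have hne : (1 / 2 + (-y : ℝ) * I : ℂ) ≠ 0 := by
    intro h; have := congrArg re h; simp at this
  rw [psi, e1, e2, Gamma_add_one _ hne]
  by_cases h0 : y = 0
  · rw [h0]; simp; positivity
  have hyI : (y:ℂ) * I ≠ 0 := mul_ne_zero (by exact_mod_cast h0) I_ne_zero
  have e3 : (Gamma (y * I))⁻¹ = (y * I) * (Gamma (1 + y * I))⁻¹ := by
    rw [add_comm, Gamma_add_one _ hyI]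
    rw [mul_inv, ← mul_assoc, mul_inv_cancel₀ hyI, one_mul]
  rw [e3, norm_mul, norm_mul, norm_mul, norm_inv]
  simp only [mul_pow, inv_pow]
  rw [norm_Gamma_half_sq, norm_Gamma_one_sq _ h0]
  have h3 : Real.pi * y / Real.sinh (Real.pi * y) = Real.pi * |y| / Real.sinh (Real.pi * |y|) := by
    rcases abs_cases y with ⟨h, _⟩ | ⟨h, _⟩ <;> rw [h]
    rw [mul_neg, Real.sinh_neg]; field_simp
  have h4 : Real.cosh (Real.pi * -y) = Real.cosh (Real.pi * |y|) := by
    rw [← Real.cosh_abs, abs_mul, abs_of_pos Real.pi_pos, abs_neg]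
  rw [h3, h4, inv_div]
  have hu0 : 0 < Real.pi * |y| := by positivity
  have hs : 0 < Real.sinh (Real.pi * |y|) := Real.sinh_pos_iff.mpr hu0
  have hc : 0 < Real.cosh (Real.pi * |y|) := Real.cosh_pos _
  have hsc : Real.sinh (Real.pi * |y|) ≤ Real.cosh (Real.pi * |y|) := (Real.sinh_lt_cosh _).le
  have hyt : |y| = |t| / 2 := by rw [hy, abs_div]; simp
  have h5 : ‖(1 / 2 + (-y : ℝ) * I : ℂ)‖ ≤ 1 + |t| := by
    refine (norm_add_le _ _).trans ?_
    simp [hyt]; linarith [abs_nonneg t]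
  have h6 : ‖(y * I : ℂ)‖ = |y| := by simp
  have hy0 : 0 < |y| := by positivity
  rw [h6]
  calc _ = ‖(1 / 2 + (-y : ℝ) * I : ℂ)‖ ^ 2 * (|y| * (Real.sinh (Real.pi * |y|) / Real.cosh (Real.pi * |y|))) := by
        field_simp
    _ ≤ (1 + |t|) ^ 2 * (|y| * 1) := by
      gcongr
      rw [div_le_one hc]; exact hsc
    _ ≤ (1 + |t|) ^ 2 * (4 * (1 + |t|)) := by
      rw [hyt]
      apply mul_le_mul_of_nonneg_left _ (by positivity)
      linarith [abs_nonneg t]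
    _ = _ := by ring

lemma psi_EG (k : ℕ) (hk : k ≤ 1) : EG (strip (-1) (1 / 2)) (psi k) := by
  have hk1 : (k:ℝ) ≤ 1 := by exact_mod_cast hk
  have hk0 : (0:ℝ) ≤ k := Nat.cast_nonneg k
  obtain ⟨B, hB0, hB⟩ := (EG_Gamma (1 / 4) 2 (by norm_num)).nonneg
  obtain ⟨C, hC0, hC⟩ := (EG_invGamma (-1)).nonneg
  have h1 : EG (strip (-1) (1 / 2)) (fun s => Gamma ((1 - s + k) / 2)) := by
    refine ⟨B, fun z hz => ?_⟩
    have := hB ((1 - z + k) / 2) ⟨by simp; linarith [hz.2], by simp; linarith [hz.1]⟩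
    refine this.trans ?_
    have : |((1 - z + k) / 2).im| ≤ |z.im| := by simp [abs_div]
    gcongr
  have h2 : EG (strip (-1) (1 / 2)) (fun s => (Gamma ((s + k) / 2))⁻¹) := by
    refine ⟨C, fun z hz => ?_⟩
    have := hC ((z + k) / 2) ⟨by simp; linarith [hz.1], by simp; linarith [hz.2]⟩
    refine this.trans ?_
    have : |((z + k) / 2).im| ≤ |z.im| := by simp [abs_div]
    gcongr
  exact h1.mul h2

lemma shift_EG {b c : ℝ} {F : ℂ → ℂ} (h : EG (strip b c) F) (t : ℝ) :
    ∃ B, ∀ z : ℂ, b ≤ z.re → z.re ≤ c → ‖F (z + t * I)‖ ≤ B * Real.exp (B * |z.im|) := by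
  obtain ⟨B, hB0, hB⟩ := h.nonneg
  refine ⟨B * Real.exp (B * |t|) + B, fun z h1 h2 => ?_⟩
  have := hB (z + t * I) ⟨by simpa using h1, by simpa using h2⟩
  refine this.trans ?_
  have h3 : |(z + t * I).im| ≤ |z.im| + |t| := by simpa using abs_add_le z.im t
  calc B * Real.exp (B * |(z + t * I).im|) ≤ B * Real.exp (B * (|z.im| + |t|)) := by gcongr
    _ = B * Real.exp (B * |t|) * Real.exp (B * |z.im|) := by rw [mul_add, Real.exp_add]; ring
    _ ≤ _ := by
      have h4 : B ≤ B * Real.exp (B * |t|) + B := by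
        have : 0 ≤ B * Real.exp (B * |t|) := by positivity
        linarith
      have h5 : B * Real.exp (B * |t|) ≤ B * Real.exp (B * |t|) + B := by linarith
      gcongr

lemma one_add_abs_add (t u : ℝ) : 1 + |u + t| ≤ (1 + |t|) * (1 + |u|) := by
  have := abs_add_le u t
  nlinarith [abs_nonneg t, abs_nonneg u, mul_nonneg (abs_nonneg t) (abs_nonneg u)]

lemma psi_bound (k : ℕ) (hk : k ≤ 1) : ∃ C > 0, ∀ x t : ℝ, -1 ≤ x → x ≤ 1 / 2 →
    ‖psi k (x + t * I)‖ ^ 2 ≤ C * (1 + |t|) ^ (1 - 2 * x) := by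
  obtain ⟨C, hC, h⟩ := three_lines (-1) (1 / 2) (by norm_num) 3
  refine ⟨C * 4, by positivity, fun x t hx1 hx2 => ?_⟩
  have hneg : ∀ t : ℝ, ‖psi k (-1 + t * I)‖ ^ 2 ≤ 4 * (1 + |t|) ^ 3 := by
    interval_cases k
    · exact psi_zero_neg_one
    · exact psi_one_neg_one
  have h1 := h Unit (fun _ z => psi k (z + t * I)) (4 * (1 + |t|) ^ 3) 1 (by positivity) (by norm_num)
    (fun _ z _ hz => by
      have := (psi_diff k (z + t * I) (by simp; linarith)).comp z (f := fun z => z + t * I) (by fun_prop)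
      exact this)
    (fun _ => shift_EG (psi_EG k hk) t)
    (fun u => by
      simp only [Finset.univ_unique, Finset.sum_const, Finset.card_singleton, one_smul]
      have := hneg (u + t)
      rw [show (((-1:ℝ):ℂ) + u * I + t * I) = -1 + ((u + t : ℝ):ℂ) * I by push_cast; ring]
      refine this.trans ?_
      rw [mul_assoc, ← mul_pow]
      have := one_add_abs_add t u
      gcongr)
    (fun u => by
      simp only [Finset.univ_unique, Finset.sum_const, Finset.card_singleton, one_smul, one_mul]
      rw [show (((1 / 2:ℝ):ℂ) + u * I + t * I) = 1 / 2 + ((u + t : ℝ):ℂ) * I by push_cast; ring]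
      have := psi_half k (u + t)
      have h2 : ‖psi k (1 / 2 + ((u + t : ℝ):ℂ) * I)‖ ^ 2 ≤ 1 := pow_le_one₀ (norm_nonneg _) this
      refine h2.trans (one_le_pow₀ (by linarith [abs_nonneg u])))
    x hx1 hx2
  simp only [Finset.univ_unique, Finset.sum_const, Finset.card_singleton, one_smul, Real.one_rpow, mul_one] at h1
  refine h1.trans ?_
  rw [mul_assoc]
  apply mul_le_mul_of_nonneg_left _ hC.le
  rw [Real.mul_rpow (by norm_num) (by positivity)]
  have e1 : ((1 + |t|) ^ 3) ^ (1 - (x - -1) / (1 / 2 - -1)) = (1 + |t|) ^ (1 - 2 * x) := by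
    rw [← Real.rpow_natCast, ← Real.rpow_mul (by positivity)]; congr 1; push_cast; ring
  rw [e1]
  apply mul_le_mul_of_nonneg_right _ (by positivity)
  calc (4:ℝ) ^ (1 - (x - -1) / (1 / 2 - -1)) ≤ 4 ^ (1:ℝ) := by
        apply Real.rpow_le_rpow_of_exponent_le (by norm_num)
        have : 0 ≤ (x - -1) / (1 / 2 - -1) := div_nonneg (by linarith) (by norm_num)
        linarith
    _ = 4 := by norm_num

end ZD
end

section
open Complex MeasureTheory Filter Topology

namespace ZD

variable {N : ℕ} [NeZero N]

lemma exists_HL (χ : DirichletCharacter ℂ N) :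
    ∃ H : ℂ → ℂ, Differentiable ℂ H ∧ ∀ s, s ≠ 1 → H s = (s - 1) * χ.LFunction s := by
  by_cases h : χ = 1
  · subst h
    refine ⟨DirichletCharacter.LFunctionTrivChar₁ N, DirichletCharacter.differentiable_LFunctionTrivChar₁ N, fun s hs => ?_⟩
    rw [DirichletCharacter.LFunctionTrivChar₁, Function.update_of_ne hs]
  · refine ⟨fun s => (s - 1) * χ.LFunction s, ?_, fun _ _ => rfl⟩
    exact (differentiable_id.sub_const 1).mul (DirichletCharacter.differentiable_LFunction h)

noncomputable def HL (χ : DirichletCharacter ℂ N) : ℂ → ℂ := (exists_HL χ).choose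

lemma HL_diff (χ : DirichletCharacter ℂ N) : Differentiable ℂ (HL χ) := (exists_HL χ).choose_spec.1
lemma HL_eq (χ : DirichletCharacter ℂ N) {s : ℂ} (hs : s ≠ 1) : HL χ s = (s - 1) * χ.LFunction s :=
  (exists_HL χ).choose_spec.2 s hs

noncomputable def kap (s : ℂ) : ℂ := (s - 1) / (s + 3)
noncomputable def Lt (χ : DirichletCharacter ℂ N) (s : ℂ) : ℂ := HL χ s / (s + 3)

lemma add3_ne {s : ℂ} (hs : -3 < s.re) : s + 3 ≠ 0 := by
  intro h
  have := congrArg re h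
  simp at this; linarith

lemma Lt_eq (χ : DirichletCharacter ℂ N) {s : ℂ} (hs : s ≠ 1) : Lt χ s = kap s * χ.LFunction s := by
  rw [Lt, kap, HL_eq χ hs]; ring

lemma Lt_diff (χ : DirichletCharacter ℂ N) {s : ℂ} (hs : -3 < s.re) : DifferentiableAt ℂ (Lt χ) s :=
  (HL_diff χ s).div (by fun_prop) (add3_ne hs)

lemma kap_diff {s : ℂ} (hs : -3 < s.re) : DifferentiableAt ℂ kap s :=
  DifferentiableAt.div (by fun_prop) (by fun_prop) (add3_ne hs)

lemma kap_le {s : ℂ} (hs : -1 ≤ s.re) : ‖kap s‖ ≤ 1 := by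
  rw [kap, norm_div]
  apply div_le_one_of_le₀ _ (norm_nonneg _)
  rw [← abs_of_nonneg (norm_nonneg (s - 1)), ← abs_of_nonneg (norm_nonneg (s + 3)), ← sq_le_sq,
    Complex.sq_norm, Complex.sq_norm, normSq_apply, normSq_apply]
  simp
  nlinarith

lemma kap_ge {s : ℂ} (h0 : 0 ≤ s.re) (h1 : s.re ≤ 1) (hs : 10 ≤ |s.im|) : 1 / 2 ≤ ‖kap s‖ := by
  rw [kap, norm_div]
  rw [le_div_iff₀ (norm_pos_iff.mpr (add3_ne (by linarith)))]
  have h2 : |s.im| ≤ ‖s - 1‖ := by simpa using abs_im_le_norm (s - 1)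
  have h3 : ‖s + 3‖ ≤ ‖s - 1‖ + 4 := by
    calc ‖s + 3‖ = ‖(s - 1) + 4‖ := by congr 1; ring
      _ ≤ _ := by refine (norm_add_le _ _).trans ?_; simp
  linarith

lemma chi_norm_le (χ : DirichletCharacter ℂ N) (n : ℕ) : ‖χ n‖ ≤ 1 := χ.norm_le_one _

lemma LSeries_norm_le {f : ℕ → ℂ} (hf : ∀ n, ‖f n‖ ≤ 1) {c : ℝ} (hc : 1 < c) {s : ℂ} (hs : c ≤ s.re) :
    ‖LSeries f s‖ ≤ ∑' n : ℕ, 1 / (n:ℝ) ^ c := by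
  rw [LSeries]
  have hsum : Summable fun n : ℕ => 1 / (n:ℝ) ^ c := Real.summable_one_div_nat_rpow.mpr hc
  refine tsum_of_norm_bounded hsum.hasSum fun n => ?_
  rcases Nat.eq_zero_or_pos n with h | h
  · simp [h]; positivity
  · rw [LSeries.term_of_ne_zero h.ne', norm_div, norm_natCast_cpow' n h]
    have h1 : (1:ℝ) ≤ n := by exact_mod_cast h
    gcongr
    · exact hf n

lemma L_bdd (χ : DirichletCharacter ℂ N) {c : ℝ} (hc : 1 < c) : ∃ C > 0, ∀ s : ℂ, c ≤ s.re → ‖χ.LFunction s‖ ≤ C := by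
  refine ⟨(∑' n : ℕ, 1 / (n:ℝ) ^ c) + 1, ?_, fun s hs => ?_⟩
  · have : 0 ≤ ∑' n : ℕ, 1 / (n:ℝ) ^ c := tsum_nonneg fun n => by positivity
    linarith
  · rw [DirichletCharacter.LFunction_eq_LSeries χ (by linarith)]
    linarith [LSeries_norm_le (f := fun n => χ n) (fun n => chi_norm_le χ n) hc hs]

lemma L_lower (χ : DirichletCharacter ℂ N) {c : ℝ} (hc : 1 < c) : ∃ C > 0, ∀ s : ℂ, c ≤ s.re → 1 ≤ C * ‖χ.LFunction s‖ := by
  refine ⟨(∑' n : ℕ, 1 / (n:ℝ) ^ c) + 1, ?_, fun s hs => ?_⟩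
  · have : 0 ≤ ∑' n : ℕ, 1 / (n:ℝ) ^ c := tsum_nonneg fun n => by positivity
    linarith
  · have hs1 : 1 < s.re := by linarith
    rw [DirichletCharacter.LFunction_eq_LSeries χ hs1]
    have h := DirichletCharacter.LSeries.mul_mu_eq_one χ hs1
    have h2 := congrArg norm h
    rw [norm_mul, norm_one] at h2
    have h3 := LSeries_norm_le (f := (fun n => χ n * ((ArithmeticFunction.moebius n : ℤ) : ℂ))) (fun n => by
      rw [norm_mul]
      apply mul_le_one₀ (chi_norm_le χ n) (norm_nonneg _)
      rw [Complex.norm_intCast]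
      exact_mod_cast ArithmeticFunction.abs_moebius_le_one) hc hs
    have h4 : ‖LSeries ((fun n : ℕ => χ n) * fun n => ((ArithmeticFunction.moebius n : ℤ) : ℂ)) s‖ ≤ (∑' n : ℕ, 1 / (n:ℝ) ^ c) + 1 :=
      h3.trans (by linarith)
    refine h2.symm.le.trans ?_
    rw [mul_comm]
    exact mul_le_mul_of_nonneg_right h4 (norm_nonneg _)

lemma char_parity (χ : DirichletCharacter ℂ N) : ∃ k : ℕ, k ≤ 1 ∧ (∀ s, χ.gammaFactor s = Gammaℝ (s + k)) ∧
    (∀ s, χ⁻¹.gammaFactor s = Gammaℝ (s + k)) := by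
  rcases χ.even_or_odd with h | h
  · refine ⟨0, by norm_num, fun s => by simp [h.gammaFactor_def], fun s => ?_⟩
    have h' : χ⁻¹.Even := by
      unfold DirichletCharacter.Even at *
      rw [MulChar.inv_apply_eq_inv', h, inv_one]
    simp [h'.gammaFactor_def]
  · refine ⟨1, le_rfl, fun s => by simp [h.gammaFactor_def], fun s => ?_⟩
    have h' : χ⁻¹.Odd := by
      unfold DirichletCharacter.Odd at *
      rw [MulChar.inv_apply_eq_inv', h]; norm_num
    simp [h'.gammaFactor_def]

lemma EG_pi_cpow (k : ℕ) (hk : k ≤ 1) : EG (strip (-1) 2) (fun z => (Real.pi : ℂ) ^ ((z + k) / 2)) := by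
  refine EG.of_bdd (Real.pi ^ (2:ℝ)) fun z hz => ?_
  rw [Complex.norm_cpow_eq_rpow_re_of_pos Real.pi_pos]
  apply Real.rpow_le_rpow_of_exponent_le (by linarith [Real.pi_gt_three])
  have : (k:ℝ) ≤ 1 := by exact_mod_cast hk
  simp; linarith [hz.2]

lemma stripHi_sub (b c : ℝ) : stripHi b c ⊆ strip b c := fun _ h => ⟨h.1, h.2.1⟩

lemma EG_gammaFactor_inv (χ : DirichletCharacter ℂ N) : EG (strip (-1) 2) (fun z => (χ.gammaFactor z)⁻¹) := by
  obtain ⟨k, hk, h, -⟩ := char_parity χ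
  obtain ⟨C, hC0, hC⟩ := (EG_invGamma (-1)).nonneg
  have hk1 : (k:ℝ) ≤ 1 := by exact_mod_cast hk
  have hk0 : (0:ℝ) ≤ k := Nat.cast_nonneg k
  have h2 : EG (strip (-1) 2) (fun s => (Gamma ((s + k) / 2))⁻¹) := by
    refine ⟨C, fun z hz => ?_⟩
    have := hC ((z + k) / 2) ⟨by simp; linarith [hz.1], by simp; linarith [hz.2]⟩
    refine this.trans ?_
    have : |((z + k) / 2).im| ≤ |z.im| := by simp [abs_div]
    gcongr
  refine ((EG_pi_cpow k hk).mul h2).of_le fun z _ => le_of_eq ?_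
  rw [h, Gammaℝ_def, mul_inv, ← cpow_neg]
  congr 4; ring

lemma HL_EG (χ : DirichletCharacter ℂ N) (c : ℝ) : EG (strip (-1) c) (HL χ) := by
  apply EG.of_hi _ (HL_diff χ).continuous
  have hs1 : ∀ z : ℂ, 1 / 2 ≤ |z.im| → z ≠ 1 ∧ z ≠ 0 := by
    intro z hz
    constructor <;> · rintro rfl; norm_num at hz
  have e1 : EG (stripHi (-1) c) χ.LFunction := by
    have h1 : EG (stripHi (-1) 2) χ.LFunction := by
      refine ((completed_EG χ (-1) 2).mul ((EG_gammaFactor_inv χ).mono (stripHi_sub _ _))).of_le fun z hz => le_of_eq ?_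
      rw [DirichletCharacter.LFunction_eq_completed_div_gammaFactor χ z (Or.inl (hs1 z hz.2.2).2), div_eq_mul_inv]
    obtain ⟨C, _, hC⟩ := L_bdd χ (c := 2) (by norm_num)
    have h2 : EG (stripHi 2 c) χ.LFunction := EG.of_bdd C fun z hz => hC z hz.1
    refine (h1.union h2).mono fun z hz => ?_
    rcases le_total z.re 2 with h | h
    · exact Or.inl ⟨hz.1, h, hz.2.2⟩
    · exact Or.inr ⟨h, hz.2.1, hz.2.2⟩
  have e2 : EG (stripHi (-1) c) (fun z => z - 1) := by
    refine ⟨|c| + 3, fun z hz => ?_⟩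
    have h1 : ‖z - 1‖ ≤ |z.re| + |z.im| + 1 := by
      refine (norm_sub_le _ _).trans ?_
      simp [norm_le_abs_re_add_abs_im]
    have h2 := abs_le_strip hz.1 hz.2.1
    rw [abs_neg, abs_one] at h2
    have h3 : 1 + (|c| + 3) * |z.im| ≤ Real.exp ((|c| + 3) * |z.im|) := by
      linarith [Real.add_one_le_exp ((|c| + 3) * |z.im|)]
    have := abs_nonneg c
    have := abs_nonneg z.im
    calc _ ≤ (|c| + 3) * (1 + (|c| + 3) * |z.im|) := by
          refine h1.trans ?_
          nlinarith [mul_nonneg (abs_nonneg c) (abs_nonneg z.im), mul_nonneg (mul_nonneg (abs_nonneg c) (abs_nonneg c)) (abs_nonneg z.im)]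
      _ ≤ _ := by gcongr
  refine (e2.mul e1).of_le fun z hz => le_of_eq ?_
  rw [HL_eq χ (hs1 z hz.2.2).1]

lemma Lt_EG (χ : DirichletCharacter ℂ N) (c : ℝ) : EG (strip (-1) c) (Lt χ) := by
  refine (HL_EG χ c).of_le fun z hz => ?_
  rw [Lt, norm_div]
  apply div_le_self (norm_nonneg _)
  have := abs_re_le_norm (z + 3)
  have h2 := le_abs_self (z + 3).re
  simp at h2
  have := hz.1
  simp at *
  linarith

lemma L_fe {χ : DirichletCharacter ℂ N} (hχ : χ.IsPrimitive) : ∃ k : ℕ, k ≤ 1 ∧ ∀ s : ℂ, s ≠ 0 → s.re < 1 →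
    χ.LFunction s = (N : ℂ) ^ (1 / 2 - s) * χ.rootNumber * (Real.pi : ℂ) ^ (s - 1 / 2) * psi k s * χ⁻¹.LFunction (1 - s) := by
  obtain ⟨k, hk, h1, h2⟩ := char_parity χ
  refine ⟨k, hk, fun s hs0 hs1 => ?_⟩
  have hk0 : (0:ℝ) ≤ k := Nat.cast_nonneg k
  have hne : (1 - s) ≠ 0 := by
    intro h
    have := congrArg re h; simp at this; linarith
  have hg : Gammaℝ (1 - s + k) ≠ 0 := Gammaℝ_ne_zero_of_re_pos (by simp; linarith)
  have e1 := DirichletCharacter.LFunction_eq_completed_div_gammaFactor χ s (Or.inl hs0)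
  have e2 := DirichletCharacter.LFunction_eq_completed_div_gammaFactor χ⁻¹ (1 - s) (Or.inl hne)
  have e3 := hχ.completedLFunction_one_sub (1 - s)
  rw [h1] at e1
  rw [h2] at e2
  rw [show 1 - (1 - s) = s by ring] at e3
  rw [e1, e3, e2, show 1 - s - 1 / 2 = 1 / 2 - s by ring]
  have e4 : psi k s * (Real.pi : ℂ) ^ (s - 1 / 2) = Gammaℝ (1 - s + k) * (Gammaℝ (s + k))⁻¹ := by
    rw [psi, Gammaℝ_def, Gammaℝ_def, mul_inv, ← cpow_neg]
    have : (Real.pi : ℂ) ^ (s - 1 / 2) = (Real.pi : ℂ) ^ (-(1 - s + k) / 2) * (Real.pi : ℂ) ^ (-(-(s + k) / 2)) := by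
      rw [← cpow_add _ _ (by exact_mod_cast Real.pi_ne_zero)]; congr 1; ring
    rw [this]; ring
  calc _ = (N : ℂ) ^ (1 / 2 - s) * χ.rootNumber * χ⁻¹.completedLFunction (1 - s) * (Gammaℝ (s + k))⁻¹ * (Gammaℝ (1 - s + k) * (Gammaℝ (1 - s + k))⁻¹) := by
        rw [mul_inv_cancel₀ hg]; ring
    _ = (N : ℂ) ^ (1 / 2 - s) * χ.rootNumber * χ⁻¹.completedLFunction (1 - s) * (Gammaℝ (1 - s + k))⁻¹ * (Gammaℝ (1 - s + k) * (Gammaℝ (s + k))⁻¹) := by ring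
    _ = _ := by rw [← e4]; ring

lemma L_fe_bound {χ : DirichletCharacter ℂ N} (hχ : χ.IsPrimitive) : ∃ C > 0, ∀ x t : ℝ, -1 ≤ x → x ≤ 1 / 2 → (x + t * I : ℂ) ≠ 0 →
    ‖χ.LFunction (x + t * I)‖ ^ 2 ≤ C * (1 + |t|) ^ (1 - 2 * x) * ‖χ⁻¹.LFunction (1 - (x + t * I))‖ ^ 2 := by
  obtain ⟨k, hk, h⟩ := L_fe hχ
  obtain ⟨C, hC, hψ⟩ := psi_bound k hk
  refine ⟨((N:ℝ) ^ (2:ℝ)) ^ 2 * (‖χ.rootNumber‖ ^ 2 + 1) * C, ?_, fun x t hx1 hx2 h0 => ?_⟩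
  · have : (0:ℝ) < N := by exact_mod_cast NeZero.pos N
    positivity
  rw [h _ h0 (by simp; linarith)]
  simp only [norm_mul, mul_pow]
  have h1 : ‖(N:ℂ) ^ (1 / 2 - (x + t * I) : ℂ)‖ ≤ (N:ℝ) ^ (2:ℝ) := by
    rw [norm_natCast_cpow' N (NeZero.pos N)]
    apply Real.rpow_le_rpow_of_exponent_le (by exact_mod_cast NeZero.pos N)
    simp; linarith
  have h2 : ‖(Real.pi : ℂ) ^ ((x + t * I) - 1 / 2 : ℂ)‖ ≤ 1 := by
    rw [Complex.norm_cpow_eq_rpow_re_of_pos Real.pi_pos]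
    apply Real.rpow_le_one_of_one_le_of_nonpos (by linarith [Real.pi_gt_three])
    simp; linarith
  have h2' : ‖(Real.pi : ℂ) ^ ((x + t * I) - 1 / 2 : ℂ)‖ ^ 2 ≤ 1 := pow_le_one₀ (norm_nonneg _) h2
  have h3 := hψ x t hx1 hx2
  calc _ ≤ ((N:ℝ) ^ (2:ℝ)) ^ 2 * (‖χ.rootNumber‖ ^ 2 + 1) * 1 * (C * (1 + |t|) ^ (1 - 2 * x)) * ‖χ⁻¹.LFunction (1 - (x + t * I))‖ ^ 2 := by
        gcongr
        linarith
    _ = _ := by ring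

lemma Lt_line {χ : DirichletCharacter ℂ N} (hχ : χ.IsPrimitive) {δ : ℝ} (h0 : 0 < δ) (h1 : δ ≤ 1) :
    ∃ C > 0, ∀ t : ℝ, ‖Lt χ (-δ + t * I)‖ ^ 2 ≤ C * (1 + |t|) ^ (1 + 2 * δ) := by
  obtain ⟨C, hC, h⟩ := L_fe_bound hχ
  obtain ⟨B, hB, hL⟩ := L_bdd χ⁻¹ (c := 1 + δ) (by linarith)
  refine ⟨C * B ^ 2, by positivity, fun t => ?_⟩
  have hne1 : (-δ + t * I : ℂ) ≠ 1 := by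
    intro h; have := congrArg re h; simp at this; linarith
  have hne0 : (((-δ : ℝ):ℂ) + t * I : ℂ) ≠ 0 := by
    intro h; have := congrArg re h; simp at this; linarith
  rw [Lt_eq χ hne1, norm_mul, mul_pow]
  have h2 : ‖kap (-δ + t * I)‖ ^ 2 ≤ 1 := pow_le_one₀ (norm_nonneg _) (kap_le (by simp; linarith))
  have h3 := h (-δ) t (by linarith) (by linarith) hne0
  have h4 := hL (1 - (((-δ : ℝ):ℂ) + t * I)) (by simp)
  have h5 : ‖χ⁻¹.LFunction (1 - (((-δ : ℝ):ℂ) + t * I))‖ ^ 2 ≤ B ^ 2 := by gcongr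
  push_cast at h3 h5
  calc _ ≤ 1 * (C * (1 + |t|) ^ (1 - 2 * (-δ)) * B ^ 2) := by
        refine mul_le_mul h2 (h3.trans ?_) (by positivity) zero_le_one
        gcongr
    _ = _ := by rw [show 1 - 2 * (-δ) = 1 + 2 * δ by ring]; ring

lemma Lt_right (χ : DirichletCharacter ℂ N) {c : ℝ} (hc : 1 < c) : ∃ C > 0, ∀ s : ℂ, c ≤ s.re → ‖Lt χ s‖ ≤ C := by
  obtain ⟨B, hB, hL⟩ := L_bdd χ hc
  refine ⟨B, hB, fun s hs => ?_⟩
  have hne1 : s ≠ 1 := by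
    rintro rfl; simp at hs; linarith
  rw [Lt_eq χ hne1, norm_mul]
  calc _ ≤ 1 * B := mul_le_mul (kap_le (by linarith)) (hL s hs) (norm_nonneg _) zero_le_one
    _ = B := one_mul B

lemma Lt_poly {χ : DirichletCharacter ℂ N} (hχ : χ.IsPrimitive) :
    ∃ C > 0, ∀ x t : ℝ, -1 ≤ x → x ≤ 4 → ‖Lt χ (x + t * I)‖ ^ 2 ≤ C * (1 + |t|) ^ 3 := by
  obtain ⟨C1, hC1, h1⟩ := Lt_line hχ (δ := 1) (by norm_num) le_rfl
  obtain ⟨C2, hC2, h2⟩ := Lt_right χ (c := 4) (by norm_num)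
  obtain ⟨C, hC, h⟩ := three_lines (-1) 4 (by norm_num) 3
  refine ⟨C * ((C1 + 1) * (C2 + 1) ^ 2), by positivity, fun x t hx1 hx2 => ?_⟩
  have h3 := h Unit (fun _ z => Lt χ (z + t * I)) ((C1 + 1) * (1 + |t|) ^ 3) ((C2 + 1) ^ 2) (by positivity) (by positivity)
    (fun _ z hz _ => by
      have := (Lt_diff χ (s := z + t * I) (by simp; linarith)).comp z (f := fun z => z + t * I) (by fun_prop)
      exact this)
    (fun _ => shift_EG (Lt_EG χ 4) t)
    (fun u => by
      simp only [Finset.univ_unique, Finset.sum_const, Finset.card_singleton, one_smul]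
      have := h1 (u + t)
      rw [show (((-1:ℝ):ℂ) + u * I + t * I) = -((1:ℝ):ℂ) + ((u + t : ℝ):ℂ) * I by push_cast; ring]
      refine this.trans ?_
      rw [show (1 + 2 * (1:ℝ)) = ((3:ℕ):ℝ) by norm_num, Real.rpow_natCast, mul_assoc, ← mul_pow]
      have := one_add_abs_add t u
      gcongr
      linarith)
    (fun u => by
      simp only [Finset.univ_unique, Finset.sum_const, Finset.card_singleton, one_smul]
      have := h2 (((4:ℝ):ℂ) + u * I + t * I) (by simp)
      calc _ ≤ (C2 + 1) ^ 2 * 1 := by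
            rw [mul_one]; gcongr; linarith
        _ ≤ _ := by gcongr; exact one_le_pow₀ (by linarith [abs_nonneg u]))
    x hx1 hx2
  simp only [Finset.univ_unique, Finset.sum_const, Finset.card_singleton, one_smul] at h3
  refine h3.trans ?_
  rw [mul_assoc]
  apply mul_le_mul_of_nonneg_left _ hC.le
  have hθ0 : 0 ≤ (x - -1) / (4 - -1) := div_nonneg (by linarith) (by norm_num)
  have hθ1 : (x - -1) / (4 - -1) ≤ 1 := by rw [div_le_one (by norm_num)]; linarith
  set θ := (x - -1) / (4 - -1) with hθ
  have ht : 1 ≤ (1 + |t|) ^ 3 := one_le_pow₀ (by linarith [abs_nonneg t])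
  calc _ ≤ ((C1 + 1) * (1 + |t|) ^ 3) ^ (1:ℝ) * ((C2 + 1) ^ 2) ^ (1:ℝ) := by
        apply mul_le_mul _ _ (by positivity) (by positivity)
        · apply Real.rpow_le_rpow_of_exponent_le (by nlinarith) (by linarith)
        · apply Real.rpow_le_rpow_of_exponent_le (by nlinarith) (by linarith)
    _ = _ := by rw [Real.rpow_one, Real.rpow_one]; ring

end ZD
end

section
open Complex MeasureTheory Filter Topology

namespace ZD

variable {q : ℕ} [NeZero q]

lemma ceil_pow {T a : ℝ} (hT : 1 ≤ T) (ha : 0 ≤ a) : ∃ Y : ℕ, 1 ≤ Y ∧ T ^ a ≤ Y ∧ (Y:ℝ) ≤ 2 * T ^ a := by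
  have h1 : 1 ≤ T ^ a := Real.one_le_rpow hT ha
  refine ⟨⌈T ^ a⌉₊, Nat.one_le_ceil_iff.mpr (by linarith), Nat.le_ceil _, ?_⟩
  linarith [Nat.ceil_lt_add_one (show 0 ≤ T ^ a by linarith)]

lemma Ypow_pos {T a Y p : ℝ} (hT : 1 ≤ T) (hY0 : 0 ≤ Y) (hY : Y ≤ 2 * T ^ a) (hp : 0 ≤ p) :
    Y ^ p ≤ 2 ^ p * T ^ (a * p) := by
  have hT0 : 0 ≤ T := by linarith
  calc Y ^ p ≤ (2 * T ^ a) ^ p := Real.rpow_le_rpow hY0 hY hp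
    _ = _ := by rw [Real.mul_rpow (by norm_num) (by positivity), ← Real.rpow_mul hT0]

lemma Ypow_neg {T a Y p : ℝ} (hT : 1 ≤ T) (hY : T ^ a ≤ Y) (hp : p ≤ 0) :
    Y ^ p ≤ T ^ (a * p) := by
  have hT0 : 0 < T := by linarith
  calc Y ^ p ≤ (T ^ a) ^ p := Real.rpow_le_rpow_of_nonpos (by positivity) hY hp
    _ = _ := by rw [← Real.rpow_mul hT0.le]

lemma conv_chi_bound (χ : DirichletCharacter ℂ q) {e : ℝ} (he : 0 < e) :
    ∃ C > 0, ∀ n : ℕ, 1 ≤ n → ‖(LSeries.convolution (fun n : ℕ => χ n) (fun n : ℕ => χ n)) n‖ ≤ C * (n:ℝ) ^ e := by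
  obtain ⟨C, hC, h⟩ := conv_bound (e / 2) (by positivity)
  refine ⟨C, hC, fun n hn => ?_⟩
  have h1 : ∀ n : ℕ, 1 ≤ n → ‖χ n‖ ≤ 1 * (n:ℝ) ^ (e / 2) := fun n hn => by
    rw [one_mul]
    exact (chi_norm_le χ n).trans (Real.one_le_rpow (by exact_mod_cast hn) (by positivity))
  have := h (fun n : ℕ => χ n) (fun n : ℕ => χ n) 1 1 zero_le_one zero_le_one h1 h1 n hn
  convert this using 2
  · ring
  · congr 1; ring

lemma sq_norm_sub_le (a b : ℂ) : ‖a - b‖ ^ 2 ≤ 2 * ‖a‖ ^ 2 + 2 * ‖b‖ ^ 2 := by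
  have h := norm_sub_le a b
  have : ‖a - b‖ ^ 2 ≤ (‖a‖ + ‖b‖) ^ 2 := by gcongr
  nlinarith [sq_nonneg (‖a‖ - ‖b‖)]

lemma DP_diff (N : ℕ) (f : ℕ → ℂ) : Differentiable ℂ (DP N f) := by
  unfold DP
  intro s
  apply DifferentiableAt.fun_sum
  intro n hn
  have hn0 : (n:ℂ) ≠ 0 := by
    have := (Finset.mem_Icc.mp hn).1
    exact_mod_cast (by omega : n ≠ 0)
  apply DifferentiableAt.const_mul
  exact (differentiableAt_id.neg).const_cpow (Or.inl hn0)

lemma DP_EG (N : ℕ) (f : ℕ → ℂ) (b c : ℝ) : EG (strip b c) (DP N f) := by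
  unfold DP
  apply EG.sum
  intro n hn
  have hn1 := (Finset.mem_Icc.mp hn).1
  apply EG.mul (EG.const _ _)
  refine EG.of_bdd ((n:ℝ) ^ (-b)) fun z hz => ?_
  rw [norm_natCast_cpow' n hn1]
  apply Real.rpow_le_rpow_of_exponent_le (by exact_mod_cast hn1)
  simp; exact hz.1

lemma kap_EG (b c : ℝ) (hb : -1 ≤ b) : EG (strip b c) kap :=
  EG.of_bdd 1 fun z hz => kap_le (by linarith [hz.1])

lemma diff_shift {F : ℂ → ℂ} {z : ℂ} {t : ℝ} (h : DifferentiableAt ℂ F (z + t * I)) :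
    DifferentiableAt ℂ (fun z => F (z + t * I)) z :=
  h.comp z (f := fun z => z + t * I) (by fun_prop)

lemma rpow_le_rpow_T {T a b : ℝ} (hT : 1 ≤ T) (h : a ≤ b) : T ^ a ≤ T ^ b :=
  Real.rpow_le_rpow_of_exponent_le hT h

/-- the function `κ²(L² - P)` -/
noncomputable def F2 (χ : DirichletCharacter ℂ q) (Y : ℕ) (s : ℂ) : ℂ :=
  Lt χ s ^ 2 - kap s ^ 2 * DP Y (LSeries.convolution (fun n : ℕ => χ n) (fun n : ℕ => χ n)) s

lemma F2_diff (χ : DirichletCharacter ℂ q) (Y : ℕ) {s : ℂ} (hs : -3 < s.re) : DifferentiableAt ℂ (F2 χ Y) s := by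
  unfold F2
  exact ((Lt_diff χ hs).pow 2).sub (((kap_diff hs).pow 2).mul (DP_diff _ _ s))

lemma F2_EG (χ : DirichletCharacter ℂ q) (Y : ℕ) (b c : ℝ) (hb : -1 ≤ b) : EG (strip b c) (F2 χ Y) := by
  have h1 : EG (strip b c) (Lt χ) := (Lt_EG χ c).mono fun z hz => ⟨hb.trans hz.1, hz.2⟩
  have h2 := (h1.mul h1).add ((EG.const _ (-1)).mul (((kap_EG b c hb).mul (kap_EG b c hb)).mul (DP_EG Y (LSeries.convolution (fun n : ℕ => χ n) (fun n : ℕ => χ n)) b c)))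
  refine h2.of_le fun z _ => le_of_eq ?_
  congr 1
  rw [F2]; ring

lemma one_add_abs_le {T t u : ℝ} (hT : 1 ≤ T) (ht : |t| ≤ T) : 1 + |u + t| ≤ 2 * T * (1 + |u|) := by
  refine (one_add_abs_add t u).trans ?_
  gcongr; linarith

lemma F2_left {χ : DirichletCharacter ℂ q} (hχ : χ.IsPrimitive) {d : ℝ} (hd : 0 < d) (hd1 : d ≤ 1 / 4) :
    ∃ C > 0, ∀ (ι : Type) [Fintype ι] (t : ι → ℝ), Sep t → ∀ T : ℝ, 1 ≤ T → (∀ i, |t i| ≤ T) → ∀ Y : ℕ, 1 ≤ Y →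
      T ^ (3 / 2 : ℝ) ≤ Y → (Y:ℝ) ≤ 2 * T ^ (3 / 2 : ℝ) → ∀ u : ℝ,
      ∑ i, ‖F2 χ Y (((-d : ℝ) : ℂ) + u * I + t i * I)‖ ^ 2 ≤ C * T ^ (3 + 8 * d) * (1 + |u|) ^ 3 := by
  obtain ⟨C1, hC1, h1⟩ := Lt_line hχ hd (by linarith)
  obtain ⟨C2, hC2, h2⟩ := conv_chi_bound χ hd
  obtain ⟨C3, hC3, h3⟩ := mv d hd
  refine ⟨2 * (4 * C1 ^ 2 * 2 ^ 3) + 2 * (C3 * C2 ^ 2 * 2 * 2 ^ (2 + 5 * d)), by positivity,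
    fun ι _ t ht T hT htT Y hY1 hY hY2 u => ?_⟩
  have hT0 : 0 < T := by linarith
  have hu := abs_nonneg u
  set D := LSeries.convolution (fun n : ℕ => χ n) (fun n : ℕ => χ n) with hD
  have hYr : (1:ℝ) ≤ Y := by exact_mod_cast hY1
  have hTY : T ≤ Y := by
    refine le_trans ?_ hY
    calc T = T ^ (1:ℝ) := (Real.rpow_one T).symm
      _ ≤ _ := rpow_le_rpow_T hT (by norm_num)
  have e1 : ∀ i, ‖F2 χ Y (((-d : ℝ) : ℂ) + u * I + t i * I)‖ ^ 2 ≤ 2 * (C1 ^ 2 * 2 ^ 3 * T ^ (2 + 4 * d) * (1 + |u|) ^ 3) +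
      2 * ‖DP Y D (((-d : ℝ) : ℂ) + (t i + u : ℝ) * I)‖ ^ 2 := by
    intro i
    have es : (((-d : ℝ) : ℂ) + u * I + t i * I) = ((-d : ℝ) : ℂ) + (t i + u : ℝ) * I := by push_cast; ring
    rw [es, F2]
    refine (sq_norm_sub_le _ _).trans ?_
    have h4 := h1 (t i + u)
    have h5 : 1 + |t i + u| ≤ 2 * T * (1 + |u|) := by rw [add_comm (t i)]; exact one_add_abs_le hT (htT i)
    have h6 : ‖Lt χ (((-d : ℝ) : ℂ) + (t i + u : ℝ) * I) ^ 2‖ ^ 2 ≤ C1 ^ 2 * 2 ^ 3 * T ^ (2 + 4 * d) * (1 + |u|) ^ 3 := by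
      rw [norm_pow]
      push_cast at h4 ⊢
      calc _ ≤ (C1 * (1 + |t i + u|) ^ (1 + 2 * d)) ^ 2 := by gcongr
        _ = C1 ^ 2 * (1 + |t i + u|) ^ (2 + 4 * d) := by
          rw [mul_pow, ← Real.rpow_natCast, ← Real.rpow_natCast, ← Real.rpow_mul (by positivity)]
          congr 2; push_cast; ring
        _ ≤ C1 ^ 2 * (2 * T * (1 + |u|)) ^ (2 + 4 * d) := by gcongr
        _ = C1 ^ 2 * (2 ^ (2 + 4 * d) * T ^ (2 + 4 * d) * (1 + |u|) ^ (2 + 4 * d)) := by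
          rw [Real.mul_rpow (by positivity) (by positivity), Real.mul_rpow (by positivity) (by positivity)]
        _ ≤ C1 ^ 2 * (2 ^ (3:ℝ) * T ^ (2 + 4 * d) * (1 + |u|) ^ (3:ℝ)) := by
          gcongr <;> linarith
        _ = _ := by norm_num; ring
    have h7 : ‖kap (((-d : ℝ) : ℂ) + (t i + u : ℝ) * I) ^ 2 * DP Y D (((-d : ℝ) : ℂ) + (t i + u : ℝ) * I)‖ ≤
        ‖DP Y D (((-d : ℝ) : ℂ) + (t i + u : ℝ) * I)‖ := by
      rw [norm_mul, norm_pow]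
      apply mul_le_of_le_one_left (norm_nonneg _)
      exact pow_le_one₀ (norm_nonneg _) (kap_le (by simp; linarith))
    gcongr
  refine (Finset.sum_le_sum fun i _ => e1 i).trans ?_
  rw [Finset.sum_add_distrib, Finset.sum_const, ← Finset.mul_sum, Finset.card_univ, nsmul_eq_mul]
  have e2 := h3 ι (fun i => t i + u) (ht.shift u) (T * (1 + |u|)) (by nlinarith) (fun i => by
      have := abs_add_le (t i) u
      have := htT i
      nlinarith) Y hY1 D C2 (-d) ((Y:ℝ) ^ (1 + 2 * d)) hC2.le (by linarith) (by positivity)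
      (fun n hn => h2 n (Finset.mem_Icc.mp hn).1)
      (fun n hn _ => by
        obtain ⟨hn1, hn2⟩ := Finset.mem_Icc.mp hn
        rw [show 1 - 2 * (-d) = 1 + 2 * d by ring]
        have : (n:ℝ) ≤ Y := by exact_mod_cast hn2
        gcongr)
  have e3 : (Y:ℝ) ^ (3 * d) * (T * (1 + |u|) * (Y:ℝ) ^ (1 + 2 * d) + (Y:ℝ) ^ (2 - 2 * (-d))) ≤ 2 * 2 ^ (2 + 5 * d) * T ^ (3 + 8 * d) * (1 + |u|) ^ 3 := by
    calc _ ≤ (Y:ℝ) ^ (3 * d) * (Y * (1 + |u|) * (Y:ℝ) ^ (1 + 2 * d) + (Y:ℝ) ^ (2 - 2 * (-d)) * (1 + |u|)) := by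
          gcongr
          exact le_mul_of_one_le_right (by positivity) (by linarith)
      _ = 2 * (Y:ℝ) ^ (2 + 5 * d) * (1 + |u|) := by
          have : (Y:ℝ) ^ (2 + 5 * d) = (Y:ℝ) ^ (3 * d) * Y * (Y:ℝ) ^ (1 + 2 * d) := by
            rw [← Real.rpow_add_one (by positivity), ← Real.rpow_add (by positivity)]; congr 1; ring
          have h' : (Y:ℝ) ^ (2 + 5 * d) = (Y:ℝ) ^ (3 * d) * (Y:ℝ) ^ (2 - 2 * (-d)) := by
            rw [← Real.rpow_add (by positivity)]; congr 1; ring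
          linear_combination (-(1 + |u|)) * this - (1 + |u|) * h'
      _ ≤ 2 * (2 ^ (2 + 5 * d) * T ^ (3 + 8 * d)) * (1 + |u|) ^ 3 := by
          have := Ypow_pos (p := 2 + 5 * d) hT (by positivity) hY2 (by positivity)
          have h4 : T ^ (3 / 2 * (2 + 5 * d)) ≤ T ^ (3 + 8 * d) := rpow_le_rpow_T hT (by linarith)
          have h5 : (Y:ℝ) ^ (2 + 5 * d) ≤ 2 ^ (2 + 5 * d) * T ^ (3 + 8 * d) := this.trans (by gcongr)
          gcongr
          exact le_self_pow₀ (by linarith) (by norm_num)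
      _ = _ := by ring
  have e4 := sep_card ht hT htT
  have e5 : T * T ^ (2 + 4 * d) ≤ T ^ (3 + 8 * d) := by
    rw [mul_comm, ← Real.rpow_add_one hT0.ne']
    exact rpow_le_rpow_T hT (by linarith)
  calc _ ≤ (4 * T) * (2 * (C1 ^ 2 * 2 ^ 3 * T ^ (2 + 4 * d) * (1 + |u|) ^ 3)) +
        2 * (C3 * C2 ^ 2 * (2 * 2 ^ (2 + 5 * d) * T ^ (3 + 8 * d) * (1 + |u|) ^ 3)) := by
        have : C3 * C2 ^ 2 * (Y:ℝ) ^ (3 * d) * (T * (1 + |u|) * (Y:ℝ) ^ (1 + 2 * d) + (Y:ℝ) ^ (2 - 2 * (-d))) ≤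
          C3 * C2 ^ 2 * (2 * 2 ^ (2 + 5 * d) * T ^ (3 + 8 * d) * (1 + |u|) ^ 3) := by
          rw [mul_assoc (C3 * C2 ^ 2)]; gcongr
        refine add_le_add ?_ ?_
        · exact mul_le_mul_of_nonneg_right e4 (by positivity)
        · exact mul_le_mul_of_nonneg_left (e2.trans this) (by norm_num)
    _ = (2 * (4 * C1 ^ 2 * 2 ^ 3)) * (T * T ^ (2 + 4 * d)) * (1 + |u|) ^ 3 + 2 * (C3 * C2 ^ 2 * 2 * 2 ^ (2 + 5 * d)) * T ^ (3 + 8 * d) * (1 + |u|) ^ 3 := by ring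
    _ ≤ (2 * (4 * C1 ^ 2 * 2 ^ 3)) * (T ^ (3 + 8 * d)) * (1 + |u|) ^ 3 + 2 * (C3 * C2 ^ 2 * 2 * 2 ^ (2 + 5 * d)) * T ^ (3 + 8 * d) * (1 + |u|) ^ 3 := by gcongr
    _ = _ := by ring

lemma F2_right (χ : DirichletCharacter ℂ q) :
    ∃ C > 0, ∀ (c : ℝ), 4 ≤ c → ∀ Y : ℕ, 1 ≤ Y → ∀ s : ℂ, s.re = c → ‖F2 χ Y s‖ ≤ C * (Y:ℝ) ^ (3 - c) := by
  obtain ⟨C1, hC1, h1⟩ := tail_bound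
  obtain ⟨C2, hC2, h2⟩ := conv_chi_bound χ (e := 1) (by norm_num)
  refine ⟨C1 * C2, by positivity, fun c hc Y hY s hs => ?_⟩
  have h3 := h1 (LSeries.convolution (fun n : ℕ => χ n) (fun n : ℕ => χ n)) C2 1 c Y s hC2.le hs (by linarith) hY h2
  have hs1 : 1 < s.re := by linarith
  have hne1 : s ≠ 1 := by
    rintro rfl; simp at hs1
  rw [F2, Lt_eq χ hne1, DirichletCharacter.LFunction_eq_LSeries χ hs1]
  have hsum := DirichletCharacter.LSeriesSummable_of_one_lt_re χ hs1
  have h4 := LSeries_convolution' hsum hsum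
  rw [show (kap s * LSeries (fun n => χ n) s) ^ 2 - kap s ^ 2 * DP Y (LSeries.convolution (fun n : ℕ => χ n) (fun n : ℕ => χ n)) s =
    kap s ^ 2 * (LSeries (fun n => χ n) s * LSeries (fun n => χ n) s - DP Y (LSeries.convolution (fun n : ℕ => χ n) (fun n : ℕ => χ n)) s) by ring]
  rw [← h4, norm_mul, norm_pow]
  calc _ ≤ 1 * ‖LSeries (LSeries.convolution (fun n : ℕ => χ n) (fun n : ℕ => χ n)) s - DP Y (LSeries.convolution (fun n : ℕ => χ n) (fun n : ℕ => χ n)) s‖ := by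
        gcongr
        exact pow_le_one₀ (norm_nonneg _) (kap_le (by linarith))
    _ ≤ _ := by
      rw [one_mul]; refine h3.trans (le_of_eq ?_); congr 2; ring

lemma rpow_const_le {C θ : ℝ} (hC : 0 ≤ C) (h0 : 0 ≤ θ) (h1 : θ ≤ 1) : C ^ θ ≤ C + 1 := by
  calc C ^ θ ≤ (C + 1) ^ θ := Real.rpow_le_rpow hC (by linarith) h0
    _ ≤ (C + 1) ^ (1:ℝ) := Real.rpow_le_rpow_of_exponent_le (by linarith) h1
    _ = C + 1 := Real.rpow_one _

lemma interp_T {T C0 C1 a b θ e : ℝ} (hT : 1 ≤ T) (h0 : 0 ≤ C0) (h1 : 0 ≤ C1) (hθ0 : 0 ≤ θ) (hθ1 : θ ≤ 1)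
    (he : a * (1 - θ) + b * θ ≤ e) : (C0 * T ^ a) ^ (1 - θ) * (C1 * T ^ b) ^ θ ≤ (C0 + 1) * (C1 + 1) * T ^ e := by
  have hT0 : 0 < T := by linarith
  rw [Real.mul_rpow h0 (by positivity), Real.mul_rpow h1 (by positivity), ← Real.rpow_mul hT0.le, ← Real.rpow_mul hT0.le]
  calc _ = C0 ^ (1 - θ) * C1 ^ θ * T ^ (a * (1 - θ) + b * θ) := by rw [Real.rpow_add hT0]; ring
    _ ≤ _ := by
      have := rpow_const_le h0 (θ := 1 - θ) (by linarith) (by linarith)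
      have := rpow_const_le h1 hθ0 hθ1
      gcongr

lemma F2_mid {χ : DirichletCharacter ℂ q} (hχ : χ.IsPrimitive) {d : ℝ} (hd : 0 < d) (hd1 : d ≤ 1 / 4) :
    ∃ C > 0, ∀ (ι : Type) [Fintype ι] (t : ι → ℝ), Sep t → ∀ T : ℝ, 1 ≤ T → (∀ i, |t i| ≤ T) → ∀ Y : ℕ, 1 ≤ Y →
      T ^ (3 / 2 : ℝ) ≤ Y → (Y:ℝ) ≤ 2 * T ^ (3 / 2 : ℝ) →
      ∑ i, ‖F2 χ Y (((2 / 3 : ℝ) : ℂ) + t i * I)‖ ^ 2 ≤ C * T ^ (1 + 12 * d) := by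
  obtain ⟨C0, hC0, h0⟩ := F2_left hχ hd hd1
  obtain ⟨C1, hC1, h1⟩ := F2_right χ
  set c : ℝ := 4 + 1 / d with hc
  have hdi : 0 < 1 / d := by positivity
  obtain ⟨C, hC, h⟩ := three_lines (-d) c (by linarith) 3
  refine ⟨C * ((C0 + 1) * (4 * C1 ^ 2 + 1)), by positivity, fun ι _ t ht T hT htT Y hY1 hY hY2 => ?_⟩
  have hT0 : 0 < T := by linarith
  have h2 := h ι (fun i z => F2 χ Y (z + t i * I)) (C0 * T ^ (3 + 8 * d)) (4 * C1 ^ 2 * T ^ (10 - 3 * c)) (by positivity) (by positivity)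
    (fun i z hz _ => diff_shift (F2_diff χ Y (by simp; linarith)))
    (fun i => shift_EG (F2_EG χ Y (-d) c (by linarith)) (t i))
    (fun u => h0 ι t ht T hT htT Y hY1 hY hY2 u)
    (fun u => by
      have e1 : ∀ i, ‖F2 χ Y ((c:ℂ) + u * I + t i * I)‖ ^ 2 ≤ C1 ^ 2 * T ^ (9 - 3 * c) := by
        intro i
        have e2 := h1 c (by linarith) Y hY1 ((c:ℂ) + u * I + t i * I) (by simp)
        have e3 : (Y:ℝ) ^ (3 - c) ≤ T ^ (3 / 2 * (3 - c)) := Ypow_neg hT hY (by linarith)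
        calc _ ≤ (C1 * T ^ (3 / 2 * (3 - c))) ^ 2 := by
              gcongr; exact e2.trans (by gcongr)
          _ = C1 ^ 2 * T ^ (9 - 3 * c) := by
              rw [mul_pow, ← Real.rpow_natCast (T ^ _), ← Real.rpow_mul hT0.le]; congr 2; push_cast; ring
      refine (Finset.sum_le_sum fun i _ => e1 i).trans ?_
      rw [Finset.sum_const, Finset.card_univ, nsmul_eq_mul]
      have e4 := sep_card ht hT htT
      have e5 : T * T ^ (9 - 3 * c) = T ^ (10 - 3 * c) := by
        rw [mul_comm, ← Real.rpow_add_one hT0.ne']; congr 1; ring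
      calc _ ≤ 4 * T * (C1 ^ 2 * T ^ (9 - 3 * c)) := by gcongr
        _ = 4 * C1 ^ 2 * T ^ (10 - 3 * c) * 1 := by rw [← e5]; ring
        _ ≤ _ := by
          gcongr; exact one_le_pow₀ (by linarith [abs_nonneg u]))
    (2 / 3) (by linarith) (by linarith)
  refine h2.trans ?_
  rw [mul_assoc C]
  apply mul_le_mul_of_nonneg_left _ hC.le
  have hcd : 0 < c - -d := by linarith
  set θ := (2 / 3 - -d) / (c - -d) with hθ
  have hθ0 : 0 ≤ θ := by apply div_nonneg <;> linarith
  have hθe : θ * (c + d) = 2 / 3 + d := by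
    rw [hθ]; field_simp; ring
  have hθd : θ ≤ d := by
    rw [hθ, div_le_iff₀ hcd]
    have : d * (1 / d) = 1 := by field_simp
    nlinarith
  apply interp_T hT hC0.le (by positivity) hθ0 (by linarith)
  nlinarith

lemma fourth_23 {χ : DirichletCharacter ℂ q} (hχ : χ.IsPrimitive) {e : ℝ} (he : 0 < e) :
    ∃ C > 0, ∀ (ι : Type) [Fintype ι] (t : ι → ℝ), Sep t → ∀ T : ℝ, 1 ≤ T → (∀ i, |t i| ≤ T) →
      ∑ i, ‖Lt χ (((2 / 3 : ℝ) : ℂ) + t i * I)‖ ^ 4 ≤ C * T ^ (1 + e) := by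
  obtain ⟨d, hd, hd1, hde⟩ : ∃ d : ℝ, 0 < d ∧ d ≤ 1 / 4 ∧ 12 * d ≤ e :=
    ⟨min (1 / 4) (e / 12), by positivity, min_le_left _ _, by linarith [min_le_right (1 / 4 : ℝ) (e / 12)]⟩
  obtain ⟨C1, hC1, h1⟩ := F2_mid hχ hd hd1
  obtain ⟨C2, hC2, h2⟩ := conv_chi_bound χ hd
  obtain ⟨C3, hC3, h3⟩ := mv d hd
  refine ⟨2 * C1 + 2 * (C3 * C2 ^ 2 * (2 ^ (3 * d) * (1 + 2 ^ (2 / 3 : ℝ)))), by positivity, fun ι _ t ht T hT htT => ?_⟩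
  have hT0 : 0 < T := by linarith
  obtain ⟨Y, hY1, hY, hY2⟩ := ceil_pow (a := 3 / 2) hT (by norm_num)
  have hY0 : (0:ℝ) ≤ Y := Nat.cast_nonneg Y
  set D := LSeries.convolution (fun n : ℕ => χ n) (fun n : ℕ => χ n) with hD
  have e1 := h1 ι t ht T hT htT Y hY1 hY hY2
  have e2 := h3 ι t ht T hT htT Y hY1 D C2 (2 / 3) 1 hC2.le (by norm_num) zero_le_one
    (fun n hn => h2 n (Finset.mem_Icc.mp hn).1)
    (fun n hn _ => Real.rpow_le_one_of_one_le_of_nonpos (by exact_mod_cast (Finset.mem_Icc.mp hn).1) (by norm_num))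
  have e3 : ∀ i, ‖Lt χ (((2 / 3 : ℝ) : ℂ) + t i * I)‖ ^ 4 ≤ 2 * ‖F2 χ Y (((2 / 3 : ℝ) : ℂ) + t i * I)‖ ^ 2 +
      2 * ‖DP Y D (((2 / 3 : ℝ) : ℂ) + t i * I)‖ ^ 2 := by
    intro i
    set s := ((2 / 3 : ℝ) : ℂ) + t i * I with hs
    have : ‖Lt χ s‖ ^ 4 = ‖F2 χ Y s - (-(kap s ^ 2 * DP Y D s))‖ ^ 2 := by
      rw [F2, show ‖Lt χ s‖ ^ 4 = ‖Lt χ s ^ 2‖ ^ 2 by rw [norm_pow]; ring]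
      congr 2; ring
    rw [this]
    refine (sq_norm_sub_le _ _).trans ?_
    have h7 : ‖-(kap s ^ 2 * DP Y D s)‖ ≤ ‖DP Y D s‖ := by
      rw [norm_neg, norm_mul, norm_pow]
      apply mul_le_of_le_one_left (norm_nonneg _)
      exact pow_le_one₀ (norm_nonneg _) (kap_le (by simp [hs]; norm_num))
    gcongr
  refine (Finset.sum_le_sum fun i _ => e3 i).trans ?_
  rw [Finset.sum_add_distrib, ← Finset.mul_sum, ← Finset.mul_sum]
  have e4 : (Y:ℝ) ^ (3 * d) * (T * 1 + (Y:ℝ) ^ (2 - 2 * (2 / 3 : ℝ))) ≤ 2 ^ (3 * d) * (1 + 2 ^ (2 / 3 : ℝ)) * T ^ (1 + 12 * d) := by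
    have e5 := Ypow_pos (p := 3 * d) hT hY0 hY2 (by positivity)
    have e6 := Ypow_pos (p := 2 / 3) hT hY0 hY2 (by positivity)
    rw [show (3 / 2 * (2 / 3) : ℝ) = 1 by norm_num, Real.rpow_one] at e6
    rw [show (2 - 2 * (2 / 3 : ℝ)) = 2 / 3 by norm_num]
    calc _ ≤ (2 ^ (3 * d) * T ^ (3 / 2 * (3 * d))) * (T * 1 + 2 ^ (2 / 3 : ℝ) * T) := by gcongr
      _ = 2 ^ (3 * d) * (1 + 2 ^ (2 / 3 : ℝ)) * (T ^ (3 / 2 * (3 * d)) * T) := by ring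
      _ ≤ _ := by
        gcongr
        rw [← Real.rpow_add_one hT0.ne']
        exact rpow_le_rpow_T hT (by linarith)
  have e7 : T ^ (1 + 12 * d) ≤ T ^ (1 + e) := rpow_le_rpow_T hT (by linarith)
  rw [mul_assoc (C3 * C2 ^ 2)] at e2
  calc _ ≤ 2 * (C1 * T ^ (1 + 12 * d)) + 2 * (C3 * C2 ^ 2 * (2 ^ (3 * d) * (1 + 2 ^ (2 / 3 : ℝ)) * T ^ (1 + 12 * d))) := by
        refine add_le_add (by gcongr) ?_
        refine mul_le_mul_of_nonneg_left (e2.trans ?_) (by norm_num)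
        gcongr
    _ = (2 * C1 + 2 * (C3 * C2 ^ 2 * (2 ^ (3 * d) * (1 + 2 ^ (2 / 3 : ℝ))))) * T ^ (1 + 12 * d) := by ring
    _ ≤ _ := by gcongr

lemma kap_ge_23 (t : ℝ) : 1 / 11 ≤ ‖kap (((2 / 3 : ℝ) : ℂ) + t * I)‖ := by
  have hne : (((2 / 3 : ℝ) : ℂ) + t * I) + 3 ≠ 0 := add3_ne (by simp; norm_num)
  rw [kap, norm_div, le_div_iff₀ (norm_pos_iff.mpr hne)]
  rw [← abs_of_nonneg (norm_nonneg (((2 / 3 : ℝ) : ℂ) + t * I - 1)), ← abs_of_nonneg (show 0 ≤ 1 / 11 * ‖((2 / 3 : ℝ) : ℂ) + t * I + 3‖ by positivity), ← sq_le_sq,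
    mul_pow, Complex.sq_norm, Complex.sq_norm, normSq_apply, normSq_apply]
  simp
  nlinarith [mul_self_nonneg t]

lemma fourth_13 {χ : DirichletCharacter ℂ q} (hχ : χ.IsPrimitive) (hχ' : χ⁻¹.IsPrimitive) {e : ℝ} (he : 0 < e) :
    ∃ C > 0, ∀ (ι : Type) [Fintype ι] (t : ι → ℝ), Sep t → ∀ T : ℝ, 1 ≤ T → (∀ i, |t i| ≤ T) →
      ∑ i, ‖Lt χ (((1 / 3 : ℝ) : ℂ) + t i * I)‖ ^ 4 ≤ C * T ^ (5 / 3 + e) := by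
  obtain ⟨C1, hC1, h1⟩ := fourth_23 hχ' he
  obtain ⟨C2, hC2, h2⟩ := L_fe_bound hχ
  refine ⟨C2 ^ 2 * 2 ^ (2 / 3 : ℝ) * 11 ^ 4 * C1, by positivity, fun ι _ t ht T hT htT => ?_⟩
  have hT0 : 0 < T := by linarith
  have e1 := h1 ι (fun i => - t i) ht.neg T hT (fun i => by rw [abs_neg]; exact htT i)
  have e2 : ∀ i, ‖Lt χ (((1 / 3 : ℝ) : ℂ) + t i * I)‖ ^ 4 ≤ C2 ^ 2 * 2 ^ (2 / 3 : ℝ) * 11 ^ 4 * T ^ (2 / 3 : ℝ) *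
      ‖Lt χ⁻¹ (((2 / 3 : ℝ) : ℂ) + (-t i : ℝ) * I)‖ ^ 4 := by
    intro i
    have hne0 : (((1 / 3 : ℝ) : ℂ) + t i * I) ≠ 0 := by
      intro h; have := congrArg re h; simp at this
    have hne1 : (((1 / 3 : ℝ) : ℂ) + t i * I) ≠ 1 := by
      intro h; have := congrArg re h; norm_num at this
    have hne2 : (((2 / 3 : ℝ) : ℂ) + (-t i : ℝ) * I) ≠ 1 := by
      intro h; have := congrArg re h; norm_num at this
    have h3 := h2 (1 / 3) (t i) (by norm_num) (by norm_num) hne0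
    rw [show (1 - (((1 / 3 : ℝ) : ℂ) + t i * I)) = ((2 / 3 : ℝ) : ℂ) + (-t i : ℝ) * I by push_cast; ring] at h3
    rw [Lt_eq χ hne1, Lt_eq χ⁻¹ hne2, norm_mul, norm_mul]
    have h4 : ‖kap (((1 / 3 : ℝ) : ℂ) + t i * I)‖ ≤ 1 := kap_le (by simp; norm_num)
    have h5 := kap_ge_23 (-t i)
    set L1 := ‖χ.LFunction (((1 / 3 : ℝ) : ℂ) + t i * I)‖
    set L2 := ‖χ⁻¹.LFunction (((2 / 3 : ℝ) : ℂ) + (-t i : ℝ) * I)‖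
    have hL2 : 0 ≤ L2 := norm_nonneg _
    have hti : 1 + |t i| ≤ 2 * T := by linarith [htT i]
    have h6 : ((1 + |t i|) ^ (1 - 2 * (1 / 3 : ℝ))) ^ 2 ≤ 2 ^ (2 / 3 : ℝ) * T ^ (2 / 3 : ℝ) := by
      rw [← Real.rpow_natCast, ← Real.rpow_mul (by positivity), ← Real.mul_rpow (by norm_num) hT0.le]
      norm_num
      gcongr
    calc _ ≤ (1 * L1) ^ 4 := by gcongr
      _ = (L1 ^ 2) ^ 2 := by ring
      _ ≤ (C2 * (1 + |t i|) ^ (1 - 2 * (1 / 3 : ℝ)) * L2 ^ 2) ^ 2 := by gcongr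
      _ = C2 ^ 2 * ((1 + |t i|) ^ (1 - 2 * (1 / 3 : ℝ))) ^ 2 * 11 ^ 4 * (1 / 11 * L2) ^ 4 := by ring
      _ ≤ C2 ^ 2 * (2 ^ (2 / 3 : ℝ) * T ^ (2 / 3 : ℝ)) * 11 ^ 4 * (‖kap (((2 / 3 : ℝ) : ℂ) + (-t i : ℝ) * I)‖ * L2) ^ 4 := by
        gcongr
      _ = _ := by ring
  refine (Finset.sum_le_sum fun i _ => e2 i).trans ?_
  rw [← Finset.mul_sum]
  calc _ ≤ C2 ^ 2 * 2 ^ (2 / 3 : ℝ) * 11 ^ 4 * T ^ (2 / 3 : ℝ) * (C1 * T ^ (1 + e)) := by gcongr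
    _ = C2 ^ 2 * 2 ^ (2 / 3 : ℝ) * 11 ^ 4 * C1 * (T ^ (2 / 3 : ℝ) * T ^ (1 + e)) := by ring
    _ = _ := by rw [← Real.rpow_add hT0]; congr 2; ring

end ZD
end

section
open Complex MeasureTheory Filter Topology

namespace ZD

variable {q : ℕ} [NeZero q]

noncomputable def mob (χ : DirichletCharacter ℂ q) (X : ℕ) (n : ℕ) : ℂ :=
  if n ≤ X then χ n * ((ArithmeticFunction.moebius n : ℤ) : ℂ) else 0

noncomputable def aco (χ : DirichletCharacter ℂ q) (X : ℕ) : ℕ → ℂ := LSeries.convolution (fun n : ℕ => χ n) (mob χ X)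

noncomputable def F1 (χ : DirichletCharacter ℂ q) (X Y : ℕ) (s : ℂ) : ℂ :=
  Lt χ s * DP X (mob χ X) s - kap s * DP Y (aco χ X) s

lemma mob_le (χ : DirichletCharacter ℂ q) (X n : ℕ) : ‖mob χ X n‖ ≤ 1 := by
  unfold mob
  split_ifs
  · rw [norm_mul]
    apply mul_le_one₀ (chi_norm_le χ n) (norm_nonneg _)
    rw [Complex.norm_intCast]
    exact_mod_cast ArithmeticFunction.abs_moebius_le_one
  · simp

lemma aco_bound (χ : DirichletCharacter ℂ q) {e : ℝ} (he : 0 < e) :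
    ∃ C > 0, ∀ X n : ℕ, 1 ≤ n → ‖aco χ X n‖ ≤ C * (n:ℝ) ^ e := by
  obtain ⟨C, hC, h⟩ := conv_bound (e / 2) (by positivity)
  refine ⟨C, hC, fun X n hn => ?_⟩
  have h1 : ∀ g : ℕ → ℂ, (∀ n, ‖g n‖ ≤ 1) → ∀ n : ℕ, 1 ≤ n → ‖g n‖ ≤ 1 * (n:ℝ) ^ (e / 2) := fun g hg n hn => by
    rw [one_mul]
    exact (hg n).trans (Real.one_le_rpow (by exact_mod_cast hn) (by positivity))
  have := h (fun n : ℕ => χ n) (mob χ X) 1 1 zero_le_one zero_le_one (h1 _ (chi_norm_le χ)) (h1 _ (mob_le χ X)) n hn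
  rw [aco]
  convert this using 2
  · ring
  · congr 1; ring

lemma aco_eq (χ : DirichletCharacter ℂ q) {X n : ℕ} (hn : 1 ≤ n) (hX : n ≤ X) : aco χ X n = if n = 1 then 1 else 0 := by
  have h := congrFun (DirichletCharacter.convolution_mul_moebius χ) n
  rw [LSeries.convolution_def] at h
  rw [aco, LSeries.convolution_def]
  have h2 : (LSeries.delta n : ℂ) = if n = 1 then 1 else 0 := by rw [LSeries.delta]
  rw [← h2, ← h]
  apply Finset.sum_congr rfl
  intro p hp
  have hp1 := (Nat.mem_divisorsAntidiagonal.mp hp).1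
  have hp2 : p.2 ≤ n := Nat.le_of_dvd hn ⟨p.1, by rw [← hp1, mul_comm]⟩
  simp only [mob, Pi.mul_apply]
  rw [if_pos (hp2.trans hX)]

noncomputable def bco (χ : DirichletCharacter ℂ q) (X n : ℕ) : ℂ := if n ≤ X then 0 else aco χ X n

lemma DP_aco (χ : DirichletCharacter ℂ q) {X Y : ℕ} (hX : 1 ≤ X) (hY : 1 ≤ Y) (s : ℂ) :
    DP Y (aco χ X) s = 1 + DP Y (bco χ X) s := by
  have : DP Y (aco χ X) s - DP Y (bco χ X) s = 1 := by
    rw [DP, DP, ← Finset.sum_sub_distrib]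
    rw [Finset.sum_eq_single 1]
    · simp [bco, hX, aco_eq χ le_rfl hX]
    · intro n hn hn1
      obtain ⟨hn2, -⟩ := Finset.mem_Icc.mp hn
      by_cases h : n ≤ X
      · simp [bco, h, aco_eq χ hn2 h, hn1]
      · simp [bco, h]
    · intro h; exact absurd (Finset.mem_Icc.mpr ⟨le_rfl, hY⟩) h
  linear_combination this

lemma F1_diff (χ : DirichletCharacter ℂ q) (X Y : ℕ) {s : ℂ} (hs : -3 < s.re) : DifferentiableAt ℂ (F1 χ X Y) s := by
  unfold F1
  exact ((Lt_diff χ hs).mul (DP_diff _ _ s)).sub ((kap_diff hs).mul (DP_diff _ _ s))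

lemma F1_EG (χ : DirichletCharacter ℂ q) (X Y : ℕ) (b c : ℝ) (hb : -1 ≤ b) : EG (strip b c) (F1 χ X Y) := by
  have h1 : EG (strip b c) (Lt χ) := (Lt_EG χ c).mono fun z hz => ⟨hb.trans hz.1, hz.2⟩
  have h2 := (h1.mul (DP_EG X (mob χ X) b c)).add ((EG.const _ (-1)).mul ((kap_EG b c hb).mul (DP_EG Y (aco χ X) b c)))
  refine h2.of_le fun z _ => le_of_eq ?_
  congr 1
  rw [F1]; ring

lemma F1_zero (χ : DirichletCharacter ℂ q) {X Y : ℕ} (hX : 1 ≤ X) (hY : 1 ≤ Y) {s : ℂ} (h0 : 0 ≤ s.re) (h1 : s.re ≤ 1)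
    (hs : 10 ≤ |s.im|) (hL : χ.LFunction s = 0) (hD : ‖DP Y (bco χ X) s‖ ≤ 1 / 2) : 1 / 4 ≤ ‖F1 χ X Y s‖ := by
  have hne1 : s ≠ 1 := by rintro rfl; norm_num at hs
  have hk := kap_ge h0 h1 hs
  rw [F1, Lt_eq χ hne1, hL, mul_zero, zero_mul, zero_sub, norm_neg, norm_mul, DP_aco χ hX hY]
  have : 1 / 2 ≤ ‖1 + DP Y (bco χ X) s‖ := by
    have h2 := norm_sub_le (1 + DP Y (bco χ X) s) (DP Y (bco χ X) s)
    rw [add_sub_cancel_right, norm_one] at h2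
    linarith
  calc (1 / 4 : ℝ) = 1 / 2 * (1 / 2) := by norm_num
    _ ≤ _ := by gcongr

lemma F1_right (χ : DirichletCharacter ℂ q) :
    ∃ C > 0, ∀ (c : ℝ), 4 ≤ c → ∀ X Y : ℕ, 1 ≤ Y → ∀ s : ℂ, s.re = c → ‖F1 χ X Y s‖ ≤ C * (Y:ℝ) ^ (3 - c) := by
  obtain ⟨C1, hC1, h1⟩ := tail_bound
  obtain ⟨C2, hC2, h2⟩ := aco_bound χ (e := 1) (by norm_num)
  refine ⟨C1 * C2, by positivity, fun c hc X Y hY s hs => ?_⟩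
  have h3 := h1 (aco χ X) C2 1 c Y s hC2.le hs (by linarith) hY (h2 X)
  have hs1 : 1 < s.re := by linarith
  have hne1 : s ≠ 1 := by
    rintro rfl; simp at hs1
  rw [F1, Lt_eq χ hne1, DirichletCharacter.LFunction_eq_LSeries χ hs1]
  have hsum := DirichletCharacter.LSeriesSummable_of_one_lt_re χ hs1
  have hM := DP_hasSum X (mob χ X) (fun n hn => by simp [mob, not_le.mpr hn]) s
  have h4 := LSeries_convolution' hsum hM.LSeriesSummable
  rw [hM.LSeries_eq] at h4
  rw [show kap s * LSeries (fun n => χ n) s * DP X (mob χ X) s - kap s * DP Y (aco χ X) s =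
    kap s * (LSeries (fun n => χ n) s * DP X (mob χ X) s - DP Y (aco χ X) s) by ring]
  rw [← h4, norm_mul]
  calc _ ≤ 1 * ‖LSeries (aco χ X) s - DP Y (aco χ X) s‖ := by
        have := kap_le (s := s) (by linarith)
        rw [aco]
        gcongr
    _ ≤ _ := by
      rw [one_mul]; refine h3.trans (le_of_eq ?_); congr 2; ring

lemma pow4_sub_le (a b : ℂ) : ‖a - b‖ ^ 4 ≤ 8 * ‖a‖ ^ 4 + 8 * ‖b‖ ^ 4 := by
  have h := sq_norm_sub_le a b
  calc ‖a - b‖ ^ 4 = (‖a - b‖ ^ 2) ^ 2 := by ring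
    _ ≤ (2 * ‖a‖ ^ 2 + 2 * ‖b‖ ^ 2) ^ 2 := by gcongr
    _ ≤ _ := by nlinarith [sq_nonneg (‖a‖ ^ 2 - ‖b‖ ^ 2)]

lemma DP_mob_le (χ : DirichletCharacter ℂ q) (X : ℕ) {s : ℂ} (hs : 0 ≤ s.re) : ‖DP X (mob χ X) s‖ ≤ X := by
  rw [DP]
  refine (norm_sum_le _ _).trans ?_
  calc _ ≤ ∑ n ∈ Finset.Icc 1 X, (1:ℝ) := by
        apply Finset.sum_le_sum
        intro n hn
        have hn1 := (Finset.mem_Icc.mp hn).1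
        rw [norm_mul, norm_natCast_cpow' n hn1]
        apply mul_le_one₀ (mob_le χ X n) (by positivity)
        apply Real.rpow_le_one_of_one_le_of_nonpos (by exact_mod_cast hn1)
        simpa using hs
    _ = X := by simp

lemma DP_congr {N : ℕ} {f g : ℕ → ℂ} (h : ∀ n ∈ Finset.Icc 1 N, f n = g n) (s : ℂ) : DP N f s = DP N g s := by
  rw [DP, DP]
  exact Finset.sum_congr rfl fun n hn => by rw [h n hn]

lemma A4 (χ : DirichletCharacter ℂ q) {d : ℝ} (hd : 0 < d) :
    ∃ C > 0, ∀ (ι : Type) [Fintype ι] (t : ι → ℝ), Sep t → ∀ T : ℝ, 1 ≤ T → (∀ i, |t i| ≤ T) → ∀ X Y : ℕ, 1 ≤ Y →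
      ∑ i, ‖DP Y (aco χ X) (((1 / 3 : ℝ) : ℂ) + t i * I)‖ ^ 4 ≤
        C * (Y:ℝ) ^ (6 * d) * (T * (Y:ℝ) ^ (2 / 3 : ℝ) + (Y:ℝ) ^ (8 / 3 : ℝ)) := by
  obtain ⟨e', he', hee, C1, hC1, h1⟩ := cpw_bound 2 d hd
  obtain ⟨C2, hC2, h2⟩ := aco_bound χ he'
  obtain ⟨C3, hC3, h3⟩ := mv d hd
  refine ⟨C3 * (C1 * C2 ^ 2) ^ 2, by positivity, fun ι _ t ht T hT htT X Y hY => ?_⟩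
  set f : ℕ → ℂ := fun n => if n ≤ Y then aco χ X n else 0 with hf
  have hf0 : ∀ n, Y < n → f n = 0 := fun n hn => by simp [hf, not_le.mpr hn]
  have hfb : ∀ n : ℕ, 1 ≤ n → ‖f n‖ ≤ C2 * (n:ℝ) ^ e' := by
    intro n hn
    by_cases h : n ≤ Y
    · simp only [hf, h, if_true]; exact h2 X n hn
    · simp only [hf, h, if_false, norm_zero]; positivity
  have e1 := h3 ι t ht T hT htT (Y ^ 2) (Nat.one_le_pow _ _ hY) (cpw f 2) (C1 * C2 ^ 2) (1 / 3) ((Y:ℝ) ^ (2 / 3 : ℝ))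
    (by positivity) (by norm_num) (by positivity)
    (fun n hn => h1 f C2 hC2.le hfb n (Finset.mem_Icc.mp hn).1)
    (fun n hn _ => by
      obtain ⟨hn1, hn2⟩ := Finset.mem_Icc.mp hn
      have hn3 : (n:ℝ) ≤ (Y:ℝ) ^ 2 := by exact_mod_cast hn2
      calc (n:ℝ) ^ (1 - 2 * (1 / 3) : ℝ) ≤ ((Y:ℝ) ^ 2) ^ (1 - 2 * (1 / 3) : ℝ) := by gcongr
        _ = _ := by rw [← Real.rpow_natCast, ← Real.rpow_mul (by positivity)]; norm_num)
  have e2 : ∀ s, ‖DP Y (aco χ X) s‖ ^ 4 = ‖DP (Y ^ 2) (cpw f 2) s‖ ^ 2 := by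
    intro s
    rw [← DP_pow Y f hf0 2 s, DP_congr (f := aco χ X) (g := f) (fun n hn => by simp [hf, (Finset.mem_Icc.mp hn).2]), norm_pow]
    ring
  simp_rw [e2]
  refine e1.trans (le_of_eq ?_)
  have hp : ∀ x : ℝ, (((Y ^ 2 : ℕ) : ℝ)) ^ x = (Y:ℝ) ^ (2 * x) := by
    intro x
    rw [Nat.cast_pow, ← Real.rpow_natCast, ← Real.rpow_mul (by positivity)]; norm_num
  rw [hp, hp, show 2 * (3 * d) = 6 * d by ring, show (2 * (2 - 2 * (1 / 3)) : ℝ) = 8 / 3 by norm_num]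

lemma F1_left {χ : DirichletCharacter ℂ q} (hχ : χ.IsPrimitive) (hχ' : χ⁻¹.IsPrimitive) {d : ℝ} (hd : 0 < d) (hd1 : d ≤ 1) :
    ∃ C > 0, ∀ (ι : Type) [Fintype ι] (t : ι → ℝ), Sep t → ∀ T : ℝ, 1 ≤ T → (∀ i, |t i| ≤ 5 * T) → ∀ X Y : ℕ, 1 ≤ Y →
      (X:ℝ) ≤ 2 * T ^ d → (Y:ℝ) ≤ 2 * T ^ (5 / 8 : ℝ) → ∀ u : ℝ,
      ∑ i, ‖F1 χ X Y (((1 / 3 : ℝ) : ℂ) + u * I + t i * I) ^ 2‖ ^ 2 ≤ C * T ^ (5 / 3 + 5 * d) * (1 + |u|) ^ 3 := by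
  obtain ⟨C1, hC1, h1⟩ := fourth_13 hχ hχ' hd
  obtain ⟨C2, hC2, h2⟩ := A4 χ hd
  refine ⟨8 * (16 * C1 * 5 ^ 3) + 8 * (C2 * 2 ^ (6 * d) * (5 * (2 ^ (2 / 3 : ℝ) + 2 ^ (8 / 3 : ℝ)))), by positivity,
    fun ι _ t ht T hT htT X Y hY1 hX hY u => ?_⟩
  have hT0 : 0 < T := by linarith
  have hu := abs_nonneg u
  have hY0 : (0:ℝ) ≤ Y := Nat.cast_nonneg Y
  set S := 5 * T * (1 + |u|) with hS
  have hS1 : 1 ≤ S := by nlinarith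
  have htS : ∀ i, |t i + u| ≤ S := fun i => by
    have := abs_add_le (t i) u
    have := htT i
    nlinarith
  have a1 := h1 ι (fun i => t i + u) (ht.shift u) S hS1 htS
  have a2 := h2 ι (fun i => t i + u) (ht.shift u) S hS1 htS X Y hY1
  have e1 : ∀ i, ‖F1 χ X Y (((1 / 3 : ℝ) : ℂ) + u * I + t i * I) ^ 2‖ ^ 2 ≤
      8 * (16 * T ^ (4 * d)) * ‖Lt χ (((1 / 3 : ℝ) : ℂ) + (t i + u : ℝ) * I)‖ ^ 4 +
      8 * ‖DP Y (aco χ X) (((1 / 3 : ℝ) : ℂ) + (t i + u : ℝ) * I)‖ ^ 4 := by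
    intro i
    have es : (((1 / 3 : ℝ) : ℂ) + u * I + t i * I) = ((1 / 3 : ℝ) : ℂ) + (t i + u : ℝ) * I := by push_cast; ring
    rw [es]
    set s := ((1 / 3 : ℝ) : ℂ) + (t i + u : ℝ) * I with hs
    have hsre : s.re = 1 / 3 := by simp [hs]
    rw [norm_pow, ← pow_mul, F1]
    refine (pow4_sub_le _ _).trans ?_
    rw [norm_mul, norm_mul]
    have m1 : ‖DP X (mob χ X) s‖ ≤ 2 * T ^ d := (DP_mob_le χ X (by linarith)).trans hX
    have m2 : ‖kap s‖ ≤ 1 := kap_le (by linarith)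
    have m3 : (T ^ d) ^ 4 = T ^ (4 * d) := by
      rw [← Real.rpow_natCast, ← Real.rpow_mul hT0.le]; congr 1; push_cast; ring
    calc _ ≤ 8 * (‖Lt χ s‖ * (2 * T ^ d)) ^ 4 + 8 * (1 * ‖DP Y (aco χ X) s‖) ^ 4 := by gcongr
      _ = _ := by rw [← m3]; ring
  refine (Finset.sum_le_sum fun i _ => e1 i).trans ?_
  rw [Finset.sum_add_distrib, ← Finset.mul_sum, ← Finset.mul_sum]
  have b1 : S ^ (5 / 3 + d) ≤ 5 ^ 3 * (1 + |u|) ^ 3 * T ^ (5 / 3 + d) := by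
    rw [hS, show 5 * T * (1 + |u|) = (5 * (1 + |u|)) * T by ring, Real.mul_rpow (by positivity) hT0.le]
    gcongr
    calc _ ≤ (5 * (1 + |u|)) ^ ((3:ℕ):ℝ) := Real.rpow_le_rpow_of_exponent_le (by linarith) (by push_cast; linarith)
      _ = _ := by rw [Real.rpow_natCast]; ring
  have b2 : (Y:ℝ) ^ (6 * d) * (S * (Y:ℝ) ^ (2 / 3 : ℝ) + (Y:ℝ) ^ (8 / 3 : ℝ)) ≤
      2 ^ (6 * d) * (5 * (2 ^ (2 / 3 : ℝ) + 2 ^ (8 / 3 : ℝ))) * T ^ (5 / 3 + 5 * d) * (1 + |u|) ^ 3 := by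
    have c1 := Ypow_pos (p := 6 * d) hT hY0 hY (by positivity)
    have c2 := Ypow_pos (p := 2 / 3) hT hY0 hY (by positivity)
    have c3 := Ypow_pos (p := 8 / 3) hT hY0 hY (by positivity)
    have c4 : S * (Y:ℝ) ^ (2 / 3 : ℝ) ≤ 5 * (1 + |u|) * (2 ^ (2 / 3 : ℝ) * T ^ (5 / 3 : ℝ)) := by
      calc _ ≤ S * (2 ^ (2 / 3 : ℝ) * T ^ (5 / 8 * (2 / 3) : ℝ)) := by gcongr
        _ = 5 * (1 + |u|) * (2 ^ (2 / 3 : ℝ) * (T ^ (5 / 8 * (2 / 3) : ℝ) * T)) := by rw [hS]; ring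
        _ ≤ _ := by
          rw [← Real.rpow_add_one hT0.ne']
          gcongr; norm_num
    have c5 : (Y:ℝ) ^ (8 / 3 : ℝ) ≤ 5 * (1 + |u|) * (2 ^ (8 / 3 : ℝ) * T ^ (5 / 3 : ℝ)) := by
      rw [show (5 / 8 * (8 / 3) : ℝ) = 5 / 3 by norm_num] at c3
      refine c3.trans (le_mul_of_one_le_left (by positivity) (by linarith))
    calc _ ≤ (2 ^ (6 * d) * T ^ (5 / 8 * (6 * d))) * (5 * (1 + |u|) * (2 ^ (2 / 3 : ℝ) * T ^ (5 / 3 : ℝ)) + 5 * (1 + |u|) * (2 ^ (8 / 3 : ℝ) * T ^ (5 / 3 : ℝ))) := by gcongr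
      _ = 2 ^ (6 * d) * (5 * (2 ^ (2 / 3 : ℝ) + 2 ^ (8 / 3 : ℝ))) * (T ^ (5 / 8 * (6 * d)) * T ^ (5 / 3 : ℝ)) * (1 + |u|) := by ring
      _ ≤ _ := by
        rw [← Real.rpow_add hT0]
        have : T ^ (5 / 8 * (6 * d) + 5 / 3) ≤ T ^ (5 / 3 + 5 * d) := rpow_le_rpow_T hT (by linarith)
        have h6 : (1 + |u|) ≤ (1 + |u|) ^ 3 := le_self_pow₀ (by linarith) (by norm_num)
        gcongr
  have b3 : T ^ (4 * d) * T ^ (5 / 3 + d) = T ^ (5 / 3 + 5 * d) := by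
    rw [← Real.rpow_add hT0]; congr 1; ring
  rw [mul_assoc C2] at a2
  calc _ ≤ 8 * (16 * T ^ (4 * d)) * (C1 * (5 ^ 3 * (1 + |u|) ^ 3 * T ^ (5 / 3 + d))) + 8 * (C2 * (2 ^ (6 * d) * (5 * (2 ^ (2 / 3 : ℝ) + 2 ^ (8 / 3 : ℝ))) * T ^ (5 / 3 + 5 * d) * (1 + |u|) ^ 3)) := by
        refine add_le_add ?_ ?_
        · refine mul_le_mul_of_nonneg_left (a1.trans ?_) (by positivity)
          gcongr
        · refine mul_le_mul_of_nonneg_left (a2.trans ?_) (by positivity)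
          gcongr
    _ = (8 * (16 * C1 * 5 ^ 3)) * (T ^ (4 * d) * T ^ (5 / 3 + d)) * (1 + |u|) ^ 3 + 8 * (C2 * 2 ^ (6 * d) * (5 * (2 ^ (2 / 3 : ℝ) + 2 ^ (8 / 3 : ℝ)))) * T ^ (5 / 3 + 5 * d) * (1 + |u|) ^ 3 := by ring
    _ = _ := by rw [b3]; ring

lemma F1_mid {χ : DirichletCharacter ℂ q} (hχ : χ.IsPrimitive) (hχ' : χ⁻¹.IsPrimitive) {d : ℝ} (hd : 0 < d) (hd1 : d ≤ 1) :
    ∃ C > 0, ∀ (ι : Type) [Fintype ι] (t : ι → ℝ), Sep t → ∀ T : ℝ, 1 ≤ T → (∀ i, |t i| ≤ 5 * T) → ∀ X Y : ℕ, 1 ≤ Y →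
      (X:ℝ) ≤ 2 * T ^ d → T ^ (5 / 8 : ℝ) ≤ Y → (Y:ℝ) ≤ 2 * T ^ (5 / 8 : ℝ) → ∀ x : ℝ, 1 / 3 ≤ x → x ≤ 4 →
      ∑ i, ‖F1 χ X Y ((x : ℂ) + t i * I) ^ 2‖ ^ 2 ≤ C * T ^ (5 / 2 * (1 - x) + 11 * d) := by
  obtain ⟨C0, hC0, h0⟩ := F1_left hχ hχ' hd hd1
  obtain ⟨C1, hC1, h1⟩ := F1_right χ
  set c : ℝ := 5 + 4 / d with hc
  have hdi : 0 < 4 / d := by positivity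
  obtain ⟨C, hC, h⟩ := three_lines (1 / 3) c (by linarith) 3
  refine ⟨C * ((C0 + 1) * (20 * C1 ^ 4 + 1)), by positivity, fun ι _ t ht T hT htT X Y hY1 hX hY hY2 x hx1 hx2 => ?_⟩
  have hT0 : 0 < T := by linarith
  have h2 := h ι (fun i z => F1 χ X Y (z + t i * I) ^ 2) (C0 * T ^ (5 / 3 + 5 * d)) (20 * C1 ^ 4 * T ^ (17 / 2 - 5 / 2 * c)) (by positivity) (by positivity)
    (fun i z hz _ => diff_shift (F := fun s => F1 χ X Y s ^ 2) ((F1_diff χ X Y (by simp; linarith)).pow 2))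
    (fun i => by
      have := (F1_EG χ X Y (1 / 3) c (by linarith))
      exact shift_EG (F := fun s => F1 χ X Y s ^ 2) ((this.mul this).of_le fun z _ => le_of_eq (by rw [sq])) (t i))
    (fun u => h0 ι t ht T hT htT X Y hY1 hX hY2 u)
    (fun u => by
      have e1 : ∀ i, ‖F1 χ X Y ((c:ℂ) + u * I + t i * I) ^ 2‖ ^ 2 ≤ C1 ^ 4 * T ^ (15 / 2 - 5 / 2 * c) := by
        intro i
        have e2 := h1 c (by linarith) X Y hY1 ((c:ℂ) + u * I + t i * I) (by simp)
        have e3 : (Y:ℝ) ^ (3 - c) ≤ T ^ (5 / 8 * (3 - c)) := Ypow_neg hT hY (by linarith)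
        rw [norm_pow, ← pow_mul]
        calc _ ≤ (C1 * T ^ (5 / 8 * (3 - c))) ^ (2 * 2) := by
              gcongr; exact e2.trans (by gcongr)
          _ = C1 ^ 4 * T ^ (15 / 2 - 5 / 2 * c) := by
              rw [mul_pow, ← Real.rpow_natCast (T ^ _), ← Real.rpow_mul hT0.le]; norm_num; left; congr 1; ring
      refine (Finset.sum_le_sum fun i _ => e1 i).trans ?_
      rw [Finset.sum_const, Finset.card_univ, nsmul_eq_mul]
      have e4 := sep_card ht (T := 5 * T) (by linarith) htT
      have e5 : T * T ^ (15 / 2 - 5 / 2 * c) = T ^ (17 / 2 - 5 / 2 * c) := by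
        rw [mul_comm, ← Real.rpow_add_one hT0.ne']; congr 1; ring
      calc _ ≤ 4 * (5 * T) * (C1 ^ 4 * T ^ (15 / 2 - 5 / 2 * c)) := by gcongr
        _ = 20 * C1 ^ 4 * T ^ (17 / 2 - 5 / 2 * c) * 1 := by rw [← e5]; ring
        _ ≤ _ := by
          gcongr; exact one_le_pow₀ (by linarith [abs_nonneg u]))
    x hx1 (by linarith)
  refine h2.trans ?_
  rw [mul_assoc C]
  apply mul_le_mul_of_nonneg_left _ hC.le
  have hcd : 0 < c - 1 / 3 := by linarith
  set θ := (x - 1 / 3) / (c - 1 / 3) with hθ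
  have hθ0 : 0 ≤ θ := by apply div_nonneg <;> linarith
  have hθe : θ * (c - 1 / 3) = x - 1 / 3 := by
    rw [hθ, div_mul_cancel₀ _ hcd.ne']
  have hθd : θ ≤ d := by
    rw [hθ, div_le_iff₀ hcd]
    have : d * (4 / d) = 4 := by field_simp
    nlinarith
  apply interp_T hT hC0.le (by positivity) hθ0 (by linarith)
  nlinarith [mul_nonneg hθ0 hd.le]

lemma classII {χ : DirichletCharacter ℂ q} (hχ : χ.IsPrimitive) (hχ' : χ⁻¹.IsPrimitive) {σ d : ℝ} (hσ : 1 / 2 ≤ σ) (hσ1 : σ ≤ 1)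
    (hd : 0 < d) (hd1 : d ≤ 1 / 12) :
    ∃ C > 0, ∀ (ι : Type) [Fintype ι] (t x : ι → ℝ), Sep t → ∀ T : ℝ, 1 ≤ T → (∀ i, |t i| ≤ T) → ∀ X Y : ℕ, 1 ≤ Y →
      (X:ℝ) ≤ 2 * T ^ d → T ^ (5 / 8 : ℝ) ≤ Y → (Y:ℝ) ≤ 2 * T ^ (5 / 8 : ℝ) → (∀ i, σ ≤ x i) → (∀ i, x i ≤ 1) →
      (∀ i, 1 / 4 ≤ ‖F1 χ X Y ((x i : ℂ) + t i * I)‖) → (Fintype.card ι : ℝ) ≤ C * T ^ (5 / 2 * (1 - σ) + 16 * d) := by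
  obtain ⟨C, hC, h⟩ := F1_mid hχ hχ' hd (by linarith)
  refine ⟨4 ^ 4 * (((2 - σ + 2 * d) / (2 * d)) ^ 2 * C), ?_, fun ι _ t x ht T hT htT X Y hY1 hX hY hY2 hx1 hx2 hF => ?_⟩
  · have : 0 < 2 - σ + 2 * d := by linarith
    positivity
  have hT0 : 0 < T := by linarith
  have h1 := sampling (fun i z => F1 χ X Y (z + t i * I) ^ 2) 2 (2 - σ + 2 * d) (2 * d) (C * T ^ (5 / 2 * (1 - σ) + 16 * d))
    (by positivity) (fun i => (x i : ℂ))
    (fun i => by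
      rw [show ((x i : ℂ) - 2) = ((x i - 2 : ℝ) : ℂ) by push_cast; ring, Complex.norm_real, Real.norm_eq_abs, abs_le]
      constructor <;> linarith [hx1 i, hx2 i]) (by linarith)
    (fun i z hz => by
      apply diff_shift (F := fun s => F1 χ X Y s ^ 2)
      apply (F1_diff χ X Y _).pow 2
      have := abs_re_le_norm (z - 2)
      rw [Metric.mem_closedBall, dist_eq_norm] at hz
      have h3 := (abs_le.mp (this.trans hz)).1
      simp at h3 ⊢
      linarith)
    (fun z hz => by
      rw [Metric.mem_sphere, dist_eq_norm] at hz
      have h3 := abs_le.mp ((abs_re_le_norm (z - 2)).trans hz.le)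
      have h4 := abs_le.mp ((abs_im_le_norm (z - 2)).trans hz.le)
      simp at h3 h4
      have h5 := h ι (fun i => t i + z.im) (ht.shift _) T hT (fun i => by
        have := abs_le.mp (htT i)
        rw [abs_le]
        constructor <;> linarith) X Y hY1 hX hY hY2 z.re (by linarith) (by linarith)
      have h6 : ∀ i, ((z.re : ℂ) + (t i + z.im : ℝ) * I) = z + t i * I := by
        intro i
        conv_rhs => rw [← re_add_im z]
        push_cast; ring
      simp_rw [h6] at h5
      refine h5.trans ?_
      exact mul_le_mul_of_nonneg_left (rpow_le_rpow_T hT (by linarith)) hC.le)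
  have h2 : (Fintype.card ι : ℝ) * (1 / 4) ^ 4 ≤ ∑ i, ‖F1 χ X Y ((x i : ℂ) + t i * I) ^ 2‖ ^ 2 := by
    rw [← nsmul_eq_mul, ← Finset.card_univ, ← Finset.sum_const]
    apply Finset.sum_le_sum
    intro i _
    rw [norm_pow, ← pow_mul]
    gcongr
    exact hF i
  have h3 := h2.trans h1
  nlinarith

end ZD
end

section
open Complex MeasureTheory Filter Topology

namespace ZD

lemma sample_DP {σ d : ℝ} (hσ1 : σ ≤ 1) (hd : 0 < d) {ι : Type} [Fintype ι] {t x : ι → ℝ} (ht : Sep t) {T : ℝ} (hT : 1 ≤ T)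
    (hd1 : d ≤ 1 / 12) (hσ0 : 1 / 2 ≤ σ)
    (htT : ∀ i, |t i| ≤ T) (hx1 : ∀ i, σ ≤ x i) (hx2 : ∀ i, x i ≤ 1) (P : ℕ) (h : ℕ → ℂ) (W B : ℝ) (hW : 0 ≤ W)
    (hWi : ∀ i, W ≤ ‖DP P h ((x i : ℂ) + t i * I)‖)
    (hB : ∀ g : ℕ → ℂ, (∀ n ∈ Finset.Icc 1 P, ‖g n‖ ≤ ‖h n‖) → ∀ y : ι → ℝ, Sep y → (∀ i, |y i| ≤ 5 * T) →
      ∑ i, ‖DP P g (((σ - 2 * d : ℝ) : ℂ) + y i * I)‖ ^ 2 ≤ B) :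
    (Fintype.card ι : ℝ) * W ^ 2 ≤ (2 / d) ^ 2 * B := by
  have hB0 : 0 ≤ B := le_trans (Finset.sum_nonneg fun i _ => by positivity)
    (hB h (fun n _ => le_rfl) t ht (fun i => by linarith [htT i]))
  have h1 := sampling (fun i z => DP P h (z + t i * I)) 2 (2 - σ + 2 * d) (2 * d) B
    (by positivity) (fun i => (x i : ℂ))
    (fun i => by
      rw [show ((x i : ℂ) - 2) = ((x i - 2 : ℝ) : ℂ) by push_cast; ring, Complex.norm_real, Real.norm_eq_abs, abs_le]
      constructor <;> linarith [hx1 i, hx2 i]) (by linarith)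
    (fun i z hz => diff_shift (DP_diff P h _))
    (fun z hz => by
      rw [Metric.mem_sphere, dist_eq_norm] at hz
      have h3 := abs_le.mp ((abs_re_le_norm (z - 2)).trans hz.le)
      have h4 := abs_le.mp ((abs_im_le_norm (z - 2)).trans hz.le)
      simp at h3 h4
      have h5 := hB (fun n => h n * (n:ℂ) ^ (-((z.re - (σ - 2 * d) : ℝ) : ℂ)))
        (fun n hn => by
          have hn1 := (Finset.mem_Icc.mp hn).1
          rw [norm_mul, norm_natCast_cpow' n hn1]
          apply mul_le_of_le_one_right (norm_nonneg _)
          apply Real.rpow_le_one_of_one_le_of_nonpos (by exact_mod_cast hn1)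
          rw [neg_re, ofReal_re]; linarith)
        (fun i => t i + z.im) (ht.shift _) (fun i => by
        have := abs_le.mp (htT i)
        rw [abs_le]
        constructor <;> linarith)
      have h6 : ∀ i, DP P (fun n => h n * (n:ℂ) ^ (-((z.re - (σ - 2 * d) : ℝ) : ℂ))) (((σ - 2 * d : ℝ) : ℂ) + (t i + z.im : ℝ) * I) = DP P h (z + t i * I) := by
        intro i
        rw [← DP_shift]
        congr 1
        conv_rhs => rw [← re_add_im z]
        push_cast; ring
      simp_rw [h6] at h5
      exact h5)
  have h2 : (Fintype.card ι : ℝ) * W ^ 2 ≤ ∑ i, ‖DP P h ((x i : ℂ) + t i * I)‖ ^ 2 := by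
    rw [← nsmul_eq_mul, ← Finset.card_univ, ← Finset.sum_const]
    apply Finset.sum_le_sum
    intro i _
    gcongr
    exact hWi i
  refine (h2.trans h1).trans ?_
  apply mul_le_mul_of_nonneg_right _ hB0
  have : (2 - σ + 2 * d) / (2 * d) ≤ 2 / d := by
    rw [div_le_div_iff₀ (by positivity) hd]
    nlinarith
  have h0 : 0 ≤ (2 - σ + 2 * d) / (2 * d) := by
    apply div_nonneg <;> linarith
  gcongr

lemma dens_mv {σ d e : ℝ} (hσ1 : σ ≤ 1) (hd : 0 < d) (hd1 : d ≤ 1 / 12) (hσ0 : 1 / 2 ≤ σ - 2 * d) (he : 0 < e) :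
    ∃ C > 0, ∀ (ι : Type) [Fintype ι] (t x : ι → ℝ), Sep t → ∀ T : ℝ, 1 ≤ T → (∀ i, |t i| ≤ T) →
      (∀ i, σ ≤ x i) → (∀ i, x i ≤ 1) → ∀ (P : ℕ) (h : ℕ → ℂ) (W M A : ℝ), 1 ≤ P → 0 ≤ W → 0 ≤ A → 0 < M →
      (∀ i, W ≤ ‖DP P h ((x i : ℂ) + t i * I)‖) → (∀ n ∈ Finset.Icc 1 P, ‖h n‖ ≤ A * (n:ℝ) ^ e) →
      (∀ n ∈ Finset.Icc 1 P, h n ≠ 0 → M ≤ n) →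
      (Fintype.card ι : ℝ) * W ^ 2 ≤ C * A ^ 2 * (P:ℝ) ^ (3 * e) * (T * M ^ (1 - 2 * (σ - 2 * d)) + (P:ℝ) ^ (2 - 2 * (σ - 2 * d))) := by
  obtain ⟨C, hC, hmv⟩ := mv e he
  refine ⟨(2 / d) ^ 2 * (C * 5), by positivity, fun ι _ t x ht T hT htT hx1 hx2 P h W M A hP hW hA hM hWi hh hs => ?_⟩
  have := sample_DP hσ1 hd ht hT hd1 (by linarith) htT hx1 hx2 P h W
    (C * A ^ 2 * (P:ℝ) ^ (3 * e) * (5 * T * M ^ (1 - 2 * (σ - 2 * d)) + (P:ℝ) ^ (2 - 2 * (σ - 2 * d)))) hW hWi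
    (fun g hg y hy hyT => hmv ι y hy (5 * T) (by linarith) hyT P hP g A (σ - 2 * d) (M ^ (1 - 2 * (σ - 2 * d))) hA (by linarith) (by positivity)
      (fun n hn => (hg n hn).trans (hh n hn))
      (fun n hn hgn => by
        have hn0 : h n ≠ 0 := by
          intro h0
          have := hg n hn
          rw [h0, norm_zero] at this
          exact hgn (norm_le_zero_iff.mp this)
        exact Real.rpow_le_rpow_of_nonpos hM (hs n hn hn0) (by linarith)))
  refine this.trans ?_
  have h2 : 5 * T * M ^ (1 - 2 * (σ - 2 * d)) + (P:ℝ) ^ (2 - 2 * (σ - 2 * d)) ≤ 5 * (T * M ^ (1 - 2 * (σ - 2 * d)) + (P:ℝ) ^ (2 - 2 * (σ - 2 * d))) := by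
    have : 0 ≤ (P:ℝ) ^ (2 - 2 * (σ - 2 * d)) := by positivity
    linarith
  calc _ ≤ (2 / d) ^ 2 * (C * A ^ 2 * (P:ℝ) ^ (3 * e) * (5 * (T * M ^ (1 - 2 * (σ - 2 * d)) + (P:ℝ) ^ (2 - 2 * (σ - 2 * d))))) := by gcongr
    _ = _ := by ring

lemma dens_hal {σ d e : ℝ} (hσ1 : σ ≤ 1) (hd : 0 < d) (hd1 : d ≤ 1 / 12) (hσ0 : 1 / 2 ≤ σ - 2 * d) (he : 0 < e) (he1 : e < 1) :
    ∃ C > 0, ∀ (ι : Type) [Fintype ι] (t x : ι → ℝ), Sep t → ∀ T : ℝ, 1 ≤ T → (∀ i, |t i| ≤ T) →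
      (∀ i, σ ≤ x i) → (∀ i, x i ≤ 1) → ∀ (P : ℕ) (h : ℕ → ℂ) (W M A : ℝ), 1 ≤ P → 0 ≤ W → 0 ≤ A → 0 < M →
      (∀ i, W ≤ ‖DP P h ((x i : ℂ) + t i * I)‖) → (∀ n ∈ Finset.Icc 1 P, ‖h n‖ ≤ A * (n:ℝ) ^ e) →
      (∀ n ∈ Finset.Icc 1 P, h n ≠ 0 → M ≤ n) →
      (Fintype.card ι : ℝ) * W ^ 2 ≤ C * A ^ 2 * (P:ℝ) ^ (2 * e) * (P / M) * (P + Fintype.card ι * T ^ (1 / 2 + e)) * (P * M ^ (-2 * (σ - 2 * d))) := by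
  obtain ⟨C, hC, hal⟩ := halasz e he he1
  refine ⟨(2 / d) ^ 2 * (C * 5 ^ (1 / 2 + e)), by positivity, fun ι _ t x ht T hT htT hx1 hx2 P h W M A hP hW hA hM hWi hh hs => ?_⟩
  set R : ℝ := ((Fintype.card ι : ℕ) : ℝ) with hR
  have hR0 : 0 ≤ R := Nat.cast_nonneg _
  have hT0 : 0 < T := by linarith
  have hP0 : (0:ℝ) < P := by exact_mod_cast hP
  have := sample_DP hσ1 hd ht hT hd1 (by linarith) htT hx1 hx2 P h W
    (C * (P / M) * (P + R * (5 * T) ^ (1 / 2 + e)) * (P * (A ^ 2 * (P:ℝ) ^ (2 * e) * M ^ (-2 * (σ - 2 * d))))) hW hWi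
    (fun g hg y hy hyT => by
      have hne : ∀ n ∈ Finset.Icc 1 P, g n ≠ 0 → M ≤ n := fun n hn hgn => by
        apply hs n hn
        intro h0
        have := hg n hn
        rw [h0, norm_zero] at this
        exact hgn (norm_le_zero_iff.mp this)
      have h1 := hal ι y hy (5 * T) (by linarith) hyT P hP (fun n => g n * (n:ℂ) ^ (-((σ - 2 * d : ℝ) : ℂ))) M hM
        (fun n hn hgn => hne n hn (left_ne_zero_of_mul hgn))
      simp_rw [← DP_shift] at h1
      refine h1.trans ?_
      have h2 : ∑ n ∈ Finset.Icc 1 P, ‖g n * (n:ℂ) ^ (-((σ - 2 * d : ℝ) : ℂ))‖ ^ 2 ≤ P * (A ^ 2 * (P:ℝ) ^ (2 * e) * M ^ (-2 * (σ - 2 * d))) := by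
        calc _ ≤ ∑ n ∈ Finset.Icc 1 P, (A ^ 2 * (P:ℝ) ^ (2 * e) * M ^ (-2 * (σ - 2 * d))) := by
              apply Finset.sum_le_sum
              intro n hn
              obtain ⟨hn1, hn2⟩ := Finset.mem_Icc.mp hn
              have hnP : (n:ℝ) ≤ P := by exact_mod_cast hn2
              have hn0 : (0:ℝ) < n := by exact_mod_cast hn1
              by_cases hg0 : g n = 0
              · rw [hg0]; simp; positivity
              rw [norm_mul, norm_natCast_cpow' n hn1, mul_pow]
              have e1 : ‖g n‖ ^ 2 ≤ A ^ 2 * (P:ℝ) ^ (2 * e) := by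
                calc _ ≤ (A * (P:ℝ) ^ e) ^ 2 := by
                      gcongr
                      exact ((hg n hn).trans (hh n hn)).trans (by gcongr)
                  _ = _ := by rw [mul_pow, ← Real.rpow_natCast ((P:ℝ) ^ e), ← Real.rpow_mul hP0.le]; congr 2; push_cast; ring
              have e2 : ((n:ℝ) ^ (-((σ - 2 * d : ℝ) : ℂ)).re) ^ 2 ≤ M ^ (-2 * (σ - 2 * d)) := by
                rw [neg_re, ofReal_re, ← Real.rpow_natCast, ← Real.rpow_mul hn0.le]
                rw [show -(σ - 2 * d) * ((2:ℕ):ℝ) = -2 * (σ - 2 * d) by push_cast; ring]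
                exact Real.rpow_le_rpow_of_nonpos hM (hne n hn hg0) (by linarith)
              gcongr
          _ = _ := by simp
      gcongr)
  refine this.trans ?_
  have h2 : P + R * (5 * T) ^ (1 / 2 + e) ≤ 5 ^ (1 / 2 + e) * (P + R * T ^ (1 / 2 + e)) := by
    rw [Real.mul_rpow (by norm_num) hT0.le]
    have : (P:ℝ) ≤ 5 ^ (1 / 2 + e) * P := le_mul_of_one_le_left hP0.le (Real.one_le_rpow (by norm_num) (by positivity))
    linarith
  calc _ ≤ (2 / d) ^ 2 * (C * (P / M) * (5 ^ (1 / 2 + e) * (P + R * T ^ (1 / 2 + e))) * (P * (A ^ 2 * (P:ℝ) ^ (2 * e) * M ^ (-2 * (σ - 2 * d))))) := by gcongr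
    _ = _ := by ring

lemma cpw_bound_unif (K : ℕ) {e : ℝ} (he : 0 < e) : ∃ e' : ℝ, 0 < e' ∧ ∃ C : ℝ, 1 ≤ C ∧ ∀ k ≤ K, ∀ (f : ℕ → ℂ) (A : ℝ), 0 ≤ A →
    (∀ n : ℕ, n ≥ 1 → ‖f n‖ ≤ A * (n:ℝ) ^ e') → ∀ n : ℕ, n ≥ 1 → ‖cpw f k n‖ ≤ C * A ^ k * (n:ℝ) ^ e := by
  induction K with
  | zero =>
    obtain ⟨e', he', _, C, hC, h⟩ := cpw_bound 0 e he
    refine ⟨e', he', C + 1, by linarith, fun k hk f A hA hf n hn => ?_⟩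
    obtain rfl : k = 0 := by omega
    refine (h f A hA hf n hn).trans ?_
    gcongr; linarith
  | succ K ih =>
    obtain ⟨e1, he1, C1, hC1, h1⟩ := ih
    obtain ⟨e2, he2, _, C2, hC2, h2⟩ := cpw_bound (K + 1) e he
    refine ⟨min e1 e2, lt_min he1 he2, C1 + C2, by linarith, fun k hk f A hA hf n hn => ?_⟩
    have key : ∀ e3, min e1 e2 ≤ e3 → ∀ n : ℕ, n ≥ 1 → ‖f n‖ ≤ A * (n:ℝ) ^ e3 := fun e3 h3 n hn => by
      refine (hf n hn).trans ?_
      have : (1:ℝ) ≤ n := by exact_mod_cast hn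
      gcongr
    rcases Nat.lt_or_ge k (K + 1) with hlt | hge
    · refine (h1 k (by omega) f A hA (key e1 (min_le_left _ _)) n hn).trans ?_
      gcongr; linarith
    · obtain rfl : k = K + 1 := by omega
      refine (h2 f A hA (key e2 (min_le_right _ _)) n hn).trans ?_
      gcongr; linarith

/-- choice of the power -/
lemma exists_pow {N Q : ℝ} (hN : 1 ≤ N) {K : ℕ} (hK : 2 ≤ K) (hQ : Q ≤ N ^ K) (hQ0 : 0 ≤ Q) :
    ∃ k, 2 ≤ k ∧ k ≤ K ∧ Q ≤ N ^ k ∧ (N ^ k ≤ N ^ 2 ∨ (N ^ k) ^ 2 ≤ Q ^ 3) := by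
  classical
  have hex : ∃ k, 2 ≤ k ∧ Q ≤ N ^ k := ⟨K, hK, hQ⟩
  obtain ⟨hk2, hkQ⟩ := Nat.find_spec hex
  set k := Nat.find hex with hk
  refine ⟨k, hk2, Nat.find_min' hex ⟨hK, hQ⟩, hkQ, ?_⟩
  rcases Nat.lt_or_ge 2 k with h | h
  · right
    have hmin := Nat.find_min hex (m := k - 1) (by omega)
    have h3 : N ^ (k - 1) < Q := by
      by_contra hc
      exact hmin ⟨by omega, not_lt.mp hc⟩
    have h4 : N ^ 2 ≤ N ^ (k - 1) := pow_le_pow_right₀ hN (by omega)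
    have h5 : N ^ k = N ^ (k - 1) * N := by rw [← pow_succ]; congr 1; omega
    calc (N ^ k) ^ 2 = (N ^ (k - 1)) ^ 2 * N ^ 2 := by rw [h5]; ring
      _ ≤ Q ^ 2 * Q := by
        have : 0 ≤ N ^ (k - 1) := by positivity
        have h6 : N ^ 2 ≤ Q := by linarith
        gcongr
      _ = Q ^ 3 := by ring
  · left
    have : k = 2 := by omega
    rw [this]

end ZD
end

section
open Complex MeasureTheory Filter Topology
namespace ZD

lemma pow_upper {T B a p : ℝ} {P : ℝ} (hT : 1 ≤ T) (hP0 : 0 ≤ P) (hB : 0 ≤ B) (hP : P ≤ B * T ^ a) (hp : 0 ≤ p) :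
    P ^ p ≤ B ^ p * T ^ (a * p) := by
  calc P ^ p ≤ (B * T ^ a) ^ p := Real.rpow_le_rpow hP0 hP hp
    _ = _ := by rw [Real.mul_rpow hB (by positivity), ← Real.rpow_mul (by linarith)]

lemma pow_lower {T a p : ℝ} {M : ℝ} (hT : 1 ≤ T) (hM : T ^ a ≤ M) (hp : p ≤ 0) :
    M ^ p ≤ T ^ (a * p) := by
  have hT0 : 0 < T := by linarith
  calc M ^ p ≤ (T ^ a) ^ p := Real.rpow_le_rpow_of_nonpos (by positivity) hM hp
    _ = _ := by rw [← Real.rpow_mul hT0.le]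

lemma calc_mv {σ d B C A CV : ℝ} (hσ1 : σ ≤ 1) (hd : 0 < d) (hd1 : d ≤ 1 / 100) (hσ0 : 1 / 2 ≤ σ - 2 * d)
    (hσ : σ ≤ 4 / 5) (hB : 1 ≤ B) (hC : 0 < C) (hA : 0 ≤ A) (hCV : 0 < CV) :
    ∃ C' > 0, ∀ T R W M P : ℝ, 1 ≤ T → 0 ≤ R → 0 < W → T ^ (5 / 6 + 10 * d) ≤ M → M ≤ 4 * T ^ (5 / 4 + 15 * d) →
      0 < P → P ≤ B * M → (W ^ 2)⁻¹ ≤ CV * T ^ (d / 10) →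
      R * W ^ 2 ≤ C * A ^ 2 * P ^ (3 * (d / 10)) * (T * M ^ (1 - 2 * (σ - 2 * d)) + P ^ (2 - 2 * (σ - 2 * d))) →
      R ≤ C' * T ^ (5 / 2 * (1 - σ) + 22 * d) := by
  set e := d / 10 with he
  set s := σ - 2 * d with hs
  refine ⟨CV * (C * (A ^ 2 + 1) * (4 * B) ^ (3 * e) * (1 + (4 * B) ^ (2 - 2 * s))), by positivity, fun T R W M P hT hR hW hM1 hM2 hP0 hP hWC h => ?_⟩
  have hT0 : 0 < T := by linarith
  have hP2 : P ≤ (4 * B) * T ^ (5 / 4 + 15 * d) := by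
    calc P ≤ B * M := hP
      _ ≤ B * (4 * T ^ (5 / 4 + 15 * d)) := by gcongr
      _ = _ := by ring
  have h1 := pow_upper hT hP0.le (by positivity) hP2 (p := 3 * e) (by positivity)
  have h2 := pow_upper hT hP0.le (by positivity) hP2 (p := 2 - 2 * s) (by linarith)
  have h3 := pow_lower hT hM1 (p := 1 - 2 * s) (by linarith)
  have h4 : T * M ^ (1 - 2 * s) ≤ T ^ (5 / 2 * (1 - σ) + 20 * d) := by
    calc T * M ^ (1 - 2 * s) ≤ T * T ^ ((5 / 6 + 10 * d) * (1 - 2 * s)) := by gcongr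
      _ = T ^ ((5 / 6 + 10 * d) * (1 - 2 * s) + 1) := by rw [Real.rpow_add_one hT0.ne']; ring
      _ ≤ _ := rpow_le_rpow_T hT (by nlinarith)
  have h5 : P ^ (2 - 2 * s) ≤ (4 * B) ^ (2 - 2 * s) * T ^ (5 / 2 * (1 - σ) + 20 * d) := by
    refine h2.trans ?_
    have : T ^ ((5 / 4 + 15 * d) * (2 - 2 * s)) ≤ T ^ (5 / 2 * (1 - σ) + 20 * d) := rpow_le_rpow_T hT (by nlinarith)
    gcongr
  have h6 : P ^ (3 * e) ≤ (4 * B) ^ (3 * e) * T ^ d := by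
    refine h1.trans ?_
    have : T ^ ((5 / 4 + 15 * d) * (3 * e)) ≤ T ^ d := rpow_le_rpow_T hT (by rw [he]; nlinarith)
    gcongr
  have h7 : T ^ e ≤ T ^ d := rpow_le_rpow_T hT (by rw [he]; linarith)
  calc R = (W ^ 2)⁻¹ * (R * W ^ 2) := by field_simp
    _ ≤ (CV * T ^ d) * (C * (A ^ 2 + 1) * ((4 * B) ^ (3 * e) * T ^ d) * (T ^ (5 / 2 * (1 - σ) + 20 * d) + (4 * B) ^ (2 - 2 * s) * T ^ (5 / 2 * (1 - σ) + 20 * d))) := by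
      refine mul_le_mul (hWC.trans (by gcongr)) (h.trans ?_) (by positivity) (by positivity)
      have : (0:ℝ) ≤ M ^ (1 - 2 * s) := Real.rpow_nonneg ((Real.rpow_nonneg hT0.le _).trans hM1) _
      gcongr
      linarith
    _ = (CV * (C * (A ^ 2 + 1) * (4 * B) ^ (3 * e) * (1 + (4 * B) ^ (2 - 2 * s)))) * (T ^ (5 / 2 * (1 - σ) + 20 * d) * T ^ d * T ^ d) := by ring
    _ = _ := by rw [← Real.rpow_add hT0, ← Real.rpow_add hT0]; congr 2; ring

set_option maxHeartbeats 1000000 in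
lemma calc_hal {σ d B C A CV : ℝ} (hσ1 : σ ≤ 1) (hd : 0 < d) (hd1 : d ≤ 1 / 100) 
    (hσ : 4 / 5 ≤ σ) (hB : 1 ≤ B) (hC : 0 < C) (hCV : 0 < CV) :
    ∃ C' > 0, ∃ T0 : ℝ, ∀ T R W M P : ℝ, 1 ≤ T → T0 ≤ T → 0 ≤ R → 0 < W → T ^ (5 / 6 + 10 * d) ≤ M → M ≤ 4 * T ^ (5 / 4 + 15 * d) →
      0 < P → P ≤ B * M → (W ^ 2)⁻¹ ≤ CV * T ^ (d / 10) →
      R * W ^ 2 ≤ C * A ^ 2 * P ^ (2 * (d / 10)) * (P / M) * (P + R * T ^ (1 / 2 + d / 10)) * (P * M ^ (-2 * (σ - 2 * d))) →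
      R ≤ C' * T ^ (5 / 2 * (1 - σ) + 22 * d) := by
  set e := d / 10 with he
  set s := σ - 2 * d with hs
  set D := CV * (C * (A ^ 2 + 1) * (4 * B) ^ (2 * e) * B * B) with hD
  have hD0 : 0 < D := by positivity
  refine ⟨2 * D * B * 4 ^ (2 - 2 * s), by positivity, (2 * D) ^ (1 / d), fun T R W M P hT hT1 hR hW hM1 hM2 hP0 hP hWC h => ?_⟩
  have hT0 : 0 < T := by linarith
  have hM0 : 0 < M := lt_of_lt_of_le (by positivity) hM1
  have hP2 : P ≤ (4 * B) * T ^ (5 / 4 + 15 * d) := by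
    calc P ≤ B * M := hP
      _ ≤ B * (4 * T ^ (5 / 4 + 15 * d)) := by gcongr
      _ = _ := by ring
  have h1 := pow_upper hT hP0.le (by positivity) hP2 (p := 2 * e) (by positivity)
  have h2 := pow_upper hT hM0.le (by positivity) hM2 (p := 2 - 2 * s) (by linarith)
  have h3 := pow_lower hT hM1 (p := 1 - 2 * s) (by linarith)
  have h6 : P ^ (2 * e) ≤ (4 * B) ^ (2 * e) * T ^ (3 * e) := by
    refine h1.trans ?_
    have : T ^ ((5 / 4 + 15 * d) * (2 * e)) ≤ T ^ (3 * e) := rpow_le_rpow_T hT (by rw [he]; nlinarith)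
    gcongr
  have h8 : P / M ≤ B := by rw [div_le_iff₀ hM0]; exact hP
  have h9 : P * M ^ (-2 * s) ≤ B * M ^ (1 - 2 * s) := by
    calc P * M ^ (-2 * s) ≤ B * M * M ^ (-2 * s) := by gcongr
      _ = _ := by rw [show 1 - 2 * s = -2 * s + 1 by ring, Real.rpow_add_one hM0.ne']; ring
  have main : R ≤ D * T ^ (4 * e) * (B * M ^ (2 - 2 * s) + R * T ^ (1 / 2 + e) * M ^ (1 - 2 * s)) := by
    calc R = (W ^ 2)⁻¹ * (R * W ^ 2) := by field_simp
      _ ≤ (CV * T ^ e) * (C * (A ^ 2 + 1) * ((4 * B) ^ (2 * e) * T ^ (3 * e)) * B * (B * M + R * T ^ (1 / 2 + e)) * (B * M ^ (1 - 2 * s))) := by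
        refine mul_le_mul hWC (h.trans ?_) (by positivity) (by positivity)
        gcongr
        linarith
      _ = D * (T ^ e * T ^ (3 * e)) * (B * (M ^ (1 - 2 * s) * M) + R * T ^ (1 / 2 + e) * M ^ (1 - 2 * s)) := by rw [hD]; ring
      _ = _ := by
        rw [← Real.rpow_add hT0, ← Real.rpow_add_one hM0.ne']
        congr 3 <;> ring_nf
  have h10 : T ^ (1 / 2 + e) * M ^ (1 - 2 * s) * T ^ (4 * e) ≤ T ^ (-d) := by
    calc _ ≤ T ^ (1 / 2 + e) * T ^ ((5 / 6 + 10 * d) * (1 - 2 * s)) * T ^ (4 * e) := by gcongr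
      _ = T ^ (1 / 2 + e + (5 / 6 + 10 * d) * (1 - 2 * s) + 4 * e) := by rw [← Real.rpow_add hT0, ← Real.rpow_add hT0]
      _ ≤ _ := rpow_le_rpow_T hT (by rw [he]; nlinarith)
  have h11 : D * T ^ (-d) ≤ 1 / 2 := by
    have : 2 * D ≤ T ^ d := by
      calc 2 * D = ((2 * D) ^ (1 / d)) ^ d := by rw [← Real.rpow_mul (by positivity)]; field_simp; simp
        _ ≤ T ^ d := by gcongr
    rw [Real.rpow_neg hT0.le, ← div_eq_mul_inv, div_le_iff₀ (by positivity)]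
    linarith
  have h12 : D * T ^ (4 * e) * (R * T ^ (1 / 2 + e) * M ^ (1 - 2 * s)) ≤ R / 2 := by
    calc _ = R * (D * (T ^ (1 / 2 + e) * M ^ (1 - 2 * s) * T ^ (4 * e))) := by ring
      _ ≤ R * (D * T ^ (-d)) := by gcongr
      _ ≤ R * (1 / 2) := by gcongr
      _ = _ := by ring
  have h13 : R ≤ 2 * D * T ^ (4 * e) * B * M ^ (2 - 2 * s) := by
    rw [mul_add] at main
    nlinarith
  refine h13.trans ?_
  calc _ ≤ 2 * D * T ^ (4 * e) * B * (4 ^ (2 - 2 * s) * T ^ ((5 / 4 + 15 * d) * (2 - 2 * s))) := by gcongr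
    _ = (2 * D * B * 4 ^ (2 - 2 * s)) * (T ^ ((5 / 4 + 15 * d) * (2 - 2 * s)) * T ^ (4 * e)) := by ring
    _ ≤ _ := by
      rw [← Real.rpow_add hT0]
      refine mul_le_mul_of_nonneg_left (rpow_le_rpow_T hT ?_) (by positivity)
      rw [he]; nlinarith
end ZD
end

section
open Complex MeasureTheory Filter Topology
namespace ZD

set_option maxHeartbeats 1000000 in
lemma block {σ d : ℝ} (hσ1 : σ ≤ 1) (hd : 0 < d) (hd1 : d ≤ 1 / 100) (hσ0 : 1 / 2 ≤ σ - 2 * d) :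
    ∃ e' : ℝ, 0 < e' ∧ ∀ A0 : ℝ, 1 ≤ A0 → ∀ Cv : ℝ, 1 ≤ Cv → ∃ C > 0, ∃ T0 : ℝ, ∀ (ι : Type) [Fintype ι] (t x : ι → ℝ), Sep t →
      ∀ T : ℝ, 1 ≤ T → T0 ≤ T → (∀ i, |t i| ≤ T) → (∀ i, σ ≤ x i) → (∀ i, x i ≤ 1) →
      ∀ (N : ℕ) (f : ℕ → ℂ) (V : ℝ), T ^ (d / 2) ≤ N → (N:ℝ) ≤ 2 * T ^ (5 / 8 : ℝ) →
      (∀ n, f n ≠ 0 → N ≤ n ∧ n ≤ 2 * N) → (∀ n : ℕ, n ≥ 1 → ‖f n‖ ≤ A0 * (n:ℝ) ^ e') → 0 < V →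
      V⁻¹ ≤ Cv * (1 + Real.log T) → (∀ i, V ≤ ‖DP (2 * N) f ((x i : ℂ) + t i * I)‖) →
      (Fintype.card ι : ℝ) ≤ C * T ^ (5 / 2 * (1 - σ) + 22 * d) := by
  obtain ⟨K0, hK0⟩ := exists_nat_ge ((5 / 6 + 10 * d) * (2 / d))
  set K := K0 + 2 with hK
  have hKd : 5 / 6 + 10 * d ≤ d / 2 * K := by
    have : (K0:ℝ) ≤ K := by rw [hK]; push_cast; linarith
    have h2 : (5 / 6 + 10 * d) * (2 / d) ≤ K := hK0.trans this
    calc 5 / 6 + 10 * d = d / 2 * ((5 / 6 + 10 * d) * (2 / d)) := by field_simp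
      _ ≤ _ := by gcongr
  obtain ⟨e', he', C1, hC1, hcp⟩ := cpw_bound_unif K (e := d / 10) (by positivity)
  refine ⟨e', he', fun A0 hA0 Cv hCv => ?_⟩
  obtain ⟨CL, hCL, hlog⟩ := log_pow_le (2 * K) (d / 10) (by positivity)
  obtain ⟨C2, hC2, hmv⟩ := dens_mv hσ1 hd (by linarith) hσ0 (e := d / 10) (by positivity)
  obtain ⟨C3, hC3, hhal⟩ := dens_hal hσ1 hd (by linarith) hσ0 (e := d / 10) (by positivity) (by linarith)
  have hA : 0 ≤ C1 * A0 ^ K := by positivity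
  have hCV : 0 < Cv ^ (2 * K) * CL := by positivity
  have hB : (1:ℝ) ≤ 2 ^ K := one_le_pow₀ (by norm_num)
  have hfin : ∃ C > 0, ∃ T0 : ℝ, ∀ T R W M P : ℝ, 1 ≤ T → T0 ≤ T → 0 ≤ R → 0 < W → T ^ (5 / 6 + 10 * d) ≤ M → M ≤ 4 * T ^ (5 / 4 + 15 * d) →
      0 < P → P ≤ 2 ^ K * M → (W ^ 2)⁻¹ ≤ (Cv ^ (2 * K) * CL) * T ^ (d / 10) →
      R * W ^ 2 ≤ C2 * (C1 * A0 ^ K) ^ 2 * P ^ (3 * (d / 10)) * (T * M ^ (1 - 2 * (σ - 2 * d)) + P ^ (2 - 2 * (σ - 2 * d))) →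
      R * W ^ 2 ≤ C3 * (C1 * A0 ^ K) ^ 2 * P ^ (2 * (d / 10)) * (P / M) * (P + R * T ^ (1 / 2 + d / 10)) * (P * M ^ (-2 * (σ - 2 * d))) →
      R ≤ C * T ^ (5 / 2 * (1 - σ) + 22 * d) := by
    rcases le_total σ (4 / 5) with h | h
    · obtain ⟨C, hC, H⟩ := calc_mv hσ1 hd hd1 hσ0 h hB hC2 hA hCV
      exact ⟨C, hC, 0, fun T R W M P a1 _ a2 a3 a4 a5 a6 a7 a8 a9 _ => H T R W M P a1 a2 a3 a4 a5 a6 a7 a8 a9⟩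
    · obtain ⟨C, hC, T0, H⟩ := calc_hal (A := C1 * A0 ^ K) hσ1 hd hd1 h hB hC3 hCV
      exact ⟨C, hC, T0, fun T R W M P a1 a0 a2 a3 a4 a5 a6 a7 a8 _ a9 => H T R W M P a1 a0 a2 a3 a4 a5 a6 a7 a8 a9⟩
  obtain ⟨C, hC, T0, H⟩ := hfin
  refine ⟨C, hC, T0, fun ι _ t x ht T hT hTT htT hx1 hx2 N f V hN1 hN2 hfs hfb hV hV1 hVi => ?_⟩
  have hT0 : 0 < T := by linarith
  have hN1' : (1:ℝ) ≤ N := le_trans (Real.one_le_rpow hT (by positivity)) hN1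
  have hNn : 1 ≤ N := by exact_mod_cast hN1'
  obtain ⟨k, hk2, hkK, hkQ, hkU⟩ := exists_pow (N := (N:ℝ)) (Q := T ^ (5 / 6 + 10 * d)) hN1' (K := K) (by omega)
    (by
      calc T ^ (5 / 6 + 10 * d) ≤ T ^ (d / 2 * K) := rpow_le_rpow_T hT hKd
        _ = (T ^ (d / 2)) ^ K := by rw [Real.rpow_mul hT0.le, Real.rpow_natCast]
        _ ≤ _ := by gcongr) (by positivity)
  have hM2 : (N:ℝ) ^ k ≤ 4 * T ^ (5 / 4 + 15 * d) := by
    rcases hkU with h | h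
    · calc (N:ℝ) ^ k ≤ (N:ℝ) ^ 2 := h
        _ ≤ (2 * T ^ (5 / 8 : ℝ)) ^ 2 := by gcongr
        _ = 4 * T ^ (5 / 4 : ℝ) := by rw [mul_pow, ← Real.rpow_natCast (T ^ (5 / 8 : ℝ)), ← Real.rpow_mul hT0.le]; norm_num
        _ ≤ _ := by
          have := rpow_le_rpow_T hT (a := 5 / 4) (b := 5 / 4 + 15 * d) (by linarith)
          linarith
    · have h1 : (N:ℝ) ^ k ≤ T ^ (5 / 4 + 15 * d) := by
        refine (pow_le_pow_iff_left₀ (by positivity) (by positivity) two_ne_zero).mp (h.trans (le_of_eq ?_))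
        rw [← Real.rpow_natCast, ← Real.rpow_natCast, ← Real.rpow_mul hT0.le, ← Real.rpow_mul hT0.le]
        congr 1; push_cast; ring
      have : 0 ≤ T ^ (5 / 4 + 15 * d) := by positivity
      linarith
  have hPc : (((2 * N) ^ k : ℕ) : ℝ) = 2 ^ k * (N:ℝ) ^ k := by push_cast; rw [mul_pow]
  have hlogT : 0 ≤ Real.log T := Real.log_nonneg hT
  have hf0 : ∀ n, 2 * N < n → f n = 0 := fun n hn => by
    by_contra hc
    have := (hfs n hc).2
    omega
  have hWi : ∀ i, V ^ k ≤ ‖DP ((2 * N) ^ k) (cpw f k) ((x i : ℂ) + t i * I)‖ := fun i => by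
    rw [← DP_pow (2 * N) f hf0, norm_pow]
    have := hVi i
    gcongr
  have hh : ∀ n ∈ Finset.Icc 1 ((2 * N) ^ k), ‖cpw f k n‖ ≤ (C1 * A0 ^ K) * (n:ℝ) ^ (d / 10) := fun n hn => by
    refine (hcp k hkK f A0 (by linarith) hfb n (Finset.mem_Icc.mp hn).1).trans ?_
    have : A0 ^ k ≤ A0 ^ K := pow_le_pow_right₀ hA0 hkK
    gcongr
  have hsup : ∀ n ∈ Finset.Icc 1 ((2 * N) ^ k), cpw f k n ≠ 0 → (N:ℝ) ^ k ≤ n := fun n _ hn =>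
    (cpw_supp (a := (N:ℝ)) (b := 2 * N) (by positivity) (fun n hn => ⟨by exact_mod_cast (hfs n hn).1, by exact_mod_cast (hfs n hn).2⟩) k n hn).1
  have hP1 : 1 ≤ (2 * N) ^ k := Nat.one_le_pow _ _ (by omega)
  refine H T (Fintype.card ι) (V ^ k) ((N:ℝ) ^ k) (((2 * N) ^ k : ℕ) : ℝ) hT hTT (by positivity) (by positivity) hkQ hM2
    (by exact_mod_cast hP1) ?_ ?_
    (hmv ι t x ht T hT htT hx1 hx2 _ _ (V ^ k) ((N:ℝ) ^ k) _ hP1 (by positivity) hA (by positivity) hWi hh hsup)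
    (hhal ι t x ht T hT htT hx1 hx2 _ _ (V ^ k) ((N:ℝ) ^ k) _ hP1 (by positivity) hA (by positivity) hWi hh hsup)
  · rw [hPc]
    have : (2:ℝ) ^ k ≤ 2 ^ K := pow_le_pow_right₀ (by norm_num) hkK
    gcongr
  · calc ((V ^ k) ^ 2)⁻¹ = (V⁻¹) ^ (2 * k) := by rw [← pow_mul, inv_pow, mul_comm k]
      _ ≤ (Cv * (1 + Real.log T)) ^ (2 * k) := by gcongr
      _ ≤ (Cv * (1 + Real.log T)) ^ (2 * K) := pow_le_pow_right₀ (by nlinarith) (by omega)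
      _ = Cv ^ (2 * K) * (1 + Real.log T) ^ (2 * K) := by rw [mul_pow]
      _ ≤ Cv ^ (2 * K) * (CL * T ^ (d / 10)) := by gcongr; exact hlog T hT
      _ = _ := by ring
end ZD
end

section
open Complex MeasureTheory Filter Topology
namespace ZD
variable {q : ℕ} [NeZero q]

lemma DP_trunc {N1 N2 : ℕ} {f : ℕ → ℂ} (h1 : ∀ n, N1 < n → f n = 0) (hN : N1 ≤ N2) (s : ℂ) : DP N2 f s = DP N1 f s := by
  rw [DP, DP]
  refine (Finset.sum_subset (Finset.Icc_subset_Icc le_rfl hN) fun n hn hn' => ?_).symm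
  rw [h1 n (by simp only [Finset.mem_Icc] at hn hn'; omega), zero_mul]

lemma DP_ext {N1 N2 : ℕ} {f : ℕ → ℂ} (h1 : ∀ n, N1 < n → f n = 0) (h2 : ∀ n, N2 < n → f n = 0) (s : ℂ) :
    DP N1 f s = DP N2 f s := by
  rcases le_total N1 N2 with h | h
  · exact (DP_trunc h1 h s).symm
  · exact DP_trunc h2 h s

noncomputable def blk (g : ℕ → ℂ) (Y j n : ℕ) : ℂ := if n ≤ Y ∧ Nat.log 2 n = j then g n else 0

lemma DP_blocks (g : ℕ → ℂ) (Y : ℕ) (s : ℂ) :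
    DP Y g s = ∑ j ∈ Finset.range (Nat.log 2 Y + 1), DP (2 * 2 ^ j) (blk g Y j) s := by
  have e1 : ∀ j, DP (2 * 2 ^ j) (blk g Y j) s = DP Y (blk g Y j) s := fun j => by
    refine DP_ext (fun n hn => ?_) (fun n hn => ?_) s
    · rw [blk, if_neg]
      rintro ⟨_, h⟩
      have := Nat.lt_pow_succ_log_self (b := 2) (by norm_num) n
      rw [h, pow_succ] at this
      omega
    · rw [blk, if_neg]; omega
  simp_rw [e1, DP]
  rw [Finset.sum_comm]
  refine Finset.sum_congr rfl fun n hn => ?_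
  have hn' := Finset.mem_Icc.mp hn
  rw [Finset.sum_eq_single (Nat.log 2 n)]
  · rw [blk, if_pos ⟨hn'.2, rfl⟩]
  · intro j _ hj
    rw [blk, if_neg (fun h => hj h.2.symm), zero_mul]
  · intro h
    exact absurd (Finset.mem_range.mpr (Nat.lt_succ_of_le (Nat.log_mono_right hn'.2))) h

lemma J_bound {T : ℝ} (hT : 1 ≤ T) {Y : ℕ} (hY : 1 ≤ Y) (hY2 : (Y:ℝ) ≤ 2 * T ^ (5 / 8 : ℝ)) :
    ((Nat.log 2 Y + 1 : ℕ) : ℝ) ≤ 2 * (1 + Real.log T) := by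
  have hT0 : 0 < T := by linarith
  have h1 : ((2:ℝ) ^ Nat.log 2 Y) ≤ Y := by exact_mod_cast Nat.pow_log_le_self 2 (by omega)
  have h2 : (Nat.log 2 Y : ℝ) * Real.log 2 ≤ Real.log 2 + 5 / 8 * Real.log T := by
    rw [← Real.log_pow, ← Real.log_rpow hT0, ← Real.log_mul (by norm_num) (by positivity)]
    exact Real.log_le_log (by positivity) (h1.trans hY2)
  have h3 := Real.log_two_gt_d9
  have h4 : 0 ≤ Real.log T := Real.log_nonneg hT
  push_cast
  by_contra hc
  push Not at hc
  nlinarith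

set_option maxHeartbeats 1000000 in
lemma classI (χ : DirichletCharacter ℂ q) {σ d : ℝ} (hσ1 : σ ≤ 1) (hd : 0 < d) (hd1 : d ≤ 1 / 100) (hσ0 : 1 / 2 ≤ σ - 2 * d) :
    ∃ C > 0, ∀ (ι : Type) [Fintype ι] (t x : ι → ℝ), Sep t → ∀ T : ℝ, 1 ≤ T → (∀ i, |t i| ≤ T) → ∀ X Y : ℕ, 1 ≤ Y →
      T ^ d ≤ X → (Y:ℝ) ≤ 2 * T ^ (5 / 8 : ℝ) → (∀ i, σ ≤ x i) → (∀ i, x i ≤ 1) →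
      (∀ i, 1 / 2 ≤ ‖DP Y (bco χ X) ((x i : ℂ) + t i * I)‖) → (Fintype.card ι : ℝ) ≤ C * T ^ (5 / 2 * (1 - σ) + 23 * d) := by
  classical
  obtain ⟨e', he', hbl⟩ := block hσ1 hd hd1 hσ0
  obtain ⟨Ca, hCa, hac⟩ := aco_bound χ he'
  obtain ⟨C, hC, T0, H⟩ := hbl (max Ca 1) (le_max_right _ _) 4 (by norm_num)
  obtain ⟨CL, hCL, hlog⟩ := log_pow_le 1 d hd
  set T1 : ℝ := max (max T0 1) (2 ^ (2 / d)) with hT1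
  have hT1' : 1 ≤ T1 := (le_max_right _ _).trans (le_max_left _ _)
  refine ⟨4 * T1 + 2 * CL * C, by positivity, fun ι _ t x ht T hT htT X Y hY hX hY2 hx1 hx2 hD => ?_⟩
  have hT0 : 0 < T := by linarith
  rcases lt_or_ge T T1 with hlt | hge
  · have h1 := sep_card ht hT htT
    have h2 : 1 ≤ T ^ (5 / 2 * (1 - σ) + 23 * d) := Real.one_le_rpow hT (by nlinarith)
    have h3 : 0 < 2 * CL * C := by positivity
    nlinarith
  set J := Nat.log 2 Y + 1 with hJ
  have hJ0 : (0:ℝ) < J := by rw [hJ]; positivity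
  have hJb := J_bound hT hY hY2
  rw [← hJ] at hJb
  have hTT0 : T0 ≤ T := (le_max_left _ _).trans ((le_max_left _ _).trans hge)
  have hTd : 2 ≤ T ^ (d / 2) := by
    calc (2:ℝ) = (2 ^ (2 / d)) ^ (d / 2) := by rw [← Real.rpow_mul (by norm_num)]; field_simp; simp
      _ ≤ _ := by
        have : (2:ℝ) ^ (2 / d) ≤ T := (le_max_right _ _).trans hge
        gcongr
  -- pigeonhole
  have hex : ∀ i, ∃ j ∈ Finset.range J, 1 / (2 * (J:ℝ)) ≤ ‖DP (2 * 2 ^ j) (blk (bco χ X) Y j) ((x i : ℂ) + t i * I)‖ := fun i => by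
    by_contra hc
    push Not at hc
    have h1 := hD i
    rw [DP_blocks] at h1
    have h2 := (norm_sum_le (Finset.range J) fun j => DP (2 * 2 ^ j) (blk (bco χ X) Y j) ((x i : ℂ) + t i * I))
    have h3 := Finset.sum_lt_sum_of_nonempty (s := Finset.range J) ⟨0, by simp [hJ]⟩ hc
    rw [Finset.sum_const, Finset.card_range, nsmul_eq_mul] at h3
    have h4 : (J:ℝ) * (1 / (2 * J)) = 1 / 2 := by field_simp
    linarith
  choose j hj1 hj2 using hex
  have hcard : ∀ j0 ∈ Finset.range J, (Fintype.card {i // j i = j0} : ℝ) ≤ C * T ^ (5 / 2 * (1 - σ) + 22 * d) := fun j0 hj0 => by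
    by_cases hemp : IsEmpty {i // j i = j0}
    · rw [Fintype.card_eq_zero]; simp only [Nat.cast_zero]; positivity
    rw [not_isEmpty_iff] at hemp
    obtain ⟨i0, hi0⟩ := hemp
    have hne : ∃ n, blk (bco χ X) Y j0 n ≠ 0 := by
      by_contra hc
      push Not at hc
      have h1 := hj2 i0
      rw [hi0, DP, Finset.sum_eq_zero (fun n _ => by rw [hc, zero_mul]), norm_zero] at h1
      have : 0 < 1 / (2 * (J:ℝ)) := by positivity
      linarith
    obtain ⟨n, hn⟩ := hne
    have hn1 : n ≤ Y ∧ Nat.log 2 n = j0 := by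
      by_contra hc
      exact hn (by rw [blk, if_neg hc])
    have hn2 : X < n := by
      rw [blk, if_pos hn1, bco] at hn
      by_contra hc
      exact hn (by rw [if_pos (by omega)])
    have hX1 : (1:ℝ) ≤ X := le_trans (Real.one_le_rpow hT hd.le) hX
    have hlow : n < 2 * 2 ^ j0 := by
      have := Nat.lt_pow_succ_log_self (b := 2) (by norm_num) n
      rw [hn1.2, pow_succ] at this
      omega
    have hup : 2 ^ j0 ≤ n := by
      have := Nat.pow_log_le_self 2 (x := n) (by omega)
      rwa [hn1.2] at this
    refine H {i // j i = j0} (fun i => t i.1) (fun i => x i.1) (fun a b hab => ht _ _ (fun h => hab (Subtype.ext h))) T hT hTT0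
      (fun i => htT _) (fun i => hx1 _) (fun i => hx2 _) (2 ^ j0) (blk (bco χ X) Y j0) (1 / (2 * (J:ℝ))) ?_ ?_ ?_ ?_ (by positivity) ?_ ?_
    · have h5 : (X:ℝ) < n := by exact_mod_cast hn2
      have h6 : (n:ℝ) < 2 * ((2 ^ j0 : ℕ) : ℝ) := by exact_mod_cast hlow
      have h7 : T ^ d = T ^ (d / 2) * T ^ (d / 2) := by rw [← Real.rpow_add hT0]; congr 1; ring
      nlinarith
    · have h5 : ((2 ^ j0 : ℕ) : ℝ) ≤ n := by exact_mod_cast hup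
      have h6 : (n:ℝ) ≤ Y := by exact_mod_cast hn1.1
      linarith
    · intro m hm
      have hm1 : m ≤ Y ∧ Nat.log 2 m = j0 := by
        by_contra hc
        exact hm (by rw [blk, if_neg hc])
      have hm0 : m ≠ 0 := by
        rintro rfl
        apply hm
        rw [blk, if_pos hm1, bco, if_pos (Nat.zero_le _)]
      have a1 := Nat.lt_pow_succ_log_self (b := 2) (by norm_num) m
      rw [hm1.2, pow_succ] at a1
      have a2 := Nat.pow_log_le_self 2 (x := m) hm0
      rw [hm1.2] at a2
      omega
    · intro m hm
      have : ‖blk (bco χ X) Y j0 m‖ ≤ ‖aco χ X m‖ := by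
        unfold blk bco
        split_ifs <;> simp
      refine (this.trans (hac X m hm)).trans ?_
      gcongr
      exact le_max_left _ _
    · rw [one_div, inv_inv]; linarith
    · intro i
      have := hj2 i.1
      rw [i.2] at this
      exact this
  have hsum : (Fintype.card ι : ℝ) = ∑ j0 ∈ Finset.range J, (Fintype.card {i // j i = j0} : ℝ) := by
    have := Finset.card_eq_sum_card_fiberwise (f := j) (s := Finset.univ) (t := Finset.range J) (fun i _ => by exact_mod_cast hj1 i)
    rw [Finset.card_univ] at this
    rw [this]
    push_cast
    refine Finset.sum_congr rfl fun j0 _ => ?_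
    rw [Fintype.card_subtype]
  rw [hsum]
  refine (Finset.sum_le_sum hcard).trans ?_
  rw [Finset.sum_const, Finset.card_range, nsmul_eq_mul]
  have h8 := hlog T hT
  rw [pow_one] at h8
  calc (J:ℝ) * (C * T ^ (5 / 2 * (1 - σ) + 22 * d)) ≤ (2 * (CL * T ^ d)) * (C * T ^ (5 / 2 * (1 - σ) + 22 * d)) := by
        gcongr; linarith
    _ = 2 * CL * C * (T ^ d * T ^ (5 / 2 * (1 - σ) + 22 * d)) := by ring
    _ = 2 * CL * C * T ^ (5 / 2 * (1 - σ) + 23 * d) := by rw [← Real.rpow_add hT0]; congr 2; ring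
    _ ≤ _ := by
      have : 0 ≤ 4 * T1 := by linarith
      gcongr; linarith

/-- density for a separated family of zeros -/
lemma dens_sep {χ : DirichletCharacter ℂ q} (hχ : χ.IsPrimitive) (hχ' : χ⁻¹.IsPrimitive) {σ d : ℝ} (hσ1 : σ ≤ 1) (hd : 0 < d)
    (hd1 : d ≤ 1 / 100) (hσ0 : 1 / 2 ≤ σ - 2 * d) :
    ∃ C > 0, ∀ (ι : Type) [Fintype ι] (t x : ι → ℝ), Sep t → ∀ T : ℝ, 1 ≤ T → (∀ i, |t i| ≤ T) → (∀ i, 10 ≤ |t i|) →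
      (∀ i, σ ≤ x i) → (∀ i, x i ≤ 1) → (∀ i, χ.LFunction ((x i : ℂ) + t i * I) = 0) →
      (Fintype.card ι : ℝ) ≤ C * T ^ (5 / 2 * (1 - σ) + 23 * d) := by
  classical
  obtain ⟨C1, hC1, H1⟩ := classI χ hσ1 hd hd1 hσ0
  obtain ⟨C2, hC2, H2⟩ := classII hχ hχ' (by linarith) hσ1 hd (by linarith)
  refine ⟨C1 + C2, by positivity, fun ι _ t x ht T hT htT ht10 hx1 hx2 hz => ?_⟩
  obtain ⟨X, hX1, hX2, hX3⟩ := ceil_pow hT hd.le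
  obtain ⟨Y, hY1, hY2, hY3⟩ := ceil_pow hT (a := 5 / 8) (by norm_num)
  set p : ι → Prop := fun i => 1 / 2 ≤ ‖DP Y (bco χ X) ((x i : ℂ) + t i * I)‖ with hp
  have a1 := H1 {i // p i} (fun i => t i.1) (fun i => x i.1) (fun a b hab => ht _ _ (fun h => hab (Subtype.ext h))) T hT
    (fun i => htT _) X Y hY1 hX2 hY3 (fun i => hx1 _) (fun i => hx2 _) (fun i => i.2)
  have a2 := H2 {i // ¬ p i} (fun i => t i.1) (fun i => x i.1) (fun a b hab => ht _ _ (fun h => hab (Subtype.ext h))) T hT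
    (fun i => htT _) X Y hY1 hX3 hY2 hY3 (fun i => hx1 _) (fun i => hx2 _) (fun i => by
      refine F1_zero χ hX1 hY1 ?_ ?_ ?_ (hz _) (not_le.mp i.2).le
      · simp; linarith [hx1 i.1]
      · simp; linarith [hx2 i.1]
      · simp; linarith [ht10 i.1])
  have a3 : (Fintype.card ι : ℝ) = Fintype.card {i // p i} + Fintype.card {i // ¬ p i} := by
    rw [← Nat.cast_add, ← Fintype.card_sum, Fintype.card_congr (Equiv.sumCompl p)]
  rw [a3]
  have a4 : T ^ (5 / 2 * (1 - σ) + 16 * d) ≤ T ^ (5 / 2 * (1 - σ) + 23 * d) := rpow_le_rpow_T hT (by linarith)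
  nlinarith

end ZD
end

section
open Complex MeasureTheory Filter Topology
namespace ZD
variable {q : ℕ} [NeZero q]

lemma factor_zeros {F : ℂ → ℂ} (hF : Differentiable ℂ F) (m : ℂ → ℕ) (S : Finset ℂ)
    (h : ∀ ρ ∈ S, ∃ c : ℂ, Tendsto (fun s => F s / (s - ρ) ^ m ρ) (𝓝[≠] ρ) (𝓝 c)) :
    ∃ G : ℂ → ℂ, Differentiable ℂ G ∧ ∀ s, s ∉ S → F s = G s * ∏ ρ ∈ S, (s - ρ) ^ m ρ := by
  classical
  induction S using Finset.induction_on with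
  | empty => exact ⟨F, hF, fun s _ => by simp⟩
  | insert a S ha ih =>
    obtain ⟨G, hG, hGF⟩ := ih (fun ρ hρ => h ρ (Finset.mem_insert_of_mem hρ))
    obtain ⟨c, hc⟩ := h a (Finset.mem_insert_self _ _)
    set P : ℂ → ℂ := fun s => ∏ ρ ∈ S, (s - ρ) ^ m ρ with hP
    have hP0 : ∀ s, s ∉ S → P s ≠ 0 := fun s hs => Finset.prod_ne_zero_iff.mpr fun ρ hρ => pow_ne_zero _ (sub_ne_zero.mpr fun h => hs (h ▸ hρ))
    have hPc : Continuous P := by rw [hP]; fun_prop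
    have hev : ∀ᶠ s in 𝓝[≠] a, s ∉ S := by
      apply eventually_nhdsWithin_of_eventually_nhds
      exact (S.finite_toSet.isClosed.isOpen_compl.mem_nhds (by simpa using ha))
    have hlim : Tendsto (fun s => G s / (s - a) ^ m a) (𝓝[≠] a) (𝓝 (c / P a)) := by
      have := hc.div ((hPc.tendsto a).mono_left nhdsWithin_le_nhds) (hP0 a ha)
      refine this.congr' ?_
      filter_upwards [hev] with s hs
      have := hP0 s hs
      rw [Pi.div_apply, hGF s hs]
      change G s * P s / _ / P s = _
      field_simp
    refine ⟨Function.update (fun s => G s / (s - a) ^ m a) a (c / P a), ?_, fun s hs => ?_⟩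
    · intro s
      by_cases hsa : s = a
      · subst hsa
        refine (Complex.analyticAt_of_differentiable_on_punctured_nhds_of_continuousAt ?_ (continuousAt_update_same.mpr hlim)).differentiableAt
        filter_upwards [self_mem_nhdsWithin] with z hz
        have hz' : z ≠ s := hz
        have h1 : DifferentiableAt ℂ (fun w => G w / (w - s) ^ m s) z :=
          (hG z).div (by fun_prop) (pow_ne_zero _ (sub_ne_zero.mpr hz'))
        refine h1.congr_of_eventuallyEq ?_
        filter_upwards [isOpen_ne.mem_nhds hz'] with w hw
        rw [Function.update_of_ne hw]
      · have h1 : DifferentiableAt ℂ (fun w => G w / (w - a) ^ m a) s :=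
          (hG s).div (by fun_prop) (pow_ne_zero _ (sub_ne_zero.mpr hsa))
        refine h1.congr_of_eventuallyEq ?_
        filter_upwards [isOpen_ne.mem_nhds hsa] with w hw
        rw [Function.update_of_ne hw]
    · rw [Finset.mem_insert, not_or] at hs
      rw [Function.update_of_ne hs.1, Finset.prod_insert ha, hGF s hs.2]
      have : (s - a) ^ m a ≠ 0 := pow_ne_zero _ (sub_ne_zero.mpr hs.1)
      field_simp

lemma jensen {F : ℂ → ℂ} (hF : Differentiable ℂ F) (m : ℂ → ℕ) (S : Finset ℂ)
    (h : ∀ ρ ∈ S, ∃ c : ℂ, Tendsto (fun s => F s / (s - ρ) ^ m ρ) (𝓝[≠] ρ) (𝓝 c)) (a : ℂ) (ha : a ∉ S) {r R B : ℝ} (hr : 0 ≤ r) (hrR : r < R)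
    (hS : ∀ ρ ∈ S, ‖ρ - a‖ ≤ r) (hB : ∀ z ∈ Metric.sphere a R, ‖F z‖ ≤ B) :
    ‖F a‖ ≤ B * (r / (R - r)) ^ (∑ ρ ∈ S, m ρ) := by
  obtain ⟨G, hG, hGF⟩ := factor_zeros hF m S h
  set n := ∑ ρ ∈ S, m ρ with hn
  have hRr : 0 < R - r := by linarith
  have h1 : ∀ z ∈ Metric.sphere a R, ‖G z‖ ≤ B / (R - r) ^ n := fun z hz => by
    have hza : ‖z - a‖ = R := by simpa [dist_eq_norm] using hz
    have hzS : z ∉ S := fun hc => by linarith [hS z hc]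
    rw [le_div_iff₀ (by positivity)]
    refine le_trans ?_ (hB z hz)
    rw [hGF z hzS, norm_mul, norm_prod, hn, ← Finset.prod_pow_eq_pow_sum]
    refine mul_le_mul_of_nonneg_left (Finset.prod_le_prod (fun _ _ => by positivity) fun ρ hρ => ?_) (norm_nonneg _)
    rw [norm_pow]
    have : R - r ≤ ‖z - ρ‖ := by
      have h2 := norm_sub_norm_le (z - a) (ρ - a)
      rw [sub_sub_sub_cancel_right] at h2
      linarith [hS ρ hρ]
    gcongr
  have h2 : ‖G a‖ ≤ B / (R - r) ^ n := by
    refine Complex.norm_le_of_forall_mem_frontier_norm_le (U := Metric.ball a R) Metric.isBounded_ball hG.diffContOnCl ?_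
      (subset_closure (Metric.mem_ball_self (by linarith)))
    intro z hz
    rw [frontier_ball a (by linarith)] at hz
    exact h1 z hz
  have h3 : ‖∏ ρ ∈ S, (a - ρ) ^ m ρ‖ ≤ r ^ n := by
    rw [norm_prod, hn, ← Finset.prod_pow_eq_pow_sum]
    refine Finset.prod_le_prod (fun _ _ => by positivity) fun ρ hρ => ?_
    rw [norm_pow]
    have := hS ρ hρ
    rw [norm_sub_rev] at this
    gcongr
  rw [hGF a ha, norm_mul]
  calc _ ≤ B / (R - r) ^ n * r ^ n := mul_le_mul h2 h3 (norm_nonneg _) ((norm_nonneg _).trans h2)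
    _ = _ := by rw [div_pow]; ring

lemma local_count {χ : DirichletCharacter ℂ q} (hχ : χ.IsPrimitive) :
    ∃ C > 0, ∀ (t : ℝ) (S : Finset ℂ) (m : ℂ → ℕ), (∀ ρ ∈ S, 1 / 2 ≤ ρ.re ∧ ρ.re < 1 ∧ |ρ.im - t| ≤ 1 / 4 ∧
      ∃ c : ℂ, Tendsto (fun s => χ.LFunction s / (s - ρ) ^ m ρ) (𝓝[≠] ρ) (𝓝 c)) →
      ((∑ ρ ∈ S, m ρ : ℕ) : ℝ) ≤ C * (1 + Real.log (1 + |t|)) := by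
  obtain ⟨C1, hC1, h1⟩ := Lt_poly hχ
  obtain ⟨C2, hC2, h2⟩ := L_lower χ (c := 6 / 5) (by norm_num)
  set D := 5 * C2 * (9 * ((C1 + 1) * 27)) with hD
  have hD0 : 0 < D := by positivity
  refine ⟨(|Real.log D| + 4) * 3, by positivity, fun t S m hS => ?_⟩
  set n := ∑ ρ ∈ S, m ρ with hn
  set a : ℂ := ((6 / 5 : ℝ) : ℂ) + t * I with ha
  have hare : a.re = 6 / 5 := by simp [ha]
  have haim : a.im = t := by simp [ha]
  have haS : a ∉ S := fun hc => by have := (hS a hc).2.1; rw [hare] at this; norm_num at this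
  have hu : 1 ≤ 1 + |t| := by linarith [abs_nonneg t]
  have hB : ∀ z ∈ Metric.sphere a 2, ‖HL χ z‖ ≤ (9 * ((C1 + 1) * 27)) * (1 + |t|) ^ 4 := fun z hz => by
    have hza : ‖z - a‖ = 2 := by simpa [dist_eq_norm] using hz
    have hre := abs_le.mp ((Complex.abs_re_le_norm (z - a)).trans hza.le)
    have him := abs_le.mp ((Complex.abs_im_le_norm (z - a)).trans hza.le)
    rw [sub_re, hare] at hre
    rw [sub_im, haim] at him
    have hz3 : z + 3 ≠ 0 := add3_ne (by linarith)
    have e1 : HL χ z = Lt χ z * (z + 3) := by rw [Lt]; field_simp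
    have hzim : 1 + |z.im| ≤ 3 * (1 + |t|) := by
      have : |z.im| ≤ |t| + 2 := by
        rw [abs_le]; constructor <;> linarith [neg_abs_le t, le_abs_self t]
      linarith [abs_nonneg t]
    have e2 := h1 z.re z.im (by linarith) (by linarith)
    rw [Complex.re_add_im] at e2
    have e3 : ‖Lt χ z‖ ≤ (C1 + 1) * 27 * (1 + |t|) ^ 3 := by
      have e4 : ‖Lt χ z‖ ^ 2 ≤ C1 * 27 * (1 + |t|) ^ 3 := by
        calc _ ≤ C1 * (1 + |z.im|) ^ 3 := e2
          _ ≤ C1 * (3 * (1 + |t|)) ^ 3 := by gcongr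
          _ = _ := by ring
      have hp : 1 ≤ (1 + |t|) ^ 3 := one_le_pow₀ hu
      have e5 : 1 ≤ (C1 + 1) * 27 * (1 + |t|) ^ 3 := by nlinarith
      by_contra hc
      push Not at hc
      nlinarith
    have e6 : ‖z + 3‖ ≤ 9 * (1 + |t|) := by
      calc ‖z + 3‖ = ‖(z - a) + (a + 3)‖ := by congr 1; ring
        _ ≤ ‖z - a‖ + ‖a + 3‖ := norm_add_le _ _
        _ ≤ 2 + (5 + |t|) := by
          rw [hza]
          have : a + 3 = ((21 / 5 : ℝ) : ℂ) + t * I := by rw [ha]; push_cast; ring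
          rw [this]
          have := norm_add_le (((21 / 5 : ℝ) : ℂ)) (t * I)
          rw [norm_mul, Complex.norm_I, Complex.norm_real, Complex.norm_real, Real.norm_eq_abs, Real.norm_eq_abs, mul_one] at this
          rw [abs_of_pos (by norm_num : (0:ℝ) < 21 / 5)] at this
          linarith
        _ ≤ _ := by linarith [abs_nonneg t]
    rw [e1, norm_mul]
    calc _ ≤ ((C1 + 1) * 27 * (1 + |t|) ^ 3) * (9 * (1 + |t|)) := by gcongr
      _ = _ := by ring
  have hJ := jensen (HL_diff χ) m S (fun ρ hρ => by
    obtain ⟨_, h3, _, c, hc⟩ := hS ρ hρ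
    have hρ1 : ρ ≠ 1 := by rintro rfl; simp at h3
    refine ⟨(ρ - 1) * c, ?_⟩
    have h4 : Tendsto (fun s : ℂ => s - 1) (𝓝[≠] ρ) (𝓝 (ρ - 1)) :=
      ((continuous_id.sub continuous_const).tendsto ρ).mono_left nhdsWithin_le_nhds
    refine (h4.mul hc).congr' ?_
    filter_upwards [eventually_nhdsWithin_of_eventually_nhds (isOpen_ne.mem_nhds hρ1)] with s hs
    rw [HL_eq χ hs]; ring) a haS (r := 3 / 4) (R := 2) (by norm_num) (by norm_num) (fun ρ hρ => by
      obtain ⟨h5, h6, h7, _⟩ := hS ρ hρ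
      refine (pow_le_pow_iff_left₀ (norm_nonneg _) (by norm_num) two_ne_zero).mp ?_
      rw [← Complex.normSq_eq_norm_sq, Complex.normSq_apply, sub_re, sub_im, hare, haim]
      have := abs_le.mp h7
      nlinarith) hB
  have ha1 : a ≠ 1 := fun h => by rw [h] at hare; norm_num at hare
  have hlow : 1 / (5 * C2) ≤ ‖HL χ a‖ := by
    rw [HL_eq χ ha1, norm_mul]
    have e7 := h2 a (by rw [hare])
    have e8 : 1 / 5 ≤ ‖a - 1‖ := by
      refine le_trans ?_ (Complex.abs_re_le_norm (a - 1))
      rw [sub_re, hare]; norm_num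
    rw [div_le_iff₀ (by positivity)]
    nlinarith [norm_nonneg (χ.LFunction a)]
  have h8 : (5 / 3 : ℝ) ^ n ≤ D * (1 + |t|) ^ 4 := by
    have e9 : (3 / 4 / (2 - 3 / 4) : ℝ) ^ n = ((5 / 3 : ℝ) ^ n)⁻¹ := by rw [← inv_pow]; norm_num
    rw [e9] at hJ
    have e10 := hlow.trans hJ
    rw [← div_eq_mul_inv, div_le_div_iff₀ (by positivity) (by positivity)] at e10
    rw [hD]; linarith
  have h9 := Real.log_le_log (by positivity) h8
  rw [Real.log_pow, Real.log_mul hD0.ne' (by positivity), Real.log_pow] at h9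
  have h10 : 1 / 3 ≤ Real.log (5 / 3) := by
    have := Real.one_sub_inv_le_log_of_pos (x := 5 / 3) (by norm_num)
    norm_num at this ⊢; linarith
  have h11 := le_abs_self (Real.log D)
  have h12 : 0 ≤ Real.log (1 + |t|) := Real.log_nonneg hu
  have h13 : (n:ℝ) * (1 / 3) ≤ n * Real.log (5 / 3) := by gcongr
  push_cast at h9
  nlinarith [abs_nonneg (Real.log D), mul_nonneg (abs_nonneg (Real.log D)) h12]
end ZD
end

section
open Complex MeasureTheory Filter Topology
namespace ZD
variable {q : ℕ} [NeZero q]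

/-- window index -/
noncomputable def win (ρ : ℂ) : ℤ := ⌊2 * ρ.im⌋

def LimOK (χ : DirichletCharacter ℂ q) (m : ℂ → ℕ) (ρ : ℂ) : Prop :=
  ∃ c : ℂ, Tendsto (fun s => χ.LFunction s / (s - ρ) ^ m ρ) (𝓝[≠] ρ) (𝓝 c)

lemma window_sum {χ : DirichletCharacter ℂ q} (hχ : χ.IsPrimitive) {e : ℝ} (he : 0 < e) :
    ∃ C > 0, ∀ T : ℝ, 1 ≤ T → ∀ (S : Finset ℂ) (m : ℂ → ℕ), (∀ ρ ∈ S, 1 / 2 ≤ ρ.re ∧ ρ.re < 1 ∧ |ρ.im| ≤ T ∧ LimOK χ m ρ) →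
      (∑ ρ ∈ S, (m ρ : ℝ)) ≤ C * T ^ e * (S.image win).card := by
  classical
  obtain ⟨C, hC, h⟩ := local_count hχ
  obtain ⟨CL, hCL, hlog⟩ := log_pow_le 1 e he
  refine ⟨C * (CL * 3 ^ e), by positivity, fun T hT S m hS => ?_⟩
  have hT0 : 0 < T := by linarith
  rw [← Finset.sum_fiberwise_of_maps_to (g := win) (t := S.image win) (fun ρ hρ => Finset.mem_image_of_mem _ hρ)]
  rw [mul_comm, ← nsmul_eq_mul]
  refine Finset.sum_le_card_nsmul _ _ _ fun w hw => ?_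
  obtain ⟨ρ0, hρ0, hw0⟩ := Finset.mem_image.mp hw
  have hin : ∀ ρ : ℂ, win ρ = w → |ρ.im - ((w:ℝ) + 1 / 2) / 2| ≤ 1 / 4 := fun ρ hρ => by
    have h1 := Int.floor_le (2 * ρ.im)
    have h2 := Int.lt_floor_add_one (2 * ρ.im)
    rw [show ⌊2 * ρ.im⌋ = w from hρ] at h1 h2
    rw [abs_le]; constructor <;> linarith
  have h1 := h (((w:ℝ) + 1 / 2) / 2) (S.filter (fun ρ => win ρ = w)) m (fun ρ hρ => by
    obtain ⟨a, b⟩ := Finset.mem_filter.mp hρ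
    obtain ⟨c1, c2, _, c3⟩ := hS ρ a
    exact ⟨c1, c2, hin ρ b, c3⟩)
  push_cast at h1
  refine h1.trans ?_
  rw [mul_assoc]
  refine mul_le_mul_of_nonneg_left ?_ hC.le
  have h2 : 1 + |((w:ℝ) + 1 / 2) / 2| ≤ 3 * T := by
    have h3 := abs_le.mp (hin ρ0 hw0)
    have h4 := abs_le.mp (hS ρ0 hρ0).2.2.1
    have : |((w:ℝ) + 1 / 2) / 2| ≤ T + 1 / 4 := by rw [abs_le]; constructor <;> linarith
    linarith
  calc 1 + Real.log (1 + |((w:ℝ) + 1 / 2) / 2|) ≤ 1 + Real.log (3 * T) := by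
        have := Real.log_le_log (by positivity) h2
        linarith
    _ ≤ CL * (3 * T) ^ e := by simpa using hlog (3 * T) (by linarith)
    _ = _ := by rw [Real.mul_rpow (by norm_num) hT0.le]; ring

lemma window_card {χ : DirichletCharacter ℂ q} (hχ : χ.IsPrimitive) (hχ' : χ⁻¹.IsPrimitive) {σ d : ℝ} (hσ1 : σ ≤ 1) (hd : 0 < d)
    (hd1 : d ≤ 1 / 100) (hσ0 : 1 / 2 ≤ σ - 2 * d) :
    ∃ C > 0, ∀ T : ℝ, 1 ≤ T → ∀ S : Finset ℂ, (∀ ρ ∈ S, σ ≤ ρ.re ∧ ρ.re < 1 ∧ |ρ.im| ≤ T ∧ χ.LFunction ρ = 0 ∧ 10 ≤ |ρ.im|) →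
      ((S.image win).card : ℝ) ≤ C * T ^ (5 / 2 * (1 - σ) + 23 * d) := by
  classical
  obtain ⟨C, hC, H⟩ := dens_sep hχ hχ' hσ1 hd hd1 hσ0
  refine ⟨3 * C, by positivity, fun T hT S hS => ?_⟩
  set W := S.image win with hW
  have hrep : ∀ w : {w // w ∈ W}, ∃ ρ ∈ S, win ρ = w.1 := fun w => Finset.mem_image.mp w.2
  choose r hr1 hr2 using hrep
  have hcl : ∀ a ∈ Finset.Ico (0:ℤ) 3, ((W.filter (fun w => w % 3 = a)).card : ℝ) ≤ C * T ^ (5 / 2 * (1 - σ) + 23 * d) := fun a _ => by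
    have h1 := H {w : {w // w ∈ W} // w.1 % 3 = a} (fun w => (r w.1).im) (fun w => (r w.1).re) (fun u v huv => by
        have hne : u.1.1 ≠ v.1.1 := fun h => huv (Subtype.ext (Subtype.ext h))
        have e1 := hr2 u.1
        have e2 := hr2 v.1
        have f1 := Int.floor_le (2 * (r u.1).im)
        have f2 := Int.lt_floor_add_one (2 * (r u.1).im)
        have f3 := Int.floor_le (2 * (r v.1).im)
        have f4 := Int.lt_floor_add_one (2 * (r v.1).im)
        rw [show ⌊2 * (r u.1).im⌋ = u.1.1 from e1] at f1 f2
        rw [show ⌊2 * (r v.1).im⌋ = v.1.1 from e2] at f3 f4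
        have g1 := u.2
        have g2 := v.2
        have : u.1.1 + 3 ≤ v.1.1 ∨ v.1.1 + 3 ≤ u.1.1 := by omega
        rw [le_abs]
        rcases this with h | h
        · right
          have : (u.1.1:ℝ) + 3 ≤ v.1.1 := by exact_mod_cast h
          linarith
        · left
          have : (v.1.1:ℝ) + 3 ≤ u.1.1 := by exact_mod_cast h
          linarith) T hT (fun w => (hS _ (hr1 w.1)).2.2.1) (fun w => (hS _ (hr1 w.1)).2.2.2.2) (fun w => (hS _ (hr1 w.1)).1)
        (fun w => (hS _ (hr1 w.1)).2.1.le) (fun w => by rw [Complex.re_add_im]; exact (hS _ (hr1 w.1)).2.2.2.1)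
    refine le_trans (le_of_eq ?_) h1
    norm_cast
    rw [← Fintype.card_coe]
    refine Fintype.card_congr ⟨fun w => ⟨⟨w.1, (Finset.mem_filter.mp w.2).1⟩, (Finset.mem_filter.mp w.2).2⟩,
      fun w => ⟨w.1.1, Finset.mem_filter.mpr ⟨w.1.2, w.2⟩⟩, fun w => rfl, fun w => rfl⟩
  have hsum := Finset.card_eq_sum_card_fiberwise (f := fun w : ℤ => w % 3) (s := W) (t := Finset.Ico (0:ℤ) 3) (fun w _ => by
    simp only [Finset.coe_Ico, Set.mem_Ico]; omega)
  rw [hsum]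
  push_cast
  refine (Finset.sum_le_sum hcl).trans (le_of_eq ?_)
  have h3 : (Finset.Ico (0:ℤ) 3).card = 3 := rfl
  rw [Finset.sum_const, h3, nsmul_eq_mul]
  push_cast; ring

lemma count_main {χ : DirichletCharacter ℂ q} (hχ : χ.IsPrimitive) (hχ' : χ⁻¹.IsPrimitive) {σ ε : ℝ} (hσ : 1 / 2 < σ) (hσ1 : σ ≤ 1) (hε : 0 < ε) :
    ∃ C > 0, ∀ T : ℝ, 1 ≤ T → ∀ (S : Finset ℂ) (m : ℂ → ℕ), (∀ ρ ∈ S, σ ≤ ρ.re ∧ ρ.re < 1 ∧ |ρ.im| ≤ T ∧ χ.LFunction ρ = 0 ∧ LimOK χ m ρ) →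
      (∑ ρ ∈ S, (m ρ : ℝ)) ≤ C * T ^ (5 / 2 * (1 - σ) + ε) := by
  classical
  obtain ⟨d, hd, hd1, hd2, hd3⟩ : ∃ d : ℝ, 0 < d ∧ d ≤ 1 / 100 ∧ d ≤ ε / 24 ∧ d ≤ (σ - 1 / 2) / 2 :=
    ⟨min (1 / 100) (min (ε / 24) ((σ - 1 / 2) / 2)), lt_min (by norm_num) (lt_min (by positivity) (by linarith)), min_le_left _ _,
      (min_le_right _ _).trans (min_le_left _ _), (min_le_right _ _).trans (min_le_right _ _)⟩
  obtain ⟨C1, hC1, h1⟩ := window_sum hχ hd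
  obtain ⟨C2, hC2, h2⟩ := window_card hχ hχ' hσ1 hd hd1 (by linarith)
  refine ⟨C1 * (C2 + 42), by positivity, fun T hT S m hS => ?_⟩
  have hT0 : 0 < T := by linarith
  have a1 := h1 T hT S m (fun ρ hρ => by
    obtain ⟨b1, b2, b3, _, b5⟩ := hS ρ hρ
    exact ⟨by linarith, b2, b3, b5⟩)
  have a2 := h2 T hT (S.filter (fun ρ => 10 ≤ |ρ.im|)) (fun ρ hρ => by
    obtain ⟨b0, b6⟩ := Finset.mem_filter.mp hρ
    obtain ⟨b1, b2, b3, b4, b5⟩ := hS ρ b0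
    exact ⟨b1, b2, b3, b4, b6⟩)
  have a3 : ((S.image win).card : ℝ) ≤ ((S.filter (fun ρ => 10 ≤ |ρ.im|)).image win).card + 42 := by
    have hsub : S.image win ⊆ (S.filter (fun ρ => 10 ≤ |ρ.im|)).image win ∪ Finset.Icc (-21) 20 := by
      intro w hw
      obtain ⟨ρ, hρ, rfl⟩ := Finset.mem_image.mp hw
      by_cases h10 : 10 ≤ |ρ.im|
      · exact Finset.mem_union_left _ (Finset.mem_image_of_mem _ (Finset.mem_filter.mpr ⟨hρ, h10⟩))
      · apply Finset.mem_union_right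
        have h11 := abs_lt.mp (not_le.mp h10)
        rw [Finset.mem_Icc, win]
        constructor
        · rw [Int.le_floor]; push_cast; linarith
        · rw [← Int.lt_add_one_iff, Int.floor_lt]; push_cast; linarith
    have h12 := (Finset.card_le_card hsub).trans (Finset.card_union_le _ _)
    rw [Int.card_Icc] at h12
    have : (20 + 1 - (-21) : ℤ).toNat = 42 := rfl
    rw [this] at h12
    exact_mod_cast h12
  have a4 : 1 ≤ T ^ (5 / 2 * (1 - σ) + 23 * d) := Real.one_le_rpow hT (by nlinarith)
  refine a1.trans ?_
  calc C1 * T ^ d * ((S.image win).card : ℝ) ≤ C1 * T ^ d * ((C2 + 42) * T ^ (5 / 2 * (1 - σ) + 23 * d)) := by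
        refine mul_le_mul_of_nonneg_left ?_ (by positivity)
        linarith
    _ = C1 * (C2 + 42) * (T ^ d * T ^ (5 / 2 * (1 - σ) + 23 * d)) := by ring
    _ ≤ _ := by
      rw [← Real.rpow_add hT0]
      exact mul_le_mul_of_nonneg_left (rpow_le_rpow_T hT (by linarith)) (by positivity)

lemma prim_inv {χ : DirichletCharacter ℂ q} (hχ : χ.IsPrimitive) : χ⁻¹.IsPrimitive := by
  rw [DirichletCharacter.IsPrimitive, DirichletCharacter.conductor_inv]; exact hχ

lemma fe_transfer {χ : DirichletCharacter ℂ q} (hχ : χ.IsPrimitive) {s0 : ℂ} (h0 : 0 < s0.re) (h1 : s0.re < 1)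
    (hz : χ.LFunction s0 = 0) (k : ℕ) {c : ℂ} (hc : Tendsto (fun s : ℂ => χ.LFunction s / (s - s0) ^ k) (𝓝[≠] s0) (𝓝 c)) :
    χ⁻¹.LFunction (1 - s0) = 0 ∧ ∃ c' : ℂ, Tendsto (fun s : ℂ => χ⁻¹.LFunction s / (s - (1 - s0)) ^ k) (𝓝[≠] (1 - s0)) (𝓝 c') := by
  obtain ⟨j, hj, hfe⟩ := L_fe (prim_inv hχ)
  rw [inv_inv] at hfe
  set E : ℂ → ℂ := fun s => (q : ℂ) ^ (1 / 2 - s) * χ⁻¹.rootNumber * (Real.pi : ℂ) ^ (s - 1 / 2) * psi j s with hE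
  have hq : (q:ℂ) ≠ 0 := by exact_mod_cast NeZero.ne q
  have hpi : (Real.pi : ℂ) ≠ 0 := by exact_mod_cast Real.pi_ne_zero
  have hre : (1 - s0).re < 1 := by simp; linarith
  have hne : (1 - s0) ≠ 0 := fun h => by
    have := congrArg Complex.re h
    simp at this; linarith
  have hEc : ContinuousAt E (1 - s0) := by
    have a1 : ContinuousAt (fun s : ℂ => (q : ℂ) ^ (1 / 2 - s)) (1 - s0) := (continuousAt_const_cpow hq).comp (f := fun s : ℂ => 1 / 2 - s) (by fun_prop)
    have a2 : ContinuousAt (fun s : ℂ => (Real.pi : ℂ) ^ (s - 1 / 2)) (1 - s0) := (continuousAt_const_cpow hpi).comp (f := fun s : ℂ => s - 1 / 2) (by fun_prop)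
    exact ((a1.mul continuousAt_const).mul a2).mul (psi_diff j _ hre).continuousAt
  refine ⟨by rw [hfe _ hne hre, sub_sub_cancel, hz, mul_zero], E (1 - s0) * (c * ((-1) ^ k)), ?_⟩
  have b1 : Tendsto (fun s : ℂ => 1 - s) (𝓝[≠] (1 - s0)) (𝓝[≠] s0) := by
    refine tendsto_nhdsWithin_iff.mpr ⟨?_, ?_⟩
    · have : ContinuousAt (fun s : ℂ => 1 - s) (1 - s0) := by fun_prop
      have h2 := this.tendsto
      rw [sub_sub_cancel] at h2
      exact h2.mono_left nhdsWithin_le_nhds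
    · filter_upwards [self_mem_nhdsWithin] with s hs h
      apply hs
      have h : 1 - s = s0 := h
      rw [← h, sub_sub_cancel]; rfl
  have b2 := (hEc.tendsto.mono_left nhdsWithin_le_nhds).mul ((hc.comp b1).mul (tendsto_const_nhds (x := ((-1:ℂ)) ^ k)))
  refine b2.congr' ?_
  have c1 : ∀ᶠ s : ℂ in 𝓝 (1 - s0), s ≠ 0 := isOpen_ne.mem_nhds hne
  have c2 : ∀ᶠ s : ℂ in 𝓝 (1 - s0), s.re < 1 := (isOpen_lt Complex.continuous_re continuous_const).mem_nhds hre
  filter_upwards [eventually_nhdsWithin_of_eventually_nhds c1, eventually_nhdsWithin_of_eventually_nhds c2] with s d1 d2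
  rw [hfe s d1 d2]
  simp only [Function.comp_apply, hE]
  have d3 : s - (1 - s0) = (-1) * (1 - s - s0) := by ring
  rw [d3, mul_pow]
  have d4 : ((-1:ℂ) ^ k)⁻¹ = (-1) ^ k := by rw [← inv_pow]; norm_num
  rw [div_eq_mul_inv _ (((-1:ℂ)) ^ k * _), mul_inv, d4]
  ring

end ZD
end

open Filter Topology

/-- Zero-density estimate (Montgomery): for a primitive Dirichlet character `χ`,
`0 < α < 1/2` and `ε > 0`, the number of zeros `σ` of `L(s,χ)` with `0 < Re σ < α`,
`0 < Im σ < T`, counted with multiplicity, is `≪ T^((5/2)α + ε)`. -/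
theorem dirichlet_zero_density {n : ℕ} [NeZero n] (χ : DirichletCharacter ℂ n) (hχ : χ.IsPrimitive)
    (α ε : ℝ) (hα0 : 0 < α) (hα : α < 1 / 2) (hε : 0 < ε) (m : ℂ → ℕ)
    (hm : ∀ σ : ℂ, 0 < σ.re → σ.re < 1 → ∃ c : ℂ, c ≠ 0 ∧
      Tendsto (fun s : ℂ => χ.LFunction s / (s - σ) ^ (m σ)) (𝓝[≠] σ) (𝓝 c)) :
    ∃ C : ℝ, 0 < C ∧ ∀ T : ℝ, 2 ≤ T →
      (∑' σ : {σ : ℂ // 0 < σ.re ∧ σ.re < α ∧ 0 < σ.im ∧ σ.im < T ∧ χ.LFunction σ = 0}, (m σ.1 : ℝ))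
        ≤ C * T ^ ((5 / 2) * α + ε) := by
  classical
  obtain ⟨C, hC, H⟩ := ZD.count_main (σ := 1 - α) (ZD.prim_inv hχ) (by rw [inv_inv]; exact hχ) (by linarith) (by linarith) hε
  refine ⟨C, hC, fun T hT => ?_⟩
  have hT0 : 0 < T := by linarith
  refine tsum_le_of_sum_le' (by positivity) fun s => ?_
  set i : {σ : ℂ // 0 < σ.re ∧ σ.re < α ∧ 0 < σ.im ∧ σ.im < T ∧ χ.LFunction σ = 0} → ℂ := fun σ => 1 - σ.1 with hi
  have hinj : Function.Injective i := fun a b hab => Subtype.ext (sub_right_injective hab)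
  have h1 := H T (by linarith) (s.image i) (fun ρ => m (1 - ρ)) (fun ρ hρ => by
    obtain ⟨z, hz, rfl⟩ := Finset.mem_image.mp hρ
    obtain ⟨z1, z2, z3, z4, z5⟩ := z.2
    obtain ⟨c, _, hc⟩ := hm z.1 z1 (by linarith)
    obtain ⟨f1, f2⟩ := ZD.fe_transfer hχ z1 (by linarith) z5 (m z.1) hc
    refine ⟨?_, ?_, ?_, f1, ?_⟩
    · simp [hi]; linarith
    · simp [hi]; linarith
    · simp [hi]; rw [abs_of_pos z3]; linarith
    · rw [ZD.LimOK]
      simp only [hi, sub_sub_cancel]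
      exact f2)
  rw [Finset.sum_image (fun a _ b _ hab => hinj hab)] at h1
  simp only [hi, sub_sub_cancel] at h1
  exact h1
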